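/- arXiv:1412.1769 — 5 statements merged into one kernel-verified Lean document; each statement's English description precedes it below -/
import Mathlib

section
/- Let S be a bounded open simply connected subset of ℝ², and let ℓ be a diagonal of S lying on the x-axis. For every point A ∈ S, the set 𝔖(A,ℓ) = {B ∈ vis(A,S) : the open segment AB meets ℓ and |y(A)| ≥ |y(B)|} is measurable and satisfies λ₂(𝔖(A,ℓ)) ≤ 3·sup{λ₂(K) : K ⊆ S convex}. -/
open MeasureTheory
open scoped ENNReal

/-- A line segment in the plane: a bounded convex subset of a line. -/
def IsLineSegment (ℓ : Set (ℝ × ℝ)) : Prop :=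
  Convex ℝ ℓ ∧ Bornology.IsBounded ℓ ∧
    ∃ a b : ℝ × ℝ, a ≠ b ∧ ℓ ⊆ Set.range (AffineMap.lineMap a b : ℝ →ᵃ[ℝ] ℝ × ℝ)

/-- A diagonal of `S`: an inclusion-maximal line segment contained in `S`. -/
def IsDiagonal (S ℓ : Set (ℝ × ℝ)) : Prop :=
  ℓ ⊆ S ∧ IsLineSegment ℓ ∧
    ∀ ℓ' : Set (ℝ × ℝ), ℓ' ⊆ S → IsLineSegment ℓ' → ℓ ⊆ ℓ' → ℓ' = ℓ

lemma edge_aux {S : Set (ℝ × ℝ)} {Q : ℝ × ℝ} {f : ℝ × ℝ → ℂ} (hf : ContinuousOn f S)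
    (he : ∀ x ∈ S, Complex.exp (f x) = (⟨x.1 - Q.1, x.2 - Q.2⟩ : ℂ)) {V W : ℝ × ℝ}
    (hVW : segment ℝ V W ⊆ S)
    (hc : 0 < (V.1 - Q.1) * (W.2 - Q.2) - (V.2 - Q.2) * (W.1 - Q.1)) :
    (f V).im < (f W).im := by
  have hmem : ∀ t ∈ Set.Icc (0:ℝ) 1, V + t • (W - V) ∈ S := by
    intro t ht
    apply hVW
    rw [segment_eq_image']
    exact ⟨t, ht, rfl⟩
  set θ : ℝ → ℝ := fun t => (f (V + t • (W - V))).im - (f V).im with hθ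
  have hcont : ContinuousOn θ (Set.Icc 0 1) := by
    have h1 : ContinuousOn (fun t : ℝ => f (V + t • (W - V))) (Set.Icc 0 1) :=
      hf.comp (by fun_prop) hmem
    exact (Complex.continuous_im.comp_continuousOn h1).sub continuousOn_const
  have hV : V ∈ S := by simpa using hmem 0 (by simp)
  have hsin : ∀ t ∈ Set.Ioc (0:ℝ) 1, 0 < Real.sin (θ t) := by
    intro t ht
    have h1 := he V hV
    have h2 := he _ (hmem t ⟨ht.1.le, ht.2⟩)
    have h1r := congrArg Complex.re h1
    have h1i := congrArg Complex.im h1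
    have h2r := congrArg Complex.re h2
    have h2i := congrArg Complex.im h2
    rw [Complex.exp_re] at h1r h2r
    rw [Complex.exp_im] at h1i h2i
    simp only [Prod.fst_add, Prod.snd_add, Prod.smul_fst, Prod.smul_snd, Prod.fst_sub,
      Prod.snd_sub, smul_eq_mul] at h1r h1i h2r h2i
    set r := Real.exp (f V).re
    set r' := Real.exp (f (V + t • (W - V))).re
    have hr : 0 < r := Real.exp_pos _
    have hr' : 0 < r' := Real.exp_pos _
    have key : r * r' * Real.sin (θ t) =
        t * ((V.1 - Q.1) * (W.2 - Q.2) - (V.2 - Q.2) * (W.1 - Q.1)) := by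
      rw [hθ]
      simp only
      rw [Real.sin_sub]
      calc _ = (r * Real.cos (f V).im) * (r' * Real.sin (f (V + t • (W - V))).im)
            - (r * Real.sin (f V).im) * (r' * Real.cos (f (V + t • (W - V))).im) := by ring
        _ = _ := by rw [h1r, h1i, h2r, h2i]; ring
    have : 0 < r * r' * Real.sin (θ t) := by rw [key]; exact mul_pos ht.1 hc
    exact (mul_pos_iff_of_pos_left (mul_pos hr hr')).1 this
  have h0 : θ 0 = 0 := by simp [hθ]
  have h1 : θ 1 = (f W).im - (f V).im := by simp [hθ]
  by_contra hcon
  have hle : θ 1 ≤ 0 := by rw [h1]; linarith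
  have hs1 := hsin 1 (by simp)
  have hpi : θ 1 ≤ -Real.pi := by
    by_contra hh
    have := Real.sin_nonpos_of_nonpos_of_neg_pi_le hle (by linarith)
    linarith
  have hiv := intermediate_value_Icc' (zero_le_one' ℝ) hcont
  obtain ⟨t, ht, hte⟩ := hiv (show -(Real.pi / 2) ∈ Set.Icc (θ 1) (θ 0) from
    ⟨by linarith [Real.pi_pos], by linarith [Real.pi_pos]⟩)
  have ht0 : t ≠ 0 := by
    rintro rfl
    linarith [Real.pi_pos]
  have := hsin t ⟨lt_of_le_of_ne ht.1 ht0.symm, ht.2⟩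
  rw [hte, Real.sin_neg, Real.sin_pi_div_two] at this
  linarith

lemma tri_pos {S : Set (ℝ × ℝ)} (ho : IsOpen S) (hsc : SimplyConnectedSpace S)
    {A C D : ℝ × ℝ} (hAC : segment ℝ A C ⊆ S) (hCD : segment ℝ C D ⊆ S)
    (hDA : segment ℝ D A ⊆ S)
    (hc : 0 < (C.1 - A.1) * (D.2 - A.2) - (C.2 - A.2) * (D.1 - A.1))
    {s t : ℝ} (hs0 : 0 < s) (hs1 : s < 1) (ht0 : 0 < t) (ht1 : t < 1) :
    A + s • ((C + t • (D - C)) - A) ∈ S := by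
  by_contra hQ
  set Q := A + s • ((C + t • (D - C)) - A) with hQd
  have hQ1 : Q.1 = A.1 + s * ((C.1 + t * (D.1 - C.1)) - A.1) := by simp [hQd]
  have hQ2 : Q.2 = A.2 + s * ((C.2 + t * (D.2 - C.2)) - A.2) := by simp [hQd]
  clear_value Q
  obtain ⟨f, hf, he⟩ := Complex.exists_continuousOn_eqOn_exp_comp
    (g := fun x : ℝ × ℝ => (⟨x.1 - Q.1, x.2 - Q.2⟩ : ℂ)) (U := S) hsc ho
    (by
      have : (fun x : ℝ × ℝ => (⟨x.1 - Q.1, x.2 - Q.2⟩ : ℂ)) =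
          fun x : ℝ × ℝ => ((x.1 - Q.1 : ℝ) : ℂ) + ((x.2 - Q.2 : ℝ) : ℂ) * Complex.I := by
        funext x
        exact Complex.mk_eq_add_mul_I _ _
      rw [this]
      fun_prop)
    (by
      rintro ⟨x, hx, h⟩
      have h1 := congrArg Complex.re h
      have h2 := congrArg Complex.im h
      simp only [Complex.zero_re, Complex.zero_im] at h1 h2
      have : x = Q := Prod.ext (by linarith) (by linarith)
      exact hQ (this ▸ hx))
  have he' : ∀ x ∈ S, Complex.exp (f x) = (⟨x.1 - Q.1, x.2 - Q.2⟩ : ℂ) := fun x hx => he hx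
  set Δ := (C.1 - A.1) * (D.2 - A.2) - (C.2 - A.2) * (D.1 - A.1) with hΔ
  have e1 := edge_aux hf he' hAC (by
    have : (A.1 - Q.1) * (C.2 - Q.2) - (A.2 - Q.2) * (C.1 - Q.1) = s * t * Δ := by
      rw [hQ1, hQ2, hΔ]; ring
    rw [this]; positivity)
  have e2 := edge_aux hf he' hCD (by
    have : (C.1 - Q.1) * (D.2 - Q.2) - (C.2 - Q.2) * (D.1 - Q.1) = (1 - s) * Δ := by
      rw [hQ1, hQ2, hΔ]; ring
    rw [this]; exact mul_pos (by linarith) hc)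
  have e3 := edge_aux hf he' hDA (by
    have : (D.1 - Q.1) * (A.2 - Q.2) - (D.2 - Q.2) * (A.1 - Q.1) = s * (1 - t) * Δ := by
      rw [hQ1, hQ2, hΔ]; ring
    rw [this]; exact mul_pos (mul_pos hs0 (by linarith)) hc)
  linarith

lemma tri_mem {S : Set (ℝ × ℝ)} (ho : IsOpen S) (hsc : SimplyConnectedSpace S)
    {A C D : ℝ × ℝ} (hAC : segment ℝ A C ⊆ S) (hCD : segment ℝ C D ⊆ S)
    (hAD : segment ℝ A D ⊆ S) (hA : A.2 ≠ 0) (hC : C.2 = 0) (hD : D.2 = 0)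
    {P : ℝ × ℝ} (hP : P ∈ segment ℝ C D) : segment ℝ A P ⊆ S := by
  intro Q hQ
  have hPS := hCD hP
  have hAS := hAC (left_mem_segment ℝ A C)
  rw [segment_eq_image'] at hP hQ
  obtain ⟨t, ht, rfl⟩ := hP
  obtain ⟨s, hs, rfl⟩ := hQ
  simp only at hPS ⊢
  rcases eq_or_lt_of_le hs.1 with rfl | hs0
  · simpa using hAS
  rcases eq_or_lt_of_le hs.2 with rfl | hs1
  · simpa using hPS
  rcases eq_or_lt_of_le ht.1 with rfl | ht0
  · apply hAC
    rw [segment_eq_image']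
    exact ⟨s, hs, by simp⟩
  rcases eq_or_lt_of_le ht.2 with rfl | ht1
  · apply hAD
    rw [segment_eq_image']
    exact ⟨s, hs, by simp⟩
  rcases lt_trichotomy ((C.1 - A.1) * (D.2 - A.2) - (C.2 - A.2) * (D.1 - A.1)) 0 with h | h | h
  · have := tri_pos ho hsc (A := A) (C := D) (D := C) (s := s) (t := 1 - t) hAD
      (by rwa [segment_symm]) (by rwa [segment_symm]) (by linarith) hs0 hs1 (by linarith)
      (by linarith)
    convert this using 3
    module
  · have hCD' : C = D := by
      rw [hC, hD] at h
      have : A.2 * (D.1 - C.1) = 0 := by linarith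
      rcases mul_eq_zero.1 this with h | h
      · exact absurd h hA
      · exact Prod.ext (by linarith) (by rw [hC, hD])
    subst hCD'
    apply hAC
    rw [segment_eq_image']
    exact ⟨s, hs, by simp⟩
  · exact tri_pos ho hsc hAC hCD (by rwa [segment_symm]) h hs0 hs1 ht0 ht1

lemma isOpen_vis {S : Set (ℝ × ℝ)} (ho : IsOpen S) (A : ℝ × ℝ) :
    IsOpen {B : ℝ × ℝ | segment ℝ A B ⊆ S} := by
  have : {B : ℝ × ℝ | segment ℝ A B ⊆ S} =
      {B : ℝ × ℝ | ∀ t ∈ Set.Icc (0:ℝ) 1, A + t • (B - A) ∈ S} := by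
    ext B
    simp only [Set.mem_setOf_eq, segment_eq_image', Set.image_subset_iff]
    rfl
  rw [this, isOpen_iff_mem_nhds]
  intro B hB
  have := isCompact_Icc.eventually_forall_of_forall_eventually (x₀ := B)
    (P := fun (B : ℝ × ℝ) (t : ℝ) => A + t • (B - A) ∈ S) (K := Set.Icc (0:ℝ) 1)
    (fun t ht => by
      have hc : Continuous fun p : (ℝ × ℝ) × ℝ => A + p.2 • (p.1 - A) := by fun_prop
      exact hc.continuousAt.preimage_mem_nhds (ho.mem_nhds (hB t ht)))
  exact this

lemma cross_iff {ℓ : Set (ℝ × ℝ)} (hx : ∀ p ∈ ℓ, p.2 = 0) {A B : ℝ × ℝ} (hA : A.2 ≠ 0) :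
    (openSegment ℝ A B ∩ ℓ).Nonempty ↔
      A.2 * B.2 < 0 ∧ ((A.1 * B.2 - B.1 * A.2) / (B.2 - A.2), (0:ℝ)) ∈ ℓ := by
  constructor
  · rintro ⟨P, hP, hPl⟩
    have h0 := hx P hPl
    rw [openSegment_eq_image'] at hP
    obtain ⟨t, ht, rfl⟩ := hP
    simp only [Prod.snd_add, Prod.smul_snd, Prod.snd_sub, smul_eq_mul] at h0
    have h1 : t * B.2 = (t - 1) * A.2 := by linarith
    have hsq : 0 < A.2 ^ 2 := by positivity
    have h2 : A.2 * B.2 < 0 := by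
      have : t * (A.2 * B.2) = (t - 1) * A.2 ^ 2 := by linear_combination A.2 * h1
      by_contra hh
      have : 0 ≤ t * (A.2 * B.2) := mul_nonneg ht.1.le (not_lt.1 hh)
      nlinarith [ht.2]
    refine ⟨h2, ?_⟩
    have hne : B.2 - A.2 ≠ 0 := by
      intro h
      have : B.2 = A.2 := by linarith
      rw [this] at h2
      nlinarith
    convert hPl using 1
    apply Prod.ext
    · simp only [Prod.fst_add, Prod.smul_fst, Prod.fst_sub, smul_eq_mul]
      rw [div_eq_iff hne]
      linear_combination (A.1 - B.1) * h0
    · simp only [Prod.snd_add, Prod.smul_snd, Prod.snd_sub, smul_eq_mul]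
      linarith
  · rintro ⟨h2, hl⟩
    have hne : A.2 - B.2 ≠ 0 := by
      intro h
      have : B.2 = A.2 := by linarith
      rw [this] at h2
      nlinarith
    have hne' : B.2 - A.2 ≠ 0 := by
      intro h; apply hne; linarith
    refine ⟨_, ?_, hl⟩
    rw [openSegment_eq_image']
    refine ⟨A.2 / (A.2 - B.2), ⟨?_, ?_⟩, ?_⟩
    · have : A.2 / (A.2 - B.2) = A.2 * (A.2 - B.2) / (A.2 - B.2) ^ 2 := by field_simp
      rw [this]
      apply div_pos
      · nlinarith [sq_nonneg A.2]
      · positivity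
    · have : A.2 / (A.2 - B.2) = 1 - (B.2 * (B.2 - A.2)) / (A.2 - B.2) ^ 2 := by
        field_simp; ring
      rw [this]
      have : 0 < (B.2 * (B.2 - A.2)) / (A.2 - B.2) ^ 2 := by
        apply div_pos
        · nlinarith [sq_nonneg B.2]
        · positivity
      linarith
    · apply Prod.ext
      · simp only [Prod.fst_add, Prod.smul_fst, Prod.fst_sub, smul_eq_mul]
        field_simp
        ring
      · simp only [Prod.snd_add, Prod.smul_snd, Prod.snd_sub, smul_eq_mul]
        field_simp
        ring

lemma meas_trace {ℓ : Set (ℝ × ℝ)} (hc : Convex ℝ ℓ) :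
    MeasurableSet {x : ℝ | (x, (0:ℝ)) ∈ ℓ} := by
  have : Convex ℝ {x : ℝ | (x, (0:ℝ)) ∈ ℓ} :=
    hc.linear_preimage (LinearMap.inl ℝ ℝ ℝ)
  exact this.ordConnected.measurableSet

lemma cross_iff_zero {ℓ : Set (ℝ × ℝ)} (hx : ∀ p ∈ ℓ, p.2 = 0) {A B : ℝ × ℝ} (hA : A.2 = 0)
    (hB : B.2 = 0) :
    (openSegment ℝ A B ∩ ℓ).Nonempty ↔
      B.1 ∈ (⋃ i ∈ {i : ℝ | (i, (0:ℝ)) ∈ ℓ ∧ A.1 < i}, Set.Ioi i) ∪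
        (⋃ i ∈ {i : ℝ | (i, (0:ℝ)) ∈ ℓ ∧ i < A.1}, Set.Iio i) ∪
        {b | b = A.1 ∧ (A.1, (0:ℝ)) ∈ ℓ} := by
  obtain ⟨a, a2⟩ := A
  obtain ⟨b, b2⟩ := B
  simp only at hA hB
  subst hA hB
  simp only [Set.mem_union, Set.mem_iUnion, Set.mem_setOf_eq, Set.mem_Ioi, Set.mem_Iio,
    exists_prop]
  have key : ∀ i : ℝ, (i, (0:ℝ)) ∈ openSegment ℝ (a, (0:ℝ)) (b, (0:ℝ)) ↔
      i ∈ openSegment ℝ a b := by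
    intro i
    simp [openSegment_eq_image']
  constructor
  · rintro ⟨⟨i, i2⟩, hi, hil⟩
    have := hx _ hil
    simp only at this
    subst this
    rw [key] at hi
    rcases lt_trichotomy a b with h | h | h
    · rw [openSegment_eq_Ioo h] at hi
      exact Or.inl (Or.inl ⟨i, ⟨hil, hi.1⟩, hi.2⟩)
    · subst h
      rw [openSegment_same] at hi
      rw [Set.mem_singleton_iff] at hi
      subst hi
      exact Or.inr ⟨rfl, hil⟩
    · rw [openSegment_symm, openSegment_eq_Ioo h] at hi
      exact Or.inl (Or.inr ⟨i, ⟨hil, hi.2⟩, hi.1⟩)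
  · rintro ((⟨i, ⟨hil, h1⟩, h2⟩ | ⟨i, ⟨hil, h1⟩, h2⟩) | ⟨rfl, h⟩)
    · refine ⟨_, (key i).2 ?_, hil⟩
      rw [openSegment_eq_Ioo (h1.trans h2)]
      exact ⟨h1, h2⟩
    · refine ⟨_, (key i).2 ?_, hil⟩
      rw [openSegment_symm, openSegment_eq_Ioo (h2.trans h1)]
      exact ⟨h2, h1⟩
    · exact ⟨_, (key b).2 (by simp [openSegment_same]), h⟩

lemma meas_cross {ℓ : Set (ℝ × ℝ)} (hc : Convex ℝ ℓ) (hx : ∀ p ∈ ℓ, p.2 = 0) (A : ℝ × ℝ) :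
    MeasurableSet {B : ℝ × ℝ | (openSegment ℝ A B ∩ ℓ).Nonempty ∧ |B.2| ≤ |A.2|} := by
  have habs : MeasurableSet {B : ℝ × ℝ | |B.2| ≤ |A.2|} :=
    (isClosed_le (by fun_prop) (by fun_prop)).measurableSet
  by_cases hA : A.2 = 0
  · have hM : MeasurableSet ((⋃ i ∈ {i : ℝ | (i, (0:ℝ)) ∈ ℓ ∧ A.1 < i}, Set.Ioi i) ∪
        (⋃ i ∈ {i : ℝ | (i, (0:ℝ)) ∈ ℓ ∧ i < A.1}, Set.Iio i) ∪
        {b | b = A.1 ∧ (A.1, (0:ℝ)) ∈ ℓ}) := by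
      refine MeasurableSet.union (MeasurableSet.union ?_ ?_) ?_
      · exact (isOpen_biUnion fun i _ => isOpen_Ioi).measurableSet
      · exact (isOpen_biUnion fun i _ => isOpen_Iio).measurableSet
      · apply Set.Subsingleton.measurableSet
        rintro x ⟨rfl, -⟩ y ⟨rfl, -⟩
        rfl
    convert (measurable_fst hM).inter habs using 1
    ext B
    simp only [Set.mem_setOf_eq, Set.mem_inter_iff, Set.mem_preimage]
    refine and_congr_left fun h => ?_
    have hB : B.2 = 0 := by rw [hA, abs_zero] at h; exact abs_nonpos_iff.1 h
    exact cross_iff_zero hx hA hB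
  · have h1 : MeasurableSet {B : ℝ × ℝ | A.2 * B.2 < 0} :=
      (isOpen_lt (by fun_prop) (by fun_prop)).measurableSet
    have h2 : Measurable fun B : ℝ × ℝ => (A.1 * B.2 - B.1 * A.2) / (B.2 - A.2) := by fun_prop
    convert (h1.inter (h2 (meas_trace hc))).inter habs using 1
    ext B
    simp only [Set.mem_setOf_eq, Set.mem_inter_iff, Set.mem_preimage]
    rw [cross_iff hx hA]

/-- For a bounded open simply connected `S ⊆ ℝ²` with a diagonal `ℓ` on
the x-axis and `A ∈ S`, the set `𝔖(A,ℓ)` of points `B` visible from `A` with `AB`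
crossing `ℓ` and `|y(A)| ≥ |y(B)|` is measurable of measure at most `3·sup c(S)`. -/
theorem crossing_visibility_bound (S ℓ : Set (ℝ × ℝ))
    (hb : Bornology.IsBounded S) (ho : IsOpen S) (hsc : SimplyConnectedSpace S)
    (hdiag : IsDiagonal S ℓ) (hx : ∀ p ∈ ℓ, p.2 = 0)
    (A : ℝ × ℝ) (hA : A ∈ S) :
    MeasurableSet {B : ℝ × ℝ | B ∈ S ∧ segment ℝ A B ⊆ S ∧
        (openSegment ℝ A B ∩ ℓ).Nonempty ∧ |B.2| ≤ |A.2|} ∧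
      volume {B : ℝ × ℝ | B ∈ S ∧ segment ℝ A B ⊆ S ∧
        (openSegment ℝ A B ∩ ℓ).Nonempty ∧ |B.2| ≤ |A.2|} ≤
        3 * ⨆ (K : Set (ℝ × ℝ)) (_ : K ⊆ S ∧ Convex ℝ K), volume K := by
  have hcx : Convex ℝ ℓ := hdiag.2.1.1
  set T := {B : ℝ × ℝ | B ∈ S ∧ segment ℝ A B ⊆ S ∧
        (openSegment ℝ A B ∩ ℓ).Nonempty ∧ |B.2| ≤ |A.2|} with hT
  have hmeas : MeasurableSet T := by
    have : T = S ∩ ({B : ℝ × ℝ | segment ℝ A B ⊆ S} ∩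
        {B : ℝ × ℝ | (openSegment ℝ A B ∩ ℓ).Nonempty ∧ |B.2| ≤ |A.2|}) := rfl
    rw [this]
    exact ho.measurableSet.inter ((isOpen_vis ho A).measurableSet.inter (meas_cross hcx hx A))
  refine ⟨hmeas, ?_⟩
  by_cases hA2 : A.2 = 0
  · have hsub : T ⊆ Set.univ ×ˢ {(0:ℝ)} := by
      rintro B ⟨-, -, -, h⟩
      rw [hA2, abs_zero] at h
      exact ⟨trivial, abs_nonpos_iff.1 h⟩
    have : volume T = 0 := by
      apply measure_mono_null hsub
      rw [Measure.volume_eq_prod, Measure.prod_prod]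
      simp
    rw [this]
    exact zero_le
  rcases T.eq_empty_or_nonempty with hTe | hTne
  · rw [hTe]; simp
  set J := {P : ℝ × ℝ | P ∈ ℓ ∧ segment ℝ A P ⊆ S} with hJ
  have hJc : Convex ℝ J := by
    rw [convex_iff_segment_subset]
    intro C hC D hD P hP
    have hCD : segment ℝ C D ⊆ ℓ := hcx.segment_subset hC.1 hD.1
    exact ⟨hCD hP, tri_mem ho hsc hC.2 (hCD.trans hdiag.1) hD.2 hA2 (hx C hC.1) (hx D hD.1) hP⟩
  -- every point of T lies on a doubled segment
  have hTJ : ∀ B ∈ T, A.2 * B.2 < 0 ∧ ∃ P ∈ J, ∃ r ∈ Set.Icc (0:ℝ) 2, B = A + r • (P - A) := by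
    rintro B ⟨-, hB, hcr, hab⟩
    have hs := ((cross_iff hx hA2).1 hcr).1
    refine ⟨hs, ?_⟩
    obtain ⟨P, hP, hPl⟩ := hcr
    refine ⟨P, ⟨hPl, ((convex_segment A B).segment_subset (left_mem_segment ℝ A B)
      (openSegment_subset_segment ℝ A B hP)).trans hB⟩, ?_⟩
    have h0 := hx P hPl
    rw [openSegment_eq_image'] at hP
    obtain ⟨t, ht, rfl⟩ := hP
    simp only [Prod.snd_add, Prod.smul_snd, Prod.snd_sub, smul_eq_mul] at h0
    have htne : t ≠ 0 := ht.1.ne'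
    refine ⟨t⁻¹, ⟨by have := ht.1; positivity, ?_⟩, ?_⟩
    · have hhalf : 1 / 2 ≤ t := by
        have hsq := sq_le_sq.2 hab
        have hpos : 0 < A.2 ^ 2 := by positivity
        have e : t ^ 2 * B.2 ^ 2 = (1 - t) ^ 2 * A.2 ^ 2 := by
          linear_combination (t * B.2 + (t - 1) * A.2) * h0
        have : (1 - t) ^ 2 * A.2 ^ 2 ≤ t ^ 2 * A.2 ^ 2 := by
          rw [← e]; exact mul_le_mul_of_nonneg_left hsq (sq_nonneg t)
        have := le_of_mul_le_mul_right this hpos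
        nlinarith
      rw [inv_le_comm₀ ht.1 (by norm_num)]
      linarith
    · rw [add_sub_cancel_left, smul_smul, inv_mul_cancel₀ htne, one_smul, add_sub_cancel]
  obtain ⟨B₀, hB₀⟩ := hTne
  obtain ⟨-, P₀, hP₀, -⟩ := hTJ B₀ hB₀
  set K := convexHull ℝ (insert A J) with hK
  have hKmem : ∀ x, x ∈ K ↔ ∃ P ∈ J, x ∈ segment ℝ A P := by
    intro x
    rw [hK, convexHull_insert ⟨P₀, hP₀⟩, hJc.convexHull_eq, mem_convexJoin]
    simp
  have hKS : K ⊆ S := by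
    intro x hxK
    obtain ⟨P, hP, hxP⟩ := (hKmem x).1 hxK
    exact hP.2 hxP
  have hTK : Disjoint K T := by
    rw [Set.disjoint_left]
    intro x hxK hxT
    obtain ⟨P, hP, hxP⟩ := (hKmem x).1 hxK
    have h1 := (hTJ x hxT).1
    rw [segment_eq_image'] at hxP
    obtain ⟨t, ht, rfl⟩ := hxP
    have h0 := hx P hP.1
    simp only [Prod.snd_add, Prod.smul_snd, Prod.snd_sub, smul_eq_mul, h0] at h1
    nlinarith [mul_nonneg (sub_nonneg.2 ht.2) (sq_nonneg A.2)]
  have hsub : K ∪ T ⊆ AffineMap.homothety A (2:ℝ) '' K := by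
    have main : ∀ P ∈ J, ∀ r ∈ Set.Icc (0:ℝ) 2,
        A + r • (P - A) ∈ AffineMap.homothety A (2:ℝ) '' K := by
      intro P hP r hr
      refine ⟨A + (r / 2) • (P - A), (hKmem _).2 ⟨P, hP, ?_⟩, ?_⟩
      · rw [segment_eq_image']
        exact ⟨r / 2, ⟨by linarith [hr.1], by linarith [hr.2]⟩, rfl⟩
      · rw [AffineMap.homothety_apply]
        simp only [vsub_eq_sub, vadd_eq_add]
        module
    rintro x (hxK | hxT)
    · obtain ⟨P, hP, hxP⟩ := (hKmem x).1 hxK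
      rw [segment_eq_image'] at hxP
      obtain ⟨t, ht, rfl⟩ := hxP
      exact main P hP t ⟨ht.1, by linarith [ht.2]⟩
    · obtain ⟨-, P, hP, r, hr, rfl⟩ := hTJ x hxT
      exact main P hP r hr
  have hvol : volume K + volume T ≤ 4 * volume K := by
    rw [← measure_union hTK hmeas]
    refine (measure_mono hsub).trans ?_
    rw [Measure.addHaar_image_homothety]
    have : Module.finrank ℝ (ℝ × ℝ) = 2 := by simp
    rw [this]
    norm_num
  have hfin : volume K ≠ ⊤ := ((measure_mono hKS).trans_lt hb.measure_lt_top).ne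
  have h3 : volume T ≤ 3 * volume K := by
    have : volume K + volume T ≤ volume K + 3 * volume K := by
      refine hvol.trans (le_of_eq ?_)
      ring
    exact (ENNReal.add_le_add_iff_left hfin).1 this
  refine h3.trans ?_
  gcongr
  exact le_iSup₂_of_le K ⟨hKS, convex_convexHull ℝ _⟩ le_rfl
end

section
/- Let S be a simply connected subset of ℝ² containing segments [A,A'] and [B,B'] with A,B on a common segment ℓ ⊆ S and A',B' on a common segment ℓ' ⊆ S. Then every point C of the segment [A,B] is visible from some point of [A',B'] in S; i.e., [A,B] ⊆ vis([A',B'], S). -/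
open Complex in
theorem lift_endpoint {X : Type*} [TopologicalSpace X] [SimplyConnectedSpace X]
    (f : X → ℂ) (hf : Continuous f) (hf0 : ∀ x, f x ≠ 0) {x y : X} (γ₀ γ₁ : Path x y)
    {e e₀ e₁ : ℂ} (Γ₀ : Path e e₀) (Γ₁ : Path e e₁)
    (h₀ : ∀ t, exp (Γ₀ t) = f (γ₀ t)) (h₁ : ∀ t, exp (Γ₁ t) = f (γ₁ t)) : e₀ = e₁ := by
  let g : C(X, {z : ℂ // z ≠ 0}) := ⟨fun x => ⟨f x, hf0 x⟩, by fun_prop⟩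
  have hh : Path.Homotopic γ₀ γ₁ := SimplyConnectedSpace.paths_homotopic γ₀ γ₁
  have hm := hh.map g
  have a0 : (γ₀.map g.continuous).toContinuousMap 0 =
      (⟨_, exp_ne_zero e⟩ : {z : ℂ // z ≠ 0}) := by
    apply Subtype.ext
    have := h₀ 0
    simp at this
    simp [g, this]
  have a1 : (γ₁.map g.continuous).toContinuousMap 0 =
      (⟨_, exp_ne_zero e⟩ : {z : ℂ // z ≠ 0}) := by
    apply Subtype.ext
    have := h₁ 0
    simp at this
    simp [g, this]
  have key := Complex.isCoveringMap_exp.liftPath_apply_one_eq_of_homotopicRel hm e a0 a1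
  have b0 := (Complex.isCoveringMap_exp.eq_liftPath_iff' a0 (Γ := Γ₀.toContinuousMap)).2
    ⟨by ext t; exact h₀ t, Γ₀.source⟩
  have b1 := (Complex.isCoveringMap_exp.eq_liftPath_iff' a1 (Γ := Γ₁.toContinuousMap)).2
    ⟨by ext t; exact h₁ t, Γ₁.source⟩
  rw [← b0, ← b1] at key
  simpa using key

/-- position of `P` relative to `p`, as a complex number -/
noncomputable def zrel (p P : ℝ × ℝ) : ℂ := ⟨P.1 - p.1, P.2 - p.2⟩

/-- signed angle at `p` from `P` to `Q` -/
noncomputable def ang (p P Q : ℝ × ℝ) : ℝ := (zrel p Q / zrel p P).arg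

/-- cross product of `P - p` and `Q - p` -/
def crs (p P Q : ℝ × ℝ) : ℝ := (P.1 - p.1) * (Q.2 - p.2) - (P.2 - p.2) * (Q.1 - p.1)

theorem mem_seg {P Q x : ℝ × ℝ} : x ∈ segment ℝ P Q ↔
    ∃ t : ℝ, 0 ≤ t ∧ t ≤ 1 ∧ x.1 = P.1 + t * (Q.1 - P.1) ∧ x.2 = P.2 + t * (Q.2 - P.2) := by
  rw [segment_eq_image']
  constructor
  · rintro ⟨t, ⟨h0, h1⟩, rfl⟩
    exact ⟨t, h0, h1, by simp, by simp⟩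
  · rintro ⟨t, h0, h1, h2, h3⟩
    exact ⟨t, ⟨h0, h1⟩, by ext <;> simp [h2, h3]⟩

theorem zrel_ne {p P : ℝ × ℝ} (h : P ≠ p) : zrel p P ≠ 0 := by
  intro h0
  apply h
  have h1 := congrArg Complex.re h0
  have h2 := congrArg Complex.im h0
  simp only [zrel, Complex.zero_re, Complex.zero_im] at h1 h2
  ext <;> linarith

theorem slit_of {p P Q : ℝ × ℝ} (h : p ∉ segment ℝ P Q) :
    zrel p Q / zrel p P ∈ Complex.slitPlane := by
  by_contra hn
  have hP : P ≠ p := by rintro rfl; exact h (left_mem_segment ℝ _ _)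
  have hz := zrel_ne hP
  rw [Complex.mem_slitPlane_iff] at hn
  push Not at hn
  obtain ⟨hre, him⟩ := hn
  set r := (zrel p Q / zrel p P).re with hr
  have hq : zrel p Q = (r : ℂ) * zrel p P := by
    rw [← div_eq_iff hz]
    apply Complex.ext <;> simp [hr, him]
  have h1 := congrArg Complex.re hq
  have h2 := congrArg Complex.im hq
  simp [zrel] at h1 h2
  apply h
  rw [mem_seg]
  have h1r : 0 < 1 - r := by linarith
  refine ⟨1 / (1 - r), by positivity, ?_, ?_, ?_⟩
  · rw [div_le_one h1r]; linarith
  · field_simp; linarith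
  · field_simp; linarith

theorem edge_lift {S : Set (ℝ × ℝ)} {p P Q : ℝ × ℝ} (hP : P ∈ S) (hQ : Q ∈ S)
    (hp : p ∉ S) (h : segment ℝ P Q ⊆ S) :
    ∃ γ : Path (⟨P, hP⟩ : S) ⟨Q, hQ⟩, ∀ e, Complex.exp e = zrel p P →
      ∃ Γ : Path e (e + Complex.log (zrel p Q / zrel p P)),
        ∀ t, Complex.exp (Γ t) = zrel p (γ t).1 := by
  have hm : ∀ t : unitInterval, P + (t : ℝ) • (Q - P) ∈ segment ℝ P Q := by
    intro t
    rw [segment_eq_image']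
    exact ⟨t, t.2, rfl⟩
  refine ⟨⟨⟨fun t => ⟨P + (t : ℝ) • (Q - P), h (hm t)⟩, by fun_prop⟩, by simp, by simp⟩, ?_⟩
  intro e he
  have hz : zrel p P ≠ 0 := by rw [← he]; exact Complex.exp_ne_zero e
  have hs : ∀ t : unitInterval, zrel p (P + (t : ℝ) • (Q - P)) / zrel p P ∈ Complex.slitPlane := by
    intro t
    apply slit_of
    intro hh
    apply hp
    apply h
    exact (convex_segment P Q).segment_subset (left_mem_segment ℝ _ _) (hm t) hh
  have hc : Continuous fun t : unitInterval => zrel p (P + (t : ℝ) • (Q - P)) / zrel p P := by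
    have : (fun t : unitInterval => zrel p (P + (t : ℝ) • (Q - P))) =
        fun t : unitInterval => zrel p P + ((t : ℝ) : ℂ) * (zrel p Q - zrel p P) := by
      funext t
      apply Complex.ext <;> simp [zrel] <;> ring
    have h2 : Continuous (fun t : unitInterval => zrel p (P + (t : ℝ) • (Q - P))) := by
      rw [this]; fun_prop
    exact h2.div_const _
  refine ⟨⟨⟨fun t => e + Complex.log (zrel p (P + (t : ℝ) • (Q - P)) / zrel p P), ?_⟩, ?_, ?_⟩, ?_⟩
  · exact continuous_const.add (hc.clog hs)
  · simp [hz]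
  · simp
  · intro t
    change Complex.exp (e + Complex.log (zrel p (P + (t : ℝ) • (Q - P)) / zrel p P)) =
      zrel p (P + (t : ℝ) • (Q - P))
    rw [Complex.exp_add, Complex.exp_log (Complex.slitPlane_ne_zero (hs t)), he]
    field_simp

theorem ang_range {p P Q : ℝ × ℝ} (h : p ∉ segment ℝ P Q) :
    -Real.pi < ang p P Q ∧ ang p P Q < Real.pi :=
  ⟨Complex.neg_pi_lt_arg _, lt_of_le_of_ne (Complex.arg_le_pi _) (Complex.slitPlane_arg_ne_pi (slit_of h))⟩

theorem ang_swap {p P Q : ℝ × ℝ} (h : p ∉ segment ℝ P Q) : ang p Q P = - ang p P Q := by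
  have := Complex.arg_inv (zrel p Q / zrel p P)
  rw [if_neg (Complex.slitPlane_arg_ne_pi (slit_of h)), inv_div] at this
  exact this

theorem im_eq (p P Q : ℝ × ℝ) :
    (zrel p Q / zrel p P).im = crs p P Q / Complex.normSq (zrel p P) := by
  rw [Complex.div_im]
  simp only [zrel, crs]
  ring

theorem nsq_pos {p P Q : ℝ × ℝ} (h : p ∉ segment ℝ P Q) : 0 < Complex.normSq (zrel p P) := by
  have hP : P ≠ p := by rintro rfl; exact h (left_mem_segment ℝ _ _)
  exact Complex.normSq_pos.2 (zrel_ne hP)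

theorem ang_nonneg {p P Q : ℝ × ℝ} (h : p ∉ segment ℝ P Q) (hc : 0 ≤ crs p P Q) :
    0 ≤ ang p P Q := by
  rw [ang, Complex.arg_nonneg_iff, im_eq]
  exact div_nonneg hc (nsq_pos h).le

theorem ang_neg {p P Q : ℝ × ℝ} (h : p ∉ segment ℝ P Q) (hc : crs p P Q < 0) :
    ang p P Q < 0 := by
  rw [ang, Complex.arg_neg_iff, im_eq]
  exact div_neg_of_neg_of_pos hc (nsq_pos h)

theorem crs_swap (p P Q : ℝ × ℝ) : crs p Q P = - crs p P Q := by simp only [crs]; ring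

theorem ang_pos {p P Q : ℝ × ℝ} (h : p ∉ segment ℝ P Q) (hc : 0 < crs p P Q) :
    0 < ang p P Q := by
  have h' : p ∉ segment ℝ Q P := by rwa [segment_symm]
  have := ang_neg h' (by rw [crs_swap]; linarith)
  rw [ang_swap h] at this
  linarith

theorem ang_add {p P Q R : ℝ × ℝ} (h1 : p ∉ segment ℝ P Q) (h2 : p ∉ segment ℝ Q R)
    (h : -Real.pi < ang p P Q + ang p Q R) (h' : ang p P Q + ang p Q R < Real.pi) :
    ang p P R = ang p P Q + ang p Q R := by
  have hP : zrel p P ≠ 0 := zrel_ne (by rintro rfl; exact h1 (left_mem_segment ℝ _ _))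
  have hQ : zrel p Q ≠ 0 := zrel_ne (by rintro rfl; exact h2 (left_mem_segment ℝ _ _))
  have hR : zrel p R ≠ 0 := zrel_ne (by rintro rfl; exact h2 (right_mem_segment ℝ _ _))
  have := (Complex.arg_mul_eq_add_arg_iff (div_ne_zero hQ hP) (div_ne_zero hR hQ)).2 ⟨h, h'.le⟩
  simp only [ang]
  rw [← this]
  congr 1
  field_simp

/-- the boundary of the tetragon is contained in `S` -/
structure Tet (S : Set (ℝ × ℝ)) (A B A' B' : ℝ × ℝ) : Prop where
  ab : segment ℝ A B ⊆ S
  bb : segment ℝ B B' ⊆ S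
  ba : segment ℝ B' A' ⊆ S
  aa : segment ℝ A' A ⊆ S

theorem Tet.swap {S : Set (ℝ × ℝ)} {A B A' B' : ℝ × ℝ} (h : Tet S A B A' B') :
    Tet S B A B' A' :=
  ⟨by rw [segment_symm]; exact h.ab, by rw [segment_symm]; exact h.aa,
   by rw [segment_symm]; exact h.ba, by rw [segment_symm]; exact h.bb⟩

theorem ang_sum {S : Set (ℝ × ℝ)} (hsc : SimplyConnectedSpace S) {A B A' B' p : ℝ × ℝ}
    (h : Tet S A B A' B') (hp : p ∉ S) :
    ang p A B + ang p B B' + ang p B' A' + ang p A' A = 0 := by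
  have hA : A ∈ S := h.ab (left_mem_segment ℝ _ _)
  have hB : B ∈ S := h.ab (right_mem_segment ℝ _ _)
  have hA' : A' ∈ S := h.aa (left_mem_segment ℝ _ _)
  have hB' : B' ∈ S := h.ba (left_mem_segment ℝ _ _)
  have hne : ∀ P : S, zrel p P.1 ≠ 0 := by
    rintro ⟨P, hP⟩
    apply zrel_ne
    rintro rfl
    exact hp hP
  obtain ⟨γ1, H1⟩ := edge_lift hA hB hp h.ab
  obtain ⟨γ2, H2⟩ := edge_lift hB hB' hp h.bb
  obtain ⟨γ3, H3⟩ := edge_lift hB' hA' hp h.ba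
  obtain ⟨γ4, H4⟩ := edge_lift hA' hA hp h.aa
  have he := Complex.exp_log (hne ⟨A, hA⟩)
  obtain ⟨Γ1, K1⟩ := H1 _ he
  obtain ⟨Γ2, K2⟩ := H2 _ (by simpa using K1 1)
  obtain ⟨Γ3, K3⟩ := H3 _ (by simpa using K2 1)
  obtain ⟨Γ4, K4⟩ := H4 _ (by simpa using K3 1)
  have tr : ∀ {x y z : S} (γ : Path x y) (γ' : Path y z) {e e1 e2 : ℂ} (Γ : Path e e1)
      (Γ' : Path e1 e2), (∀ t, Complex.exp (Γ t) = zrel p (γ t).1) →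
      (∀ t, Complex.exp (Γ' t) = zrel p (γ' t).1) →
      ∀ t, Complex.exp (Γ.trans Γ' t) = zrel p (γ.trans γ' t).1 := by
    intro x y z γ γ' e e1 e2 Γ Γ' h1 h2 t
    simp only [Path.trans_apply]
    split_ifs
    · exact h1 _
    · exact h2 _
  have hcont : Continuous fun P : S => zrel p P.1 := by
    have : (fun P : S => zrel p P.1) =
        fun P : S => ((P.1.1 - p.1 : ℝ) : ℂ) + ((P.1.2 - p.2 : ℝ) : ℂ) * Complex.I := by
      funext P
      apply Complex.ext <;> simp [zrel]
    rw [this]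
    fun_prop
  have key := lift_endpoint (fun P : S => zrel p P.1) hcont hne
    (((γ1.trans γ2).trans γ3).trans γ4) (Path.refl _)
    (((Γ1.trans Γ2).trans Γ3).trans Γ4) (Path.refl _)
    (tr _ _ _ _ (tr _ _ _ _ (tr _ _ _ _ K1 K2) K3) K4) (by intro t; simpa using he)
  have := congrArg Complex.im key
  simp only [Complex.add_im, Complex.log_im] at this
  simp only [ang]
  linarith

theorem core1 {S : Set (ℝ × ℝ)} (hsc : SimplyConnectedSpace S) {A B A' B' p : ℝ × ℝ}
    (h : Tet S A B A' B') (h1 : 0 ≤ crs p A B) (h2 : 0 ≤ crs p B B') (h3 : 0 ≤ crs p B' A')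
    (h4 : 0 < crs p A' A) : p ∈ S := by
  by_contra hp
  have := ang_sum hsc h hp
  have := ang_nonneg (fun hh => hp (h.ab hh)) h1
  have := ang_nonneg (fun hh => hp (h.bb hh)) h2
  have := ang_nonneg (fun hh => hp (h.ba hh)) h3
  have := ang_pos (fun hh => hp (h.aa hh)) h4
  linarith

theorem core2 {S : Set (ℝ × ℝ)} (hsc : SimplyConnectedSpace S) {A B A' B' p : ℝ × ℝ}
    (h : Tet S A B A' B') (h1 : 0 < crs p A B) (h2 : 0 < crs p B B')
    (h4 : 0 < crs p A' A) (h5 : 0 < crs p B A') : p ∈ S := by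
  rcases le_or_gt 0 (crs p B' A') with h3 | h3
  · exact core1 hsc h h1.le h2.le h3 h4
  by_contra hp
  have n1 : p ∉ segment ℝ A B := fun hh => hp (h.ab hh)
  have n2 : p ∉ segment ℝ B B' := fun hh => hp (h.bb hh)
  have n3 : p ∉ segment ℝ B' A' := fun hh => hp (h.ba hh)
  have n4 : p ∉ segment ℝ A' A := fun hh => hp (h.aa hh)
  have e := ang_sum hsc h hp
  have e1 := ang_pos n1 h1
  have e2 := ang_pos n2 h2
  have e3 := ang_neg n3 h3
  have e4 := ang_pos n4 h4
  have n5 : p ∉ segment ℝ B A' := by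
    intro hh
    obtain ⟨t, _, _, a, b⟩ := mem_seg.1 hh
    simp only [crs, a, b] at h5
    ring_nf at h5
    exact lt_irrefl _ h5
  have e5 := ang_pos n5 h5
  have := ang_add n2 n3 (by linarith [(ang_range n3).1]) (by linarith [(ang_range n2).2])
  linarith

theorem core3 {S : Set (ℝ × ℝ)} (hsc : SimplyConnectedSpace S) {A B A' B' p : ℝ × ℝ}
    (h : Tet S A B A' B') (h1 : 0 < crs p A B) (h2 : 0 < crs p B B')
    (h4 : 0 < crs p A' A) (h5 : 0 < crs p B' A) : p ∈ S := by
  rcases le_or_gt 0 (crs p B' A') with h3 | h3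
  · exact core1 hsc h h1.le h2.le h3 h4
  by_contra hp
  have n1 : p ∉ segment ℝ A B := fun hh => hp (h.ab hh)
  have n2 : p ∉ segment ℝ B B' := fun hh => hp (h.bb hh)
  have n3 : p ∉ segment ℝ B' A' := fun hh => hp (h.ba hh)
  have n4 : p ∉ segment ℝ A' A := fun hh => hp (h.aa hh)
  have e := ang_sum hsc h hp
  have e1 := ang_pos n1 h1
  have e2 := ang_pos n2 h2
  have e3 := ang_neg n3 h3
  have e4 := ang_pos n4 h4
  have n5 : p ∉ segment ℝ B' A := by
    intro hh
    obtain ⟨t, _, _, a, b⟩ := mem_seg.1 hh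
    simp only [crs, a, b] at h5
    ring_nf at h5
    exact lt_irrefl _ h5
  have e5 := ang_pos n5 h5
  have := ang_add n3 n4 (by linarith [(ang_range n3).1]) (by linarith [(ang_range n4).2])
  linarith

theorem seg_line {C u P Q p : ℝ × ℝ} {α β r : ℝ}
    (hP1 : P.1 = C.1 + α * u.1) (hP2 : P.2 = C.2 + α * u.2)
    (hQ1 : Q.1 = C.1 + β * u.1) (hQ2 : Q.2 = C.2 + β * u.2)
    (hp1 : p.1 = C.1 + r * u.1) (hp2 : p.2 = C.2 + r * u.2)
    (h1 : α ≤ r) (h2 : r ≤ β) : p ∈ segment ℝ P Q := by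
  rw [mem_seg]
  rcases eq_or_lt_of_le (h1.trans h2) with h | h
  · have hr : r = α := by linarith
    exact ⟨0, le_rfl, zero_le_one, by rw [hp1, hP1, hr]; ring, by rw [hp2, hP2, hr]; ring⟩
  · have hd : 0 < β - α := by linarith
    refine ⟨(r - α) / (β - α), div_nonneg (by linarith) hd.le, ?_, ?_, ?_⟩
    · rw [div_le_one hd]; linarith
    · rw [hp1, hP1, hQ1]; field_simp; ring
    · rw [hp2, hP2, hQ2]; field_simp; ring

theorem vis_f {S : Set (ℝ × ℝ)} (hsc : SimplyConnectedSpace S) {A B A' B' C : ℝ × ℝ}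
    (h : Tet S A B A' B') {s : ℝ} (hs0 : 0 < s) (hs1 : s < 1)
    (hC1 : C.1 = A.1 + s * (B.1 - A.1)) (hC2 : C.2 = A.2 + s * (B.2 - A.2))
    (y1 : 0 < crs A B A') (y2 : 0 < crs A B B') (f : 0 ≤ crs A' B B') :
    segment ℝ C A' ⊆ S := by
  intro p hp
  obtain ⟨t, ht0, ht1, hp1, hp2⟩ := mem_seg.1 hp
  rcases eq_or_lt_of_le ht0 with rfl | ht0
  · exact h.ab (mem_seg.2 ⟨s, hs0.le, hs1.le, by rw [hp1, hC1]; ring, by rw [hp2, hC2]; ring⟩)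
  rcases eq_or_lt_of_le ht1 with rfl | ht1
  · exact h.aa (mem_seg.2 ⟨0, le_rfl, zero_le_one, by rw [hp1]; ring, by rw [hp2]; ring⟩)
  have t1 : 0 < 1 - t := by linarith
  have s1 : 0 < 1 - s := by linarith
  have e1 : crs p A B = t * crs A B A' := by
    simp only [crs, hp1, hp2, hC1, hC2]; ring
  have e2 : crs p B B' = (1 - t) * (1 - s) * crs A B B' + t * crs A' B B' := by
    simp only [crs, hp1, hp2, hC1, hC2]; ring
  have e3 : crs p A' A = (1 - t) * s * crs A B A' := by
    simp only [crs, hp1, hp2, hC1, hC2]; ring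
  have e4 : crs p B A' = (1 - t) * (1 - s) * crs A B A' := by
    simp only [crs, hp1, hp2, hC1, hC2]; ring
  exact core2 hsc h (by rw [e1]; positivity) (by rw [e2]; positivity) (by rw [e3]; positivity)
    (by rw [e4]; positivity)

theorem vis_g {S : Set (ℝ × ℝ)} (hsc : SimplyConnectedSpace S) {A B A' B' C : ℝ × ℝ}
    (h : Tet S A B A' B') {s : ℝ} (hs0 : 0 < s) (hs1 : s < 1)
    (hC1 : C.1 = A.1 + s * (B.1 - A.1)) (hC2 : C.2 = A.2 + s * (B.2 - A.2))
    (y1 : 0 < crs A B A') (y2 : 0 < crs A B B') (g : 0 ≤ crs B' A' A) :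
    segment ℝ C B' ⊆ S := by
  intro p hp
  obtain ⟨t, ht0, ht1, hp1, hp2⟩ := mem_seg.1 hp
  rcases eq_or_lt_of_le ht0 with rfl | ht0
  · exact h.ab (mem_seg.2 ⟨s, hs0.le, hs1.le, by rw [hp1, hC1]; ring, by rw [hp2, hC2]; ring⟩)
  rcases eq_or_lt_of_le ht1 with rfl | ht1
  · exact h.ba (mem_seg.2 ⟨0, le_rfl, zero_le_one, by rw [hp1]; ring, by rw [hp2]; ring⟩)
  have t1 : 0 < 1 - t := by linarith
  have s1 : 0 < 1 - s := by linarith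
  have e1 : crs p A B = t * crs A B B' := by
    simp only [crs, hp1, hp2, hC1, hC2]; ring
  have e2 : crs p B B' = (1 - t) * (1 - s) * crs A B B' := by
    simp only [crs, hp1, hp2, hC1, hC2]; ring
  have e3 : crs p A' A = (1 - t) * s * crs A B A' + t * crs B' A' A := by
    simp only [crs, hp1, hp2, hC1, hC2]; ring
  have e4 : crs p B' A = (1 - t) * s * crs A B B' := by
    simp only [crs, hp1, hp2, hC1, hC2]; ring
  exact core3 hsc h (by rw [e1]; positivity) (by rw [e2]; positivity) (by rw [e3]; positivity)
    (by rw [e4]; positivity)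

/-- a point `D` on the line `A B` is `C + m (B - A)` -/
theorem on_line {A B C D : ℝ × ℝ} (hAB : A ≠ B) {s : ℝ}
    (hC1 : C.1 = A.1 + s * (B.1 - A.1)) (hC2 : C.2 = A.2 + s * (B.2 - A.2))
    (h : crs A B D = 0) :
    ∃ m : ℝ, D.1 = C.1 + m * (B.1 - A.1) ∧ D.2 = C.2 + m * (B.2 - A.2) := by
  simp only [crs] at h
  by_cases h1 : B.1 - A.1 = 0
  · have h2 : B.2 - A.2 ≠ 0 := by
      intro h2
      apply hAB
      ext <;> linarith
    refine ⟨(D.2 - C.2) / (B.2 - A.2), ?_, by field_simp; ring⟩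
    rw [h1] at h hC1 ⊢
    have : D.1 - A.1 = 0 := by
      have : (B.2 - A.2) * (D.1 - A.1) = 0 := by linarith
      exact (mul_eq_zero.1 this).resolve_left h2
    linarith
  · refine ⟨(D.1 - C.1) / (B.1 - A.1), by field_simp; ring, ?_⟩
    rw [hC1, hC2]
    field_simp
    linarith

/-- collinear case -/
theorem vis_line {S : Set (ℝ × ℝ)} {A B A' C : ℝ × ℝ} (hAB : A ≠ B)
    (hab : segment ℝ A B ⊆ S) (haa : segment ℝ A' A ⊆ S) {s : ℝ}
    (hC1 : C.1 = A.1 + s * (B.1 - A.1)) (hC2 : C.2 = A.2 + s * (B.2 - A.2))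
    (hs0 : 0 ≤ s) (hs1 : s ≤ 1)
    (y1 : crs A B A' = 0) : segment ℝ C A' ⊆ S := by
  intro p hp
  obtain ⟨t, ht0, ht1, hp1, hp2⟩ := mem_seg.1 hp
  obtain ⟨m, hm1, hm2⟩ := on_line hAB hC1 hC2 y1
  have hA1 : A.1 = C.1 + (-s) * (B - A).1 := by rw [hC1]; simp
  have hA2 : A.2 = C.2 + (-s) * (B - A).2 := by rw [hC2]; simp
  have hB1 : B.1 = C.1 + (1 - s) * (B - A).1 := by rw [hC1]; simp; ring
  have hB2 : B.2 = C.2 + (1 - s) * (B - A).2 := by rw [hC2]; simp; ring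
  have hp1' : p.1 = C.1 + (t * m) * (B - A).1 := by rw [hp1, hm1]; simp; ring
  have hp2' : p.2 = C.2 + (t * m) * (B - A).2 := by rw [hp2, hm2]; simp; ring
  rcases le_total 0 m with h0 | h0
  · apply haa
    rw [segment_symm]
    exact seg_line (u := B - A) (β := m) hA1 hA2 hm1 hm2 hp1' hp2' (by nlinarith)
      (by nlinarith)
  · rcases le_total (-s) (t * m) with h1 | h1
    · exact hab (seg_line hA1 hA2 hB1 hB2 hp1' hp2' h1 (by nlinarith))
    · apply haa
      exact seg_line (u := B - A) (α := m) hm1 hm2 hA1 hA2 hp1' hp2' (by nlinarith) h1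

theorem triangle {S : Set (ℝ × ℝ)} (hsc : SimplyConnectedSpace S) {A B X C : ℝ × ℝ}
    (hab : segment ℝ A B ⊆ S) (hax : segment ℝ A X ⊆ S) (hbx : segment ℝ B X ⊆ S)
    (hC : C ∈ segment ℝ A B) : segment ℝ C X ⊆ S := by
  by_cases hAB : A = B
  · subst hAB
    rw [segment_same] at hC
    rw [hC]; exact hax
  obtain ⟨s, hs0, hs1, hC1, hC2⟩ := mem_seg.1 hC
  rcases eq_or_lt_of_le hs0 with rfl | hs0
  · have : C = A := by ext <;> simp [hC1, hC2]
    rw [this]; exact hax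
  rcases eq_or_lt_of_le hs1 with rfl | hs1
  · have : C = B := by ext <;> simp [hC1, hC2]
    rw [this]; exact hbx
  have hxx : segment ℝ X X ⊆ S := by
    rw [segment_same, Set.singleton_subset_iff]
    exact hax (right_mem_segment ℝ _ _)
  have hT : Tet S A B X X := ⟨hab, hbx, hxx, by rwa [segment_symm]⟩
  rcases lt_trichotomy (crs A B X) 0 with h | h | h
  · have e : crs B A X = - crs A B X := by simp only [crs]; ring
    exact vis_f hsc hT.swap (s := 1 - s) (by linarith) (by linarith) (by rw [hC1]; ring)
      (by rw [hC2]; ring) (by linarith) (by linarith) (by simp [crs])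
  · exact vis_line hAB hab hT.aa hC1 hC2 hs0.le hs1.le h
  · exact vis_f hsc hT hs0 hs1 hC1 hC2 h h (by simp [crs])

theorem crossing {S : Set (ℝ × ℝ)} (hsc : SimplyConnectedSpace S) {A B A' B' C X : ℝ × ℝ}
    (h : Tet S A B A' B') {s l m : ℝ} (hs0 : 0 < s) (hs1 : s < 1)
    (hC1 : C.1 = A.1 + s * (B.1 - A.1)) (hC2 : C.2 = A.2 + s * (B.2 - A.2))
    (hl0 : 0 < l) (hl1 : l < 1) (hm0 : 0 < m) (hm1 : m < 1)
    (hX1 : X.1 = A.1 + l * (A'.1 - A.1)) (hX2 : X.2 = A.2 + l * (A'.2 - A.2))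
    (hY1 : X.1 = B.1 + m * (B'.1 - B.1)) (hY2 : X.2 = B.2 + m * (B'.2 - B.2)) :
    ∃ C' ∈ segment ℝ A' B', segment ℝ C C' ⊆ S := by
  have hXA : X ∈ segment ℝ A' A := by
    rw [segment_symm]; exact mem_seg.2 ⟨l, hl0.le, hl1.le, hX1, hX2⟩
  have hXB : X ∈ segment ℝ B B' := mem_seg.2 ⟨m, hm0.le, hm1.le, hY1, hY2⟩
  have sub : ∀ {P Q R T : ℝ × ℝ}, R ∈ segment ℝ P Q → T ∈ segment ℝ P Q →
      segment ℝ R T ⊆ segment ℝ P Q := fun h1 h2 => (convex_segment _ _).segment_subset h1 h2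
  have hC : C ∈ segment ℝ A B := mem_seg.2 ⟨s, hs0.le, hs1.le, hC1, hC2⟩
  have T1 : segment ℝ C X ⊆ S := triangle hsc h.ab
    ((sub (right_mem_segment ℝ _ _) hXA).trans h.aa)
    ((sub (left_mem_segment ℝ _ _) hXB).trans h.bb) hC
  have l1 : 0 < 1 - l := by linarith
  have m1 : 0 < 1 - m := by linarith
  have s1 : 0 < 1 - s := by linarith
  obtain ⟨w1, hw1⟩ : ∃ w1, w1 = (1 - s) * l * (1 - m) := ⟨_, rfl⟩
  obtain ⟨w2, hw2⟩ : ∃ w2, w2 = s * m * (1 - l) := ⟨_, rfl⟩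
  have w1p : 0 < w1 := by rw [hw1]; positivity
  have w2p : 0 < w2 := by rw [hw2]; positivity
  have hw : 0 < w1 + w2 := by linarith
  obtain ⟨τ, hτ⟩ : ∃ τ, τ = w2 / (w1 + w2) := ⟨_, rfl⟩
  obtain ⟨C', hC'⟩ : ∃ C' : ℝ × ℝ, C' = (A'.1 + τ * (B'.1 - A'.1), A'.2 + τ * (B'.2 - A'.2)) :=
    ⟨_, rfl⟩
  have hC'm : C' ∈ segment ℝ A' B' := by
    rw [mem_seg]
    refine ⟨τ, by rw [hτ]; positivity, ?_, by rw [hC'], by rw [hC']⟩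
    rw [hτ, div_le_one hw]; linarith
  have T2 : segment ℝ C' X ⊆ S := triangle hsc (by rw [segment_symm]; exact h.ba)
    ((sub (left_mem_segment ℝ _ _) hXA).trans h.aa)
    ((sub (right_mem_segment ℝ _ _) hXB).trans h.bb) hC'm
  refine ⟨C', hC'm, ?_⟩
  obtain ⟨ν, hν⟩ : ∃ ν, ν = 1 + (1 - l) * (1 - m) / (w1 + w2) := ⟨_, rfl⟩
  have hν1 : 1 ≤ ν := by
    rw [hν]
    have : 0 ≤ (1 - l) * (1 - m) / (w1 + w2) := by positivity
    linarith
  have alg : ∀ a b a' b' c x : ℝ, c = a + s * (b - a) → x = a + l * (a' - a) →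
      x = b + m * (b' - b) → a' + τ * (b' - a') = c + ν * (x - c) := by
    intro a b a' b' c x hc hx hy
    have h1 : w1 * (a' - x) + w2 * (b' - x) = (1 - l) * (1 - m) * (x - c) := by
      have i1 : l * (a' - x) = (1 - l) * (x - a) := by rw [hx]; ring
      have i2 : m * (b' - x) = (1 - m) * (x - b) := by rw [hy]; ring
      rw [hw1, hw2, hc]
      linear_combination (1 - s) * (1 - m) * i1 + s * (1 - l) * i2
    rw [hτ, hν]
    field_simp
    linear_combination h1
  have c1 : C'.1 = C.1 + ν * (X - C).1 := by
    rw [hC']; exact alg _ _ _ _ _ _ hC1 hX1 hY1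
  have c2 : C'.2 = C.2 + ν * (X - C).2 := by
    rw [hC']; exact alg _ _ _ _ _ _ hC2 hX2 hY2
  intro p hp
  obtain ⟨t, ht0, ht1, hp1, hp2⟩ := mem_seg.1 hp
  have hp1' : p.1 = C.1 + (t * ν) * (X - C).1 := by rw [hp1, c1]; ring
  have hp2' : p.2 = C.2 + (t * ν) * (X - C).2 := by rw [hp2, c2]; ring
  rcases le_total (t * ν) 1 with h1 | h1
  · apply T1
    exact seg_line (u := X - C) (α := 0) (β := 1) (by simp) (by simp) (by simp) (by simp)
      hp1' hp2' (by positivity) h1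
  · apply T2
    rw [segment_symm]
    exact seg_line (u := X - C) (α := 1) (β := ν) (by simp) (by simp) c1 c2
      hp1' hp2' h1 (by nlinarith)

theorem vis_pos {S : Set (ℝ × ℝ)} (hsc : SimplyConnectedSpace S) {A B A' B' C : ℝ × ℝ}
    (h : Tet S A B A' B') {s : ℝ} (hs0 : 0 < s) (hs1 : s < 1)
    (hC1 : C.1 = A.1 + s * (B.1 - A.1)) (hC2 : C.2 = A.2 + s * (B.2 - A.2))
    (y1 : 0 < crs A B A') (y2 : 0 < crs A B B') :
    ∃ C' ∈ segment ℝ A' B', segment ℝ C C' ⊆ S := by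
  rcases le_or_gt 0 (crs A' B B') with f | f
  · exact ⟨A', left_mem_segment ℝ _ _, vis_f hsc h hs0 hs1 hC1 hC2 y1 y2 f⟩
  rcases le_or_gt 0 (crs B' A' A) with g | g
  · exact ⟨B', right_mem_segment ℝ _ _, vis_g hsc h hs0 hs1 hC1 hC2 y1 y2 g⟩
  have hd : crs A B A' - crs B' A' A = crs A B B' - crs A' B B' := by simp only [crs]; ring
  obtain ⟨d, hdd⟩ : ∃ d, d = crs A B B' - crs A' B B' := ⟨_, rfl⟩
  have dp : 0 < d := by linarith
  refine crossing hsc h (X := (A.1 + crs A B B' / d * (A'.1 - A.1),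
      A.2 + crs A B B' / d * (A'.2 - A.2))) (l := crs A B B' / d) (m := crs A B A' / d)
      hs0 hs1 hC1 hC2 (by positivity) ?_ (by positivity) ?_ rfl rfl ?_ ?_
  · rw [div_lt_one dp]; linarith
  · rw [div_lt_one dp]; linarith
  · simp only
    field_simp
    rw [hdd]
    simp only [crs]
    ring
  · simp only
    field_simp
    rw [hdd]
    simp only [crs]
    ring

theorem vis_opp {S : Set (ℝ × ℝ)} (hsc : SimplyConnectedSpace S) {A B A' B' C : ℝ × ℝ}
    (h : Tet S A B A' B') (hAB : A ≠ B) {s : ℝ} (hs0 : 0 < s) (hs1 : s < 1)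
    (hC1 : C.1 = A.1 + s * (B.1 - A.1)) (hC2 : C.2 = A.2 + s * (B.2 - A.2))
    (y : crs A B A' * crs A B B' < 0) :
    ∃ C' ∈ segment ℝ A' B', segment ℝ C C' ⊆ S := by
  obtain ⟨y1, hy1⟩ : ∃ y1, y1 = crs A B A' := ⟨_, rfl⟩
  obtain ⟨y2, hy2⟩ : ∃ y2, y2 = crs A B B' := ⟨_, rfl⟩
  rw [← hy1, ← hy2] at y
  have hne : y1 - y2 ≠ 0 := by
    intro h0
    have : y1 = y2 := by linarith
    rw [this] at y
    nlinarith
  obtain ⟨D, hD⟩ : ∃ D : ℝ × ℝ, D = (A'.1 + y1 / (y1 - y2) * (B'.1 - A'.1),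
    A'.2 + y1 / (y1 - y2) * (B'.2 - A'.2)) := ⟨_, rfl⟩
  have hDm : D ∈ segment ℝ A' B' := by
    rw [mem_seg]
    refine ⟨y1 / (y1 - y2), ?_, ?_, by rw [hD], by rw [hD]⟩
    · rcases lt_or_gt_of_ne hne with h0 | h0
      · apply div_nonneg_of_nonpos _ h0.le
        nlinarith
      · apply div_nonneg _ h0.le
        nlinarith
    · rcases lt_or_gt_of_ne hne with h0 | h0
      · rw [div_le_one_of_neg h0]; nlinarith
      · rw [div_le_one h0]; nlinarith
  have hD0 : crs A B D = 0 := by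
    have : crs A B D = y1 + y1 / (y1 - y2) * (y2 - y1) := by
      rw [hD, hy1, hy2]
      generalize crs A B A' / (crs A B A' - crs A B B') = q
      simp only [crs]; ring
    rw [this]; field_simp; ring
  obtain ⟨m, hm1, hm2⟩ := on_line hAB hC1 hC2 hD0
  have hk : crs C B' A' = m * (y1 - y2) := by
    have e : crs D B' A' = 0 := by
      rw [hD]
      generalize y1 / (y1 - y2) = q
      simp only [crs]; ring
    have : crs D B' A' = crs C B' A' - m * (y1 - y2) := by
      rw [hy1, hy2]
      simp only [crs, hm1, hm2, hC1, hC2]; ring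
    linarith
  refine ⟨D, hDm, ?_⟩
  intro p hp
  obtain ⟨t, ht0, ht1, hp1, hp2⟩ := mem_seg.1 hp
  obtain ⟨r, hr⟩ : ∃ r, r = t * m := ⟨_, rfl⟩
  have hp1' : p.1 = C.1 + r * (B - A).1 := by rw [hp1, hm1, hr]; simp; ring
  have hp2' : p.2 = C.2 + r * (B - A).2 := by rw [hp2, hm2, hr]; simp; ring
  have e1 : crs p A B = 0 := by
    simp only [crs, hp1', hp2', hC1, hC2, Prod.fst_sub, Prod.snd_sub]; ring
  have e2 : crs p B B' = (1 - s - r) * y2 := by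
    rw [hy2]; simp only [crs, hp1', hp2', hC1, hC2, Prod.fst_sub, Prod.snd_sub]; ring
  have e3 : crs p B' A' = (m - r) * (y1 - y2) := by
    have : crs p B' A' = crs C B' A' - r * (y1 - y2) := by
      rw [hy1, hy2]
      simp only [crs, hp1', hp2', hC1, hC2, Prod.fst_sub, Prod.snd_sub]; ring
    rw [this, hk]; ring
  have e4 : crs p A' A = (s + r) * y1 := by
    rw [hy1]; simp only [crs, hp1', hp2', hC1, hC2, Prod.fst_sub, Prod.snd_sub]; ring
  have hpos : 0 ≤ crs p B B' → 0 ≤ crs p B' A' → 0 < crs p A' A → p ∈ S :=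
    fun a b c => core1 hsc h e1.ge a b c
  have hneg : crs p B B' < 0 → crs p B' A' ≤ 0 → crs p A' A ≤ 0 → p ∈ S := by
    intro a b c
    refine core1 hsc h.swap (by rw [crs_swap, e1]; simp) ?_ ?_ ?_
    · rw [crs_swap]; linarith
    · rw [crs_swap]; linarith
    · rw [crs_swap]; linarith
  rw [e2, e3, e4] at hpos hneg
  by_cases hr1 : -s ≤ r
  · by_cases hr2 : r ≤ 1 - s
    · apply h.ab
      exact seg_line (u := B - A) (α := -s) (β := 1 - s) (by rw [hC1]; simp) (by rw [hC2]; simp)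
        (by rw [hC1]; simp; ring) (by rw [hC2]; simp; ring) hp1' hp2' hr1 hr2
    · push Not at hr2
      have hmr : 0 ≤ m - r := by
        have : 0 < m := by
          by_contra hm
          push Not at hm
          have := mul_nonpos_of_nonneg_of_nonpos ht0 hm
          linarith
        have := mul_le_of_le_one_left this.le ht1
        linarith
      rcases lt_trichotomy y1 0 with q | q | q
      · have q2 : 0 < y2 := pos_of_mul_neg_right y q.le
        exact hneg (mul_neg_of_neg_of_pos (by linarith) (by linarith)) (mul_nonpos_of_nonneg_of_nonpos (by linarith) (by linarith)) (mul_nonpos_of_nonneg_of_nonpos (by linarith) (by linarith))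
      · rw [q] at y; simp at y
      · have q2 : y2 < 0 := neg_of_mul_neg_right y q.le
        exact hpos (mul_nonneg_of_nonpos_of_nonpos (by linarith) (by linarith)) (mul_nonneg (by linarith) (by linarith)) (mul_pos (by linarith) (by linarith))
  · push Not at hr1
    have hmr : m - r ≤ 0 := by
      have : m < 0 := by
        by_contra hm
        push Not at hm
        have := mul_nonneg ht0 hm
        linarith
      have := mul_nonneg (sub_nonneg.2 ht1) (neg_nonneg.2 this.le)
      linarith
    rcases lt_trichotomy y1 0 with q | q | q
    · have q2 : 0 < y2 := pos_of_mul_neg_right y q.le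
      exact hpos (mul_nonneg (by linarith) (by linarith)) (mul_nonneg_of_nonpos_of_nonpos (by linarith) (by linarith)) (mul_pos_of_neg_of_neg (by linarith) (by linarith))
    · rw [q] at y; simp at y
    · have q2 : y2 < 0 := neg_of_mul_neg_right y q.le
      exact hneg (mul_neg_of_pos_of_neg (by linarith) (by linarith)) (mul_nonpos_of_nonpos_of_nonneg (by linarith) (by linarith)) (mul_nonpos_of_nonpos_of_nonneg (by linarith) (by linarith))

theorem vis_main {S : Set (ℝ × ℝ)} (hsc : SimplyConnectedSpace S) {A B A' B' C : ℝ × ℝ}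
    (h : Tet S A B A' B') (hC : C ∈ segment ℝ A B) :
    ∃ C' ∈ segment ℝ A' B', segment ℝ C C' ⊆ S := by
  have haa : segment ℝ A A' ⊆ S := by rw [segment_symm]; exact h.aa
  by_cases hAB : A = B
  · subst hAB
    rw [segment_same] at hC
    rw [hC]; exact ⟨A', left_mem_segment ℝ _ _, haa⟩
  obtain ⟨s, hs0, hs1, hC1, hC2⟩ := mem_seg.1 hC
  rcases eq_or_lt_of_le hs0 with rfl | hs0
  · have : C = A := by ext <;> simp [hC1, hC2]
    rw [this]; exact ⟨A', left_mem_segment ℝ _ _, haa⟩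
  rcases eq_or_lt_of_le hs1 with rfl | hs1
  · have : C = B := by ext <;> simp [hC1, hC2]
    rw [this]; exact ⟨B', right_mem_segment ℝ _ _, h.bb⟩
  have e : ∀ X, crs B A X = - crs A B X := by intro X; simp only [crs]; ring
  have neg : crs A B A' < 0 → crs A B B' < 0 →
      ∃ C' ∈ segment ℝ A' B', segment ℝ C C' ⊆ S := by
    intro a b
    rw [segment_symm]
    exact vis_pos hsc h.swap (s := 1 - s) (by linarith) (by linarith) (by rw [hC1]; ring)
      (by rw [hC2]; ring) (by rw [e]; linarith) (by rw [e]; linarith)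
  have opp := vis_opp hsc h hAB hs0 hs1 hC1 hC2
  rcases eq_or_ne (crs A B A') 0 with y1 | y1
  · exact ⟨A', left_mem_segment ℝ _ _, vis_line hAB h.ab h.aa hC1 hC2 hs0.le hs1.le y1⟩
  rcases eq_or_ne (crs A B B') 0 with y2 | y2
  · exact ⟨B', right_mem_segment ℝ _ _, vis_line (Ne.symm hAB) h.swap.ab h.swap.aa (s := 1 - s)
      (by rw [hC1]; ring) (by rw [hC2]; ring) (by linarith) (by linarith) (by rw [e, y2, neg_zero])⟩
  rcases lt_or_gt_of_ne y1 with z1 | z1 <;> rcases lt_or_gt_of_ne y2 with z2 | z2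
  · exact neg z1 z2
  · exact opp (mul_neg_of_neg_of_pos z1 z2)
  · exact opp (mul_neg_of_pos_of_neg z1 z2)
  · exact vis_pos hsc h hs0 hs1 hC1 hC2 z1 z2

/-- In a simply connected `S ⊆ ℝ²`, if `A,B` lie on a segment `ℓ ⊆ S`,
`A',B'` lie on a segment `ℓ' ⊆ S`, and `[A,A'], [B,B'] ⊆ S`, then every point of
`[A,B]` is visible in `S` from some point of `[A',B']`. -/
theorem tetragon_visibility (S ℓ ℓ' : Set (ℝ × ℝ))
    (hsc : SimplyConnectedSpace S)
    (hℓ : IsLineSegment ℓ) (hℓ' : IsLineSegment ℓ')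
    (hℓS : ℓ ⊆ S) (hℓ'S : ℓ' ⊆ S)
    (A B A' B' : ℝ × ℝ)
    (hA : A ∈ ℓ) (hB : B ∈ ℓ) (hA' : A' ∈ ℓ') (hB' : B' ∈ ℓ')
    (h1 : segment ℝ A A' ⊆ S) (h2 : segment ℝ B B' ⊆ S) :
    ∀ C ∈ segment ℝ A B, ∃ C' ∈ segment ℝ A' B', segment ℝ C C' ⊆ S := by
  intro C hC
  refine vis_main hsc ⟨?_, h2, ?_, ?_⟩ hC
  · exact (hℓ.1.segment_subset hA hB).trans hℓS
  · exact (hℓ'.1.segment_subset hB' hA').trans hℓ'S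
  · rw [segment_symm]; exact h1
end

section
/- Let S be a bounded open simply connected subset of ℝ² and ℓ a diagonal of S (an inclusion-maximal line segment contained in S). Then S \ ℓ has exactly two polygonally connected components S₁ and S₂; moreover S₁ ∪ ℓ and S₂ ∪ ℓ are each simply connected, and for every A ∈ ℓ and every disc neighborhood N_ε(A) ⊆ S, the parts of N_ε(A) on the two open sides of the supporting line of ℓ lie in S₁ and S₂ respectively. -/
/-- `A` and `B` can be joined by a polygonal line inside `X`. -/
def PolyConn (X : Set (ℝ × ℝ)) (A B : ℝ × ℝ) : Prop :=
  A ∈ X ∧ B ∈ X ∧ ∃ n, ∃ f : Fin (n + 1) → ℝ × ℝ, f 0 = A ∧ f (Fin.last n) = B ∧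
    ∀ i : Fin n, segment ℝ (f i.castSucc) (f i.succ) ⊆ X

/-- `C` is a p-component of `X`: an equivalence class of polygonal connectivity. -/
def IsPComponent (X C : Set (ℝ × ℝ)) : Prop :=
  ∃ A ∈ X, C = {B | PolyConn X A B}

open Set Metric Topology Filter

theorem sc_of_retract {X Y : Type*} [TopologicalSpace X] [TopologicalSpace Y]
    [SimplyConnectedSpace Y] (i : C(X, Y)) (r : C(Y, X)) (h : ∀ x, r (i x) = x) :
    SimplyConnectedSpace X := by
  rw [simply_connected_iff_paths_homotopic']
  have hsurj : Function.Surjective r := fun x => ⟨i x, h x⟩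
  refine ⟨hsurj.pathConnectedSpace r.continuous, ?_⟩
  intro x y p₁ p₂
  obtain ⟨F⟩ := SimplyConnectedSpace.paths_homotopic (p₁.map i.continuous) (p₂.map i.continuous)
  exact ⟨{
    toFun := fun t => r (F t)
    map_zero_left := by intro t; simp [h]
    map_one_left := by intro t; simp [h]
    prop' := by
      intro t z hz
      have := F.prop' t z hz
      simp only [ContinuousMap.coe_mk] at this ⊢
      change r (F (t, z)) = _
      have h2 : F (t, z) = (p₁.map i.continuous) z := this
      rw [h2]; simp [h] }⟩

theorem polyConn_iff (X : Set (ℝ × ℝ)) (A B : ℝ × ℝ) :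
    PolyConn X A B ↔ A ∈ X ∧ Relation.ReflTransGen (fun x y => segment ℝ x y ⊆ X) A B := by
  constructor
  · rintro ⟨hA, hB, n, f, h0, hl, hs⟩
    refine ⟨hA, ?_⟩
    have : ∀ i : Fin (n + 1), Relation.ReflTransGen (fun x y => segment ℝ x y ⊆ X) A (f i) := by
      intro i
      induction i using Fin.induction with
      | zero => rw [h0]
      | succ i ih => exact ih.tail (hs i)
    rw [← hl]; exact this _
  · rintro ⟨hA, h⟩
    induction h with
    | refl => exact ⟨hA, hA, 0, fun _ => A, rfl, rfl, fun i => i.elim0⟩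
    | @tail b c _ hbc ih =>
      obtain ⟨_, hB, n, f, h0, hl, hs⟩ := ih
      refine ⟨hA, hbc (right_mem_segment ℝ b c), n + 1, Fin.snoc f c, ?_, ?_, ?_⟩
      · have : (0 : Fin (n + 2)) = Fin.castSucc 0 := rfl
        rw [this, Fin.snoc_castSucc, h0]
      · simp
      · intro i
        induction i using Fin.lastCases with
        | last => simpa [hl, Fin.succ_last] using hbc
        | cast j => rw [Fin.succ_castSucc, Fin.snoc_castSucc, Fin.snoc_castSucc]; exact hs j

theorem PolyConn.trans' {X : Set (ℝ × ℝ)} {A B C : ℝ × ℝ} (h : PolyConn X A B)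
    (h' : PolyConn X B C) : PolyConn X A C := by
  rw [polyConn_iff] at *
  exact ⟨h.1, h.2.trans h'.2⟩

theorem PolyConn.symm' {X : Set (ℝ × ℝ)} {A B : ℝ × ℝ} (h : PolyConn X A B) :
    PolyConn X B A := by
  have hB := h.2.1
  rw [polyConn_iff] at *
  refine ⟨hB, ?_⟩
  have : Std.Symm (fun x y : ℝ × ℝ => segment ℝ x y ⊆ X) :=
    ⟨fun x y h => by rw [segment_symm]; exact h⟩
  exact Std.Symm.symm _ _ h.2

theorem PolyConn.of_convex {X K : Set (ℝ × ℝ)} (hK : Convex ℝ K) (hKX : K ⊆ X) {A B : ℝ × ℝ}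
    (hA : A ∈ K) (hB : B ∈ K) : PolyConn X A B := by
  rw [polyConn_iff]
  exact ⟨hKX hA, .single ((hK.segment_subset hA hB).trans hKX)⟩

/-- Facts about a diagonal. -/
theorem diag_facts {S ℓ : Set (ℝ × ℝ)} (hne : S.Nonempty) (hd : IsDiagonal S ℓ) :
    ∃ (f : (ℝ × ℝ) →ₗ[ℝ] ℝ) (c : ℝ), f ≠ 0 ∧ (∀ p ∈ ℓ, f p = c) ∧ ℓ.Nonempty ∧
      (∀ q ∈ ℓ, ∀ p, f p = c → segment ℝ p q ⊆ S → p ∈ ℓ) ∧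
      ∃ (τ : C(ℝ × ℝ, ℝ)) (σ : C(ℝ, ℝ × ℝ)) (T : Set ℝ), T.OrdConnected ∧
        (∀ p ∈ ℓ, τ p ∈ T ∧ σ (τ p) = p) ∧ ∀ t ∈ T, σ t ∈ ℓ := by
  obtain ⟨hℓS, ⟨hconv, hbd, a, b, hab, hrange⟩, hmax⟩ := hd
  set σ : ℝ →ᵃ[ℝ] ℝ × ℝ := AffineMap.lineMap a b with hσ
  set v := b - a with hv
  have hvne : 0 < v.1 ^ 2 + v.2 ^ 2 := by
    have : v ≠ 0 := sub_ne_zero.2 hab.symm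
    by_contra hcon
    apply this
    have h1 : v.1 = 0 := by nlinarith [sq_nonneg v.1, sq_nonneg v.2]
    have h2 : v.2 = 0 := by nlinarith [sq_nonneg v.1, sq_nonneg v.2]
    exact Prod.ext h1 h2
  have hσa : ∀ t, σ t = (a.1 + t * v.1, a.2 + t * v.2) := by
    intro t
    ext <;> simp [hσ, AffineMap.lineMap_apply, hv] <;> ring
  let f : (ℝ × ℝ) →ₗ[ℝ] ℝ := v.1 • LinearMap.snd ℝ ℝ ℝ - v.2 • LinearMap.fst ℝ ℝ ℝ
  have hf : ∀ p, f p = v.1 * p.2 - v.2 * p.1 := by intro p; simp [f]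
  let τ : C(ℝ × ℝ, ℝ) :=
    ⟨fun p => ((p.1 - a.1) * v.1 + (p.2 - a.2) * v.2) / (v.1 ^ 2 + v.2 ^ 2), by fun_prop⟩
  have hτ : ∀ p, τ p = ((p.1 - a.1) * v.1 + (p.2 - a.2) * v.2) / (v.1 ^ 2 + v.2 ^ 2) :=
    fun p => rfl
  have hτσ : ∀ t, τ (σ t) = t := by
    intro t; rw [hτ, hσa, div_eq_iff hvne.ne']; ring
  have hστ : ∀ p, f p = f a → σ (τ p) = p := by
    intro p hp
    rw [hf, hf] at hp
    rw [hσa, hτ]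
    ext
    · simp only
      field_simp
      linear_combination v.2 * hp
    · simp only
      field_simp
      linear_combination (-v.1) * hp
  have hfσ : ∀ t, f (σ t) = f a := by
    intro t; rw [hf, hf, hσa]; ring
  have hfℓ : ∀ p ∈ ℓ, f p = f a := by
    intro p hp; obtain ⟨t, rfl⟩ := hrange hp; exact hfσ t
  have hσc : Continuous σ := by
    have : (σ : ℝ → ℝ × ℝ) = fun t => (a.1 + t * v.1, a.2 + t * v.2) := funext hσa
    rw [this]; fun_prop
  have hTconv : Convex ℝ (σ ⁻¹' ℓ) := hconv.affine_preimage σ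
  refine ⟨f, f a, ?_, hfℓ, ?_, ?_, τ, ⟨σ, hσc⟩, σ ⁻¹' ℓ, hTconv.ordConnected, ?_, fun t ht => ht⟩
  · intro h0
    have : f (-v.2, v.1) = 0 := by rw [h0]; rfl
    rw [hf] at this
    simp only at this
    nlinarith
  · by_contra hemp
    rw [not_nonempty_iff_eq_empty] at hemp
    obtain ⟨s, hs⟩ := hne
    have := hmax {s} (by simpa using hs) ⟨convex_singleton s, Bornology.isBounded_singleton,
      s, s + (1, 0), by simp, by
        rw [singleton_subset_iff]; exact ⟨0, by simp⟩⟩ (by simp [hemp])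
    rw [hemp] at this
    exact singleton_ne_empty s this
  · intro q hq p hp hseg
    have hlp : IsLineSegment (ℓ ∪ segment ℝ p q) := by
      refine ⟨?_, ?_, a, b, hab, ?_⟩
      · have : ℓ ∪ segment ℝ p q = σ '' (σ ⁻¹' ℓ ∪ segment ℝ (τ p) (τ q)) := by
          rw [image_union, image_preimage_eq_of_subset hrange, image_segment, hστ p hp,
            hστ q (hfℓ q hq)]
        rw [this]
        apply Convex.affine_image
        rw [Real.convex_iff_isPreconnected]
        refine IsPreconnected.union (τ q) ?_ (right_mem_segment ℝ _ _) hTconv.isPreconnected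
          (convex_segment _ _).isPreconnected
        change σ (τ q) ∈ ℓ
        rwa [hστ q (hfℓ q hq)]
      · refine hbd.union ?_
        rw [segment_eq_image]
        exact (isCompact_Icc.image (by fun_prop)).isBounded
      · refine union_subset hrange ?_
        rw [← hστ p hp, ← hστ q (hfℓ q hq), ← image_segment]
        exact image_subset_range _ _
    have := hmax _ (union_subset hℓS hseg) hlp subset_union_left
    rw [← this]
    exact Or.inr (left_mem_segment ℝ p q)
  · intro p hp
    have := hστ p (hfℓ p hp)
    refine ⟨?_, this⟩
    change σ (τ p) ∈ ℓ
    rwa [this]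

theorem exists_side {f : (ℝ × ℝ) →ₗ[ℝ] ℝ} (hf : f ≠ 0) {A : ℝ × ℝ} {U : Set (ℝ × ℝ)}
    (hU : U ∈ 𝓝 A) : ∃ z ∈ U, f A < f z := by
  obtain ⟨n, hn⟩ : ∃ n, 0 < f n := by
    obtain ⟨n, hn⟩ : ∃ n, f n ≠ 0 := by
      by_contra! h; exact hf (LinearMap.ext h)
    rcases lt_or_gt_of_ne hn with h | h
    · exact ⟨-n, by simpa using h⟩
    · exact ⟨n, h⟩
  have hc : Tendsto (fun s : ℝ => A + s • n) (𝓝[>] 0) (𝓝 A) := by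
    have : Continuous (fun s : ℝ => A + s • n) := by fun_prop
    have h := this.tendsto 0
    simp only [zero_smul, add_zero] at h
    exact h.mono_left nhdsWithin_le_nhds
  obtain ⟨s, hs, hs0⟩ := ((hc.eventually hU).and self_mem_nhdsWithin).exists
  refine ⟨A + s • n, hs, ?_⟩
  have : 0 < s * f n := mul_pos hs0 hn
  simpa using this

theorem convex_half (f : (ℝ × ℝ) →ₗ[ℝ] ℝ) (c : ℝ) (A : ℝ × ℝ) (ε : ℝ) :
    Convex ℝ (ball A ε ∩ {x | c < f x}) :=
  (convex_ball A ε).inter (convex_halfSpace_gt f.isLinear c)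

theorem half_conn {S ℓ : Set (ℝ × ℝ)} (ho : IsOpen S) {f : (ℝ × ℝ) →ₗ[ℝ] ℝ} {c : ℝ}
    (hf : f ≠ 0) (hℓS : ℓ ⊆ S) (hℓ : ∀ p ∈ ℓ, f p = c) (hpre : IsPreconnected ℓ)
    {A A' : ℝ × ℝ} (hA : A ∈ ℓ) (hA' : A' ∈ ℓ) :
    ∀ ε ε', 0 < ε → 0 < ε' → ball A ε ⊆ S → ball A' ε' ⊆ S →
      ∀ x ∈ ball A ε ∩ {x | c < f x}, ∀ x' ∈ ball A' ε' ∩ {x | c < f x},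
        PolyConn (S \ ℓ) x x' := by
  have hsub : ∀ A ε, ball A ε ⊆ S → ball A ε ∩ {x | c < f x} ⊆ S \ ℓ := by
    intro A ε h x hx
    exact ⟨h hx.1, fun hxl => (hx.2 : c < f x).ne' (hℓ x hxl)⟩
  refine hpre.induction₂' (fun A A' => ∀ ε ε', 0 < ε → 0 < ε' → ball A ε ⊆ S → ball A' ε' ⊆ S →
      ∀ x ∈ ball A ε ∩ {x | c < f x}, ∀ x' ∈ ball A' ε' ∩ {x | c < f x},
        PolyConn (S \ ℓ) x x') ?_ ?_ hA hA'
  · intro A hA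
    obtain ⟨r, hr, hrS⟩ := Metric.isOpen_iff.1 ho A (hℓS hA)
    filter_upwards [self_mem_nhdsWithin, mem_nhdsWithin_of_mem_nhds (ball_mem_nhds A hr)]
      with A' hA' hA'r
    have key : ∀ ε ε', 0 < ε → 0 < ε' → ball A ε ⊆ S → ball A' ε' ⊆ S →
      ∀ x ∈ ball A ε ∩ {x | c < f x}, ∀ x' ∈ ball A' ε' ∩ {x | c < f x},
        PolyConn (S \ ℓ) x x' := by
      intro ε ε' hε hε' hS hS' x hx x' hx'
      obtain ⟨w, hw, hfw⟩ := exists_side hf (inter_mem (ball_mem_nhds A hr) (ball_mem_nhds A hε))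
      obtain ⟨z, hz, hfz⟩ := exists_side hf
        (inter_mem (isOpen_ball.mem_nhds hA'r) (ball_mem_nhds A' hε'))
      rw [hℓ _ hA] at hfw
      rw [hℓ _ hA'] at hfz
      have h1 := PolyConn.of_convex (convex_half f c A ε) (hsub A ε hS) hx ⟨hw.2, hfw⟩
      have h2 := PolyConn.of_convex (convex_half f c A r) (hsub A r hrS) ⟨hw.1, hfw⟩ ⟨hz.1, hfz⟩
      have h3 := PolyConn.of_convex (convex_half f c A' ε') (hsub A' ε' hS') ⟨hz.2, hfz⟩ hx'
      exact (h1.trans' h2).trans' h3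
    refine ⟨key, fun ε ε' hε hε' hS hS' x hx x' hx' => (key ε' ε hε' hε hS' hS x' hx' x hx).symm'⟩
  · intro A B C hA hB hC h1 h2 ε ε' hε hε' hS hS' x hx x' hx'
    obtain ⟨r, hr, hrS⟩ := Metric.isOpen_iff.1 ho B (hℓS hB)
    obtain ⟨w, hw, hfw⟩ := exists_side hf (ball_mem_nhds B hr)
    rw [hℓ _ hB] at hfw
    exact (h1 ε r hε hr hS hrS x hx w ⟨hw, hfw⟩).trans' (h2 r ε' hr hε' hrS hS' w ⟨hw, hfw⟩ x' hx')

theorem isOpen_polyClass {X : Set (ℝ × ℝ)} (hX : IsOpen X) (A : ℝ × ℝ) :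
    IsOpen {B | PolyConn X A B} := by
  rw [Metric.isOpen_iff]
  intro B hB
  obtain ⟨r, hr, hrX⟩ := Metric.isOpen_iff.1 hX B hB.2.1
  exact ⟨r, hr, fun C hC => PolyConn.trans' hB
    (PolyConn.of_convex (convex_ball B r) hrX (mem_ball_self hr) hC)⟩

theorem separation {S ℓ : Set (ℝ × ℝ)} (hSc : Sᶜ.Nonempty) (ho : IsOpen S)
    [SimplyConnectedSpace S] {f : (ℝ × ℝ) →ₗ[ℝ] ℝ} {c : ℝ}
    (hℓS : ℓ ⊆ S) (hne : ℓ.Nonempty)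
    (hF : ∀ q ∈ ℓ, ∀ p, f p = c → segment ℝ p q ⊆ S → p ∈ ℓ) :
    ∃ k : (ℝ × ℝ) → ℝ, (∀ x y, PolyConn (S \ ℓ) x y → k x = k y) ∧
      ∀ A ∈ ℓ, ∃ U ∈ 𝓝 A, ∀ x ∈ U, ∀ y ∈ U, c < f x → f y < c → k x ≠ k y := by
  have hfc : Continuous f := f.continuous_of_finiteDimensional
  have hδpos : ∀ p ∈ S, 0 < infDist p Sᶜ := by
    intro p hp
    rw [← ho.isClosed_compl.notMem_iff_infDist_pos hSc]
    exact fun h => h hp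
  set w : ℝ × ℝ → ℝ := fun p => max 0 (1 / 2 - infDist p ℓ / infDist p Sᶜ) with hw
  have hwc : ContinuousOn w S := by
    apply continuousOn_const.sup
    apply ContinuousOn.sub continuousOn_const
    exact (continuous_infDist_pt _).continuousOn.div (continuous_infDist_pt _).continuousOn
      (fun p hp => (hδpos p hp).ne')
  have hwℓ : ∀ p ∈ ℓ, w p = 1 / 2 := by
    intro p hp
    simp [hw, infDist_zero_of_mem hp]
  have hw0 : ∀ p ∈ S, f p = c → p ∉ ℓ → w p = 0 := by
    intro p hp hpc hpl
    have hge : infDist p Sᶜ ≤ infDist p ℓ := by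
      by_contra! hlt
      obtain ⟨q, hq, hqd⟩ := (infDist_lt_iff hne).1 hlt
      apply hpl
      refine hF q hq p hpc ?_
      have hb : ball p (infDist p Sᶜ) ⊆ S := by
        have := ball_infDist_compl_subset (s := S) (x := p)
        exact this
      exact ((convex_ball p _).segment_subset (mem_ball_self (hδpos p hp))
        (by rw [mem_ball, dist_comm]; exact hqd)).trans hb
    have : 1 ≤ infDist p ℓ / infDist p Sᶜ := (one_le_div (hδpos p hp)).2 hge
    simp only [hw]
    apply max_eq_left
    linarith
  have hwS : Continuous (fun p : S => w p) := continuousOn_iff_continuous_domRestrict.1 hwc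
  let G : C(S, AddCircle (1 : ℝ)) :=
    ⟨fun p => if c ≤ f p then ((w p : ℝ) : AddCircle (1 : ℝ)) else ((-w p : ℝ) : AddCircle (1 : ℝ)), by
      apply Continuous.if_le
      · exact (AddCircle.continuous_mk' 1).comp hwS
      · exact (AddCircle.continuous_mk' 1).comp hwS.neg
      · fun_prop
      · fun_prop
      · intro p hp
        by_cases hpl : (p : ℝ × ℝ) ∈ ℓ
        · rw [hwℓ p hpl]
          rw [QuotientAddGroup.eq]
          rw [AddSubgroup.mem_zmultiples_iff]
          exact ⟨-1, by norm_num⟩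
        · rw [hw0 p p.2 hp.symm hpl, neg_zero]⟩
  have : LocallyPathConnectedSpace S := ho.locallyPathConnectedSpace
  obtain ⟨A₀, hA₀⟩ := hne
  obtain ⟨e₀, he₀⟩ := QuotientAddGroup.mk_surjective (G ⟨A₀, hℓS hA₀⟩)
  obtain ⟨h, ⟨-, hh⟩, -⟩ := (AddCircle.isCoveringMap_coe (1 : ℝ)).existsUnique_continuousMap_lifts
    G ⟨A₀, hℓS hA₀⟩ e₀ he₀
  classical
  let h' : ℝ × ℝ → ℝ := fun p => if hp : p ∈ S then h ⟨p, hp⟩ else 0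
  have hh' : ∀ p : S, h' p = h p := fun p => by simp [h']
  have hh'c : ContinuousOn h' S := by
    rw [continuousOn_iff_continuous_domRestrict]
    have : S.domRestrict h' = h := funext hh'
    rw [this]; exact h.continuous
  let θ : ℝ × ℝ → ℝ := fun p => if c ≤ f p then w p else - w p
  have hθc : ContinuousOn θ (S \ ℓ) := by
    rw [continuousOn_iff_continuous_domRestrict]
    have hwS' : Continuous (fun p : ↥(S \ ℓ) => w p) :=
      continuousOn_iff_continuous_domRestrict.1 (hwc.mono sdiff_subset)
    apply Continuous.if_le
    · exact hwS'
    · exact hwS'.neg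
    · fun_prop
    · fun_prop
    · intro p hp
      have h0 := hw0 p p.2.1 hp.symm p.2.2
      change w p = -w p
      rw [h0, neg_zero]
  have hzmul : ∀ p ∈ S, h' p - θ p ∈ AddSubgroup.zmultiples (1 : ℝ) := by
    intro p hp
    have h1 : ((h' p : ℝ) : AddCircle (1 : ℝ)) = ((θ p : ℝ) : AddCircle (1 : ℝ)) := by
      have := congrFun hh ⟨p, hp⟩
      rw [hh' ⟨p, hp⟩]
      refine this.trans ?_
      simp only [G, θ, ContinuousMap.coe_mk]
      split_ifs <;> rfl
    rw [eq_comm, QuotientAddGroup.eq] at h1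
    rwa [sub_eq_neg_add]
  refine ⟨fun p => h' p - θ p, ?_, ?_⟩
  · intro x y hxy
    rw [polyConn_iff] at hxy
    have := hxy.2
    clear hxy
    induction this with
    | refl => rfl
    | @tail a b _ hab ih =>
      rw [ih]
      refine (convex_segment a b).isPreconnected.constant_of_mapsTo
        (T := (AddSubgroup.zmultiples (1 : ℝ) : Set ℝ)) 
        ⟨inferInstanceAs (DiscreteTopology (AddSubgroup.zmultiples (1 : ℝ)))⟩ (f := fun p => h' p - θ p)
        ?_ ?_ (left_mem_segment ℝ a b) (right_mem_segment ℝ a b)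
      · exact ((hh'c.mono sdiff_subset).sub hθc).mono hab
      · exact fun p hp => hzmul p (hab hp).1
  · intro A hA
    have hSA : S ∈ 𝓝 A := ho.mem_nhds (hℓS hA)
    have c1 := hh'c.continuousAt hSA
    have c2 := hwc.continuousAt hSA
    have e1 := c1.eventually (ball_mem_nhds (h' A) (by norm_num : (0 : ℝ) < 1 / 4))
    have e2 := c2.eventually (lt_mem_nhds (by rw [hwℓ A hA]; norm_num : (1 / 4 : ℝ) < w A))
    refine ⟨_, e1.and e2, ?_⟩
    rintro x ⟨hx1, hx2⟩ y ⟨hy1, hy2⟩ hx hy heq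
    have t1 : θ x = w x := if_pos hx.le
    have t2 : θ y = - w y := if_neg (not_le.2 hy)
    simp only [t1, t2] at heq
    rw [Real.dist_eq, abs_lt] at hx1 hy1
    linarith [hx1.1, hx1.2, hy1.1, hy1.2]

theorem sc_piece {S ℓ S₁ S₂ : Set (ℝ × ℝ)} [SimplyConnectedSpace S]
    (hS : S = S₁ ∪ S₂ ∪ ℓ) (h1 : IsOpen S₁) (h2 : IsOpen S₂) (h12 : Disjoint S₁ S₂)
    (h1l : Disjoint S₁ ℓ) (h2l : Disjoint S₂ ℓ) (hne : ℓ.Nonempty)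
    (τ : C(ℝ × ℝ, ℝ)) (σ : C(ℝ, ℝ × ℝ)) (T : Set ℝ) (hT : T.OrdConnected)
    (hτ : ∀ p ∈ ℓ, τ p ∈ T ∧ σ (τ p) = p) (hσ : ∀ t ∈ T, σ t ∈ ℓ) :
    SimplyConnectedSpace ↥(S₁ ∪ ℓ) := by
  have hℓS : ℓ ⊆ S := by rw [hS]; exact subset_union_right
  have hsub : S₁ ∪ ℓ ⊆ S := by
    rw [hS]; exact union_subset_union_left _ subset_union_left
  have hcl : IsClosed ((↑) ⁻¹' ℓ : Set S) := by
    rw [← isOpen_compl_iff]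
    have : ((↑) ⁻¹' ℓ : Set S)ᶜ = (↑) ⁻¹' (S₁ ∪ S₂) := by
      ext ⟨p, hp⟩
      simp only [mem_compl_iff, mem_preimage]
      rw [hS] at hp
      constructor
      · intro h; exact hp.resolve_right h
      · rintro (h | h)
        · exact disjoint_left.1 h1l h
        · exact disjoint_left.1 h2l h
    rw [this]
    exact (h1.union h2).preimage continuous_subtype_val
  have hcl2 : ((↑) ⁻¹' (S₁ ∪ ℓ) : Set S) = ((↑) ⁻¹' S₂ : Set S)ᶜ := by
    ext ⟨p, hp⟩
    simp only [mem_compl_iff, mem_preimage]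
    rw [hS] at hp
    constructor
    · rintro (h | h)
      · exact disjoint_left.1 h12 h
      · exact disjoint_right.1 h2l h
    · intro h
      rcases hp with (hp | hp) | hp
      · exact Or.inl hp
      · exact absurd hp h
      · exact Or.inr hp
  have he : IsClosedEmbedding (inclusion hℓS) := by
    refine ⟨IsEmbedding.inclusion hℓS, ?_⟩
    rw [range_inclusion]
    exact hcl
  obtain ⟨p₀, hp₀⟩ := hne
  obtain ⟨g, hgT, hg⟩ := ContinuousMap.exists_extension_forall_mem_of_isClosedEmbedding
    (τ.comp ⟨((↑) : ℓ → ℝ × ℝ), continuous_subtype_val⟩) (t := T) (fun x => (hτ x x.2).1)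
    ⟨_, (hτ p₀ hp₀).1⟩ he
  classical
  have hrc : Continuous (fun p : S => if (p : ℝ × ℝ) ∈ S₁ ∪ ℓ then (p : ℝ × ℝ) else σ (g p)) := by
    apply Continuous.if
    · intro p hp
      have hpl : (p : ℝ × ℝ) ∈ ℓ := by
        have hp' : p ∈ frontier ((↑) ⁻¹' (S₁ ∪ ℓ) : Set S) := hp
        have hclosed : IsClosed ((↑) ⁻¹' (S₁ ∪ ℓ) : Set S) := by
          rw [hcl2]; exact (h2.preimage continuous_subtype_val).isClosed_compl
        rw [hclosed.frontier_eq] at hp'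
        rcases hp'.1 with h | h
        · exfalso
          apply hp'.2
          rw [mem_interior]
          exact ⟨Subtype.val ⁻¹' S₁, preimage_mono subset_union_left,
            h1.preimage continuous_subtype_val, h⟩
        · exact h
      have := congrFun hg ⟨p, hpl⟩
      have h3 : g p = τ p := this
      rw [h3, (hτ p hpl).2]
    · exact continuous_subtype_val
    · fun_prop
  have hrm : ∀ p : S, (if (p : ℝ × ℝ) ∈ S₁ ∪ ℓ then (p : ℝ × ℝ) else σ (g p)) ∈ S₁ ∪ ℓ := by
    intro p
    split_ifs with h
    · exact h
    · exact Or.inr (hσ _ (hgT p))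
  refine sc_of_retract (Y := S) ⟨inclusion hsub, continuous_inclusion hsub⟩
    ⟨fun p => ⟨_, hrm p⟩, hrc.subtype_mk hrm⟩ ?_
  rintro ⟨p, hp⟩
  ext1
  exact if_pos hp

/-- Cutting a bounded open simply connected `S ⊆ ℝ²` along a diagonal `ℓ`
yields exactly two p-components `S₁, S₂`; `S₁ ∪ ℓ` and `S₂ ∪ ℓ` are simply connected,
and near every point of `ℓ` inside `S`, the two open sides of the supporting line of `ℓ`
lie in `S₁` and `S₂` respectively. -/
theorem cutting_along_diagonal (S ℓ : Set (ℝ × ℝ))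
    (hb : Bornology.IsBounded S) (ho : IsOpen S) (hsc : SimplyConnectedSpace S)
    (hdiag : IsDiagonal S ℓ) :
    ∃ S₁ S₂ : Set (ℝ × ℝ), S₁ ≠ S₂ ∧
      (∀ C, IsPComponent (S \ ℓ) C ↔ C = S₁ ∨ C = S₂) ∧
      SimplyConnectedSpace ↥(S₁ ∪ ℓ) ∧ SimplyConnectedSpace ↥(S₂ ∪ ℓ) ∧
      ∃ f : (ℝ × ℝ) →ₗ[ℝ] ℝ, f ≠ 0 ∧ (∀ p ∈ ℓ, ∀ q ∈ ℓ, f p = f q) ∧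
        ∀ A ∈ ℓ, ∀ ε > 0, Metric.ball A ε ⊆ S →
          Metric.ball A ε ∩ {x | f x < f A} ⊆ S₁ ∧
          Metric.ball A ε ∩ {x | f A < f x} ⊆ S₂ := by
  have hSne : S.Nonempty := by
    have : PathConnectedSpace S := inferInstance
    exact nonempty_coe_sort.1 this.nonempty
  have hSc : Sᶜ.Nonempty := by
    rw [nonempty_compl]
    rintro rfl
    exact NormedSpace.unbounded_univ ℝ (ℝ × ℝ) hb
  obtain ⟨f, c, hf, hfℓ, ⟨A₀, hA₀⟩, hF, τ, σ, T, hT, hτ, hσ⟩ := diag_facts hSne hdiag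
  have hℓS := hdiag.1
  have hpre : IsPreconnected ℓ := hdiag.2.1.1.isPreconnected
  obtain ⟨k, hk, hkA⟩ := separation hSc ho hℓS ⟨A₀, hA₀⟩ hF
  have hfc : Continuous f := f.continuous_of_finiteDimensional
  -- points of small balls lying on the supporting line belong to the diagonal
  have hball : ∀ A ∈ ℓ, ∀ ε, ball A ε ⊆ S → ∀ x ∈ ball A ε, f x = c → x ∈ ℓ := by
    intro A hA ε hS x hx hxc
    refine hF A hA x hxc (((convex_ball A ε).segment_subset hx ?_).trans hS)
    exact mem_ball_self (pos_of_mem_ball hx)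
  have hX : IsOpen (S \ ℓ) := by
    rw [Metric.isOpen_iff]
    intro p hp
    by_contra! hcon
    have hpcl : p ∈ closure ℓ := by
      rw [Metric.mem_closure_iff]
      intro ε hε
      obtain ⟨r, hr, hrS⟩ := Metric.isOpen_iff.1 ho p hp.1
      obtain ⟨y, hy, hyX⟩ := not_subset.1 (hcon (min ε r) (lt_min hε hr))
      refine ⟨y, ?_, ?_⟩
      · by_contra hyl
        exact hyX ⟨hrS (ball_subset_ball (min_le_right _ _) hy), hyl⟩
      · rw [dist_comm]; exact ball_subset_ball (min_le_left _ _) hy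
    have hpc : f p = c := by
      have : IsClosed {x | f x = c} := isClosed_eq hfc continuous_const
      exact closure_minimal (fun x hx => hfℓ x hx) this hpcl
    obtain ⟨r, hr, hrS⟩ := Metric.isOpen_iff.1 ho p hp.1
    obtain ⟨q, hq, hqd⟩ := Metric.mem_closure_iff.1 hpcl r hr
    refine hp.2 (hF q hq p hpc (((convex_ball p r).segment_subset (mem_ball_self hr) ?_).trans hrS))
    rw [mem_ball, dist_comm]; exact hqd
  have hf' : -f ≠ 0 := neg_ne_zero.2 hf
  have hfℓ' : ∀ p ∈ ℓ, (-f) p = -c := fun p hp => by simp [hfℓ p hp]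
  obtain ⟨r, hr, hrS⟩ := Metric.isOpen_iff.1 ho A₀ (hℓS hA₀)
  obtain ⟨U, hU, hUk⟩ := hkA A₀ hA₀
  have hN := inter_mem hU (ball_mem_nhds A₀ hr)
  obtain ⟨zp, hzp, hfzp⟩ := exists_side hf hN
  obtain ⟨zm, hzm, hfzm⟩ := exists_side hf' hN
  rw [hfℓ _ hA₀] at hfzp
  rw [hfℓ' _ hA₀] at hfzm
  have hfzm' : f zm < c := by simpa using hfzm
  have hzpX : zp ∈ S \ ℓ := ⟨hrS hzp.2, fun h => hfzp.ne' (hfℓ _ h)⟩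
  have hzmX : zm ∈ S \ ℓ := ⟨hrS hzm.2, fun h => hfzm'.ne (hfℓ _ h)⟩
  have hsep : ¬ PolyConn (S \ ℓ) zp zm := fun h => hUk zp hzp.1 zm hzm.1 hfzp hfzm' (hk _ _ h)
  have hup : ∀ A ∈ ℓ, ∀ ε > 0, ball A ε ⊆ S → ∀ x ∈ ball A ε, c < f x →
      PolyConn (S \ ℓ) zp x := by
    intro A hA ε hε hS x hx hxc
    exact half_conn ho hf hℓS hfℓ hpre hA₀ hA r ε hr hε hrS hS zp ⟨hzp.2, hfzp⟩ x ⟨hx, hxc⟩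
  have hdn : ∀ A ∈ ℓ, ∀ ε > 0, ball A ε ⊆ S → ∀ x ∈ ball A ε, f x < c →
      PolyConn (S \ ℓ) zm x := by
    intro A hA ε hε hS x hx hxc
    exact half_conn ho hf' hℓS hfℓ' hpre hA₀ hA r ε hr hε hrS hS zm ⟨hzm.2, hfzm⟩ x
      ⟨hx, by simpa using hxc⟩
  have refl' : ∀ x ∈ S \ ℓ, PolyConn (S \ ℓ) x x := fun x hx => (polyConn_iff _ _ _).2 ⟨hx, .refl⟩
  have hcover : ∀ x ∈ S \ ℓ, PolyConn (S \ ℓ) zm x ∨ PolyConn (S \ ℓ) zp x := by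
    intro B hB
    by_contra! hcon
    have hSpre : IsPreconnected S := by
      rw [isPreconnected_iff_preconnectedSpace]; infer_instance
    set C := {x | PolyConn (S \ ℓ) B x} with hC
    -- complement of C in S is open
    have hD : IsOpen (S \ C) := by
      rw [Metric.isOpen_iff]
      rintro p ⟨hpS, hpC⟩
      obtain ⟨e, he, heS⟩ := Metric.isOpen_iff.1 ho p hpS
      by_cases hpl : p ∈ ℓ
      · refine ⟨e, he, fun x hx => ⟨heS hx, fun hxC => ?_⟩⟩
        have hxl : x ∉ ℓ := hxC.2.1.2
        rcases lt_trichotomy (f x) c with h | h | h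
        · exact hcon.1 ((hdn p hpl e he heS x hx h).trans' (PolyConn.symm' hxC))
        · exact hxl (hball p hpl e heS x hx h)
        · exact hcon.2 ((hup p hpl e he heS x hx h).trans' (PolyConn.symm' hxC))
      · obtain ⟨e, he, heX⟩ := Metric.isOpen_iff.1 hX p ⟨hpS, hpl⟩
        refine ⟨e, he, fun x hx => ⟨(heX hx).1, fun hxC => hpC ?_⟩⟩
        exact PolyConn.trans' hxC
          (PolyConn.of_convex (convex_ball p e) heX hx (mem_ball_self he))
    obtain ⟨x, -, hx1, hx2⟩ := hSpre C (S \ C) (isOpen_polyClass hX B) hD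
      (fun x hx => by
        by_cases h : x ∈ C
        · exact Or.inl h
        · exact Or.inr ⟨hx, h⟩)
      ⟨B, hB.1, refl' B hB⟩ ⟨A₀, hℓS hA₀, hℓS hA₀, fun h => h.2.1.2 hA₀⟩
    exact hx2.2 hx1
  have hS12 : S = {x | PolyConn (S \ ℓ) zm x} ∪ {x | PolyConn (S \ ℓ) zp x} ∪ ℓ := by
    ext x
    constructor
    · intro hx
      by_cases h : x ∈ ℓ
      · exact Or.inr h
      · exact Or.inl (hcover x ⟨hx, h⟩)
    · rintro ((h | h) | h)
      · exact h.2.1.1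
      · exact h.2.1.1
      · exact hℓS h
  have hdisj : Disjoint {x | PolyConn (S \ ℓ) zm x} {x | PolyConn (S \ ℓ) zp x} := by
    rw [disjoint_left]
    intro x h1 h2
    exact hsep (PolyConn.trans' h2 (PolyConn.symm' h1))
  have hdl : ∀ z, Disjoint {x | PolyConn (S \ ℓ) z x} ℓ := by
    intro z
    rw [disjoint_left]
    intro x h1
    exact h1.2.1.2
  have hclass : ∀ z A, PolyConn (S \ ℓ) z A →
      {x | PolyConn (S \ ℓ) A x} = {x | PolyConn (S \ ℓ) z x} := by
    intro z A h
    ext x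
    exact ⟨fun h' => h.trans' h', fun h' => h.symm'.trans' h'⟩
  refine ⟨{x | PolyConn (S \ ℓ) zm x}, {x | PolyConn (S \ ℓ) zp x}, ?_, ?_, ?_, ?_, f, hf, ?_, ?_⟩
  · intro h
    have : zm ∈ {x | PolyConn (S \ ℓ) zp x} := by rw [← h]; exact refl' zm hzmX
    exact hsep this
  · intro C
    constructor
    · rintro ⟨A, hA, rfl⟩
      rcases hcover A hA with h | h
      · exact Or.inl (hclass _ _ h)
      · exact Or.inr (hclass _ _ h)
    · rintro (rfl | rfl)
      · exact ⟨zm, hzmX, rfl⟩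
      · exact ⟨zp, hzpX, rfl⟩
  · exact sc_piece hS12 (isOpen_polyClass hX _) (isOpen_polyClass hX _) hdisj (hdl _) (hdl _)
      ⟨A₀, hA₀⟩ τ σ T hT hτ hσ
  · exact sc_piece (S := S) (by rw [union_comm {x | PolyConn (S \ ℓ) zp x}]; exact hS12)
      (isOpen_polyClass hX _) (isOpen_polyClass hX _) hdisj.symm (hdl _) (hdl _)
      ⟨A₀, hA₀⟩ τ σ T hT hτ hσ
  · intro p hp q hq
    rw [hfℓ p hp, hfℓ q hq]
  · intro A hA ε hε hS
    rw [hfℓ A hA]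
    exact ⟨fun x hx => hdn A hA ε hε hS x hx.1 hx.2, fun x hx => hup A hA ε hε hS x hx.1 hx.2⟩
end

section
/- Let K ⊆ ℝ² be a convex body (compact convex set with nonempty interior). Then K contains a triangle T with λ₂(T) ≥ (3√3)/(4π) · λ₂(K). -/
open MeasureTheory
open scoped ENNReal

lemma upper_fn (K : Set (ℝ × ℝ)) (hK : IsCompact K) (a b : ℝ) (hp : Prod.fst '' K = Set.Icc a b) :
    ∃ f : ℝ → ℝ, Measurable f ∧ (∀ x ∈ Set.Icc a b, (x, f x) ∈ K) ∧ (∀ p ∈ K, p.2 ≤ f p.1) ∧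
      ∃ M, ∀ x, |f x| ≤ M := by
  classical
  have key : ∀ x ∈ Set.Icc a b, ∃ y, (x, y) ∈ K ∧ ∀ z, (x, z) ∈ K → z ≤ y := by
    intro x hx
    have hcp : IsCompact (K ∩ Prod.fst ⁻¹' {x}) :=
      hK.inter_right (isClosed_singleton.preimage continuous_fst)
    have hne : (K ∩ Prod.fst ⁻¹' {x}).Nonempty := by
      rw [← hp] at hx
      obtain ⟨p, hpK, rfl⟩ := hx
      exact ⟨p, hpK, rfl⟩
    obtain ⟨p, ⟨hpK, hpx⟩, hm⟩ := hcp.exists_isMaxOn hne continuous_snd.continuousOn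
    have hpx' : p.1 = x := hpx
    refine ⟨p.2, ?_, ?_⟩
    · rw [← hpx']; exact hpK
    · intro z hz
      exact hm (show (x, z) ∈ K ∩ Prod.fst ⁻¹' {x} from ⟨hz, rfl⟩)
  choose! f0 h1 h2 using key
  obtain ⟨M, hM⟩ := hK.isBounded.exists_norm_le
  refine ⟨fun x => if x ∈ Set.Icc a b then f0 x else 0, ?_, ?_, ?_, max M 0, ?_⟩
  · apply measurable_of_Ici
    intro s
    have : (fun x => if x ∈ Set.Icc a b then f0 x else 0) ⁻¹' Set.Ici s =
        (Prod.fst '' (K ∩ Prod.snd ⁻¹' Set.Ici s)) ∪ ((Set.Icc a b)ᶜ ∩ {_x | s ≤ 0}) := by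
      ext x
      by_cases hx : x ∈ Set.Icc a b
      · simp only [Set.mem_preimage, hx, if_true, Set.mem_Ici, Set.mem_union, Set.mem_inter_iff,
          Set.mem_compl_iff, not_true, false_and, or_false]
        constructor
        · intro h; exact ⟨(x, f0 x), ⟨h1 x hx, h⟩, rfl⟩
        · rintro ⟨p, ⟨hpK, hps⟩, rfl⟩
          exact le_trans hps (h2 _ hx _ hpK)
      · simp only [Set.mem_preimage, hx, if_false, Set.mem_Ici, Set.mem_union, Set.mem_inter_iff,
          Set.mem_compl_iff, not_false_iff, true_and, Set.mem_ofPred_eq]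
        constructor
        · intro h; exact Or.inr h
        · rintro (⟨p, ⟨hpK, hps⟩, rfl⟩ | h)
          · exact absurd (hp ▸ ⟨p, hpK, rfl⟩) hx
          · exact h
    rw [this]
    refine MeasurableSet.union ?_ (measurableSet_Icc.compl.inter (MeasurableSet.const _))
    exact ((hK.inter_right (isClosed_Ici.preimage continuous_snd)).image
      continuous_fst).isClosed.measurableSet
  · intro x hx
    simp only [hx, if_true]; exact h1 x hx
  · intro p hpK
    have hx : p.1 ∈ Set.Icc a b := hp ▸ ⟨p, hpK, rfl⟩
    simp only [hx, if_true]; exact h2 _ hx _ hpK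
  · intro x
    by_cases hx : x ∈ Set.Icc a b
    · simp only [hx, if_true]
      exact le_trans (le_trans (norm_snd_le (x, f0 x)) (hM _ (h1 x hx))) (le_max_left _ _)
    · simp [hx]

lemma lower_fn (K : Set (ℝ × ℝ)) (hK : IsCompact K) (a b : ℝ) (hp : Prod.fst '' K = Set.Icc a b) :
    ∃ f : ℝ → ℝ, Measurable f ∧ (∀ x ∈ Set.Icc a b, (x, f x) ∈ K) ∧ (∀ p ∈ K, f p.1 ≤ p.2) ∧
      ∃ M, ∀ x, |f x| ≤ M := by
  have hc : Continuous (fun p : ℝ × ℝ => (p.1, -p.2)) := by fun_prop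
  obtain ⟨f, h1, h2, h3, M, h4⟩ := upper_fn ((fun p : ℝ × ℝ => (p.1, -p.2)) '' K) (hK.image hc) a b
    (by rw [← hp, Set.image_image])
  refine ⟨fun x => - f x, h1.neg, ?_, ?_, M, ?_⟩
  · intro x hx
    obtain ⟨p, hpK, h⟩ := h2 x hx
    simp only [Prod.mk.injEq] at h
    have e : (x, -f x) = p := Prod.ext h.1.symm (by simp [← h.2])
    change (x, -f x) ∈ K
    rw [e]; exact hpK
  · intro p hpK
    have := h3 _ ⟨p, hpK, rfl⟩
    simp only at this
    linarith
  · intro x; simpa using h4 x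

lemma std_tri : ENNReal.ofReal (1/2) ≤ volume {p : ℝ × ℝ | 0 ≤ p.1 ∧ 0 ≤ p.2 ∧ p.1 + p.2 ≤ 1} := by
  have h := volume_regionBetween_eq_integral (μ := volume) (s := Set.Icc (0:ℝ) 1)
    (f := fun _ => (0:ℝ)) (g := fun x => 1 - x)
    (continuous_const.integrableOn_Icc) ((continuous_const.sub continuous_id).integrableOn_Icc)
    measurableSet_Icc (by intro x hx; simpa using hx.2)
  have h2 : ∫ y in Set.Icc (0:ℝ) 1, ((fun x : ℝ => 1 - x) - fun _ : ℝ => (0:ℝ)) y = 1/2 := by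
    rw [integral_Icc_eq_integral_Ioc, ← intervalIntegral.integral_of_le zero_le_one]
    simp only [Pi.sub_apply, sub_zero]
    rw [intervalIntegral.integral_sub (by simp) (by simp)]
    simp; norm_num
  rw [h2] at h
  rw [← h]
  apply measure_mono
  rintro ⟨x, y⟩ ⟨h1, h2⟩
  simp only [Set.mem_Icc, Set.mem_Ioo] at h1 h2
  refine ⟨h1.1, h2.1.le, ?_⟩
  simp only
  linarith [h2.2]

lemma tri_area (p q s : ℝ × ℝ) :
    ENNReal.ofReal (|(q.1-p.1)*(s.2-p.2) - (s.1-p.1)*(q.2-p.2)| / 2) ≤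
      volume (convexHull ℝ ({p, q, s} : Set (ℝ × ℝ))) := by
  set L : (ℝ × ℝ) →ₗ[ℝ] (ℝ × ℝ) := Matrix.toLin (Module.Basis.finTwoProd ℝ) (Module.Basis.finTwoProd ℝ)
    !![q.1-p.1, s.1-p.1; q.2-p.2, s.2-p.2] with hL
  have hdet : LinearMap.det L = (q.1-p.1)*(s.2-p.2) - (s.1-p.1)*(q.2-p.2) := by
    rw [hL, LinearMap.det_toLin, Matrix.det_fin_two_of]
  set T : Set (ℝ × ℝ) := {p : ℝ × ℝ | 0 ≤ p.1 ∧ 0 ≤ p.2 ∧ p.1 + p.2 ≤ 1}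
  have hsub : (fun x => p + x) '' (L '' T) ⊆ convexHull ℝ ({p, q, s} : Set (ℝ × ℝ)) := by
    rintro _ ⟨_, ⟨⟨u, v⟩, ⟨hu, hv, huv⟩, rfl⟩, rfl⟩
    simp only at hu hv huv
    have hcv := convex_convexHull ℝ ({p, q, s} : Set (ℝ × ℝ))
    have hsb := subset_convexHull ℝ ({p, q, s} : Set (ℝ × ℝ))
    have := hcv.sum_mem (t := Finset.univ) (w := ![1-u-v, u, v]) (z := ![p, q, s])
      (by intro i _; fin_cases i <;> simp <;> linarith)
      (by simp [Fin.sum_univ_three]; ring)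
      (by intro i _; apply hsb; fin_cases i <;> simp)
    convert this using 1
    simp only [hL, Matrix.toLin_finTwoProd_apply, Fin.sum_univ_three]
    ext <;> simp <;> ring
  calc _ = ENNReal.ofReal |LinearMap.det L| * ENNReal.ofReal (1/2) := by
        rw [← ENNReal.ofReal_mul (abs_nonneg _), hdet]; congr 1; ring
    _ ≤ ENNReal.ofReal |LinearMap.det L| * volume T := by gcongr; exact std_tri
    _ = volume (L '' T) := (Measure.addHaar_image_linearMap volume L T).symm
    _ = volume ((fun x => p + x) '' (L '' T)) := by
        rw [Set.image_add_left, measure_preimage_add]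
    _ ≤ _ := measure_mono hsub

lemma cov (a b : ℝ) (hab : a < b) (φ : ℝ → ℝ) :
    ∫ x in Set.Icc a b, φ x =
      ∫ θ in (0:ℝ)..Real.pi,
        φ ((a+b)/2 + (b-a)/2 * Real.cos θ) * ((b-a)/2 * Real.sin θ) := by
  have hr : 0 < (b-a)/2 := by linarith
  have himg : (fun θ => (a+b)/2 + (b-a)/2 * Real.cos θ) '' Set.Icc 0 Real.pi = Set.Icc a b := by
    ext x
    constructor
    · rintro ⟨θ, _, rfl⟩
      have h1 := Real.neg_one_le_cos θ
      have h2 := Real.cos_le_one θ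
      constructor <;> simp only <;> nlinarith
    · rintro ⟨h1, h2⟩
      refine ⟨Real.arccos ((x - (a+b)/2) / ((b-a)/2)),
        ⟨Real.arccos_nonneg _, Real.arccos_le_pi _⟩, ?_⟩
      simp only
      rw [Real.cos_arccos]
      · rw [mul_div_cancel₀ _ hr.ne']; ring
      · rw [le_div_iff₀ hr]; linarith
      · rw [div_le_iff₀ hr]; linarith
  rw [← himg, integral_image_eq_integral_abs_deriv_smul (f' := fun θ => (b-a)/2 * (-Real.sin θ))
    measurableSet_Icc]
  · rw [integral_Icc_eq_integral_Ioc, ← intervalIntegral.integral_of_le Real.pi_pos.le]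
    apply intervalIntegral.integral_congr
    intro θ hθ
    rw [Set.uIcc_of_le Real.pi_pos.le] at hθ
    have := Real.sin_nonneg_of_mem_Icc hθ
    simp only [smul_eq_mul, mul_neg, abs_neg]
    rw [abs_of_nonneg (by positivity)]; ring
  · intro θ _
    exact (((Real.hasDerivAt_cos θ).const_mul _).const_add _).hasDerivWithinAt
  · intro x hx y hy h
    apply Real.injOn_cos hx hy
    simp only at h
    exact mul_left_cancel₀ hr.ne' (by linarith)

lemma vol_le (K : Set (ℝ × ℝ)) (hK : IsCompact K) (a b : ℝ) (hp : Prod.fst '' K = Set.Icc a b)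
    (f g : ℝ → ℝ) (hf : IntegrableOn f (Set.Icc a b)) (hg : IntegrableOn g (Set.Icc a b))
    (hfK : ∀ p ∈ K, p.2 ≤ f p.1) (hgK : ∀ p ∈ K, g p.1 ≤ p.2) :
    volume K ≤ ENNReal.ofReal ((∫ x in Set.Icc a b, f x) - ∫ x in Set.Icc a b, g x) := by
  rw [← integral_sub hf hg, ofReal_integral_eq_lintegral_ofReal (f := fun x => f x - g x)
    (hf.sub hg),
    ← lintegral_indicator measurableSet_Icc, Measure.volume_eq_prod,
    Measure.prod_apply hK.measurableSet]
  · apply lintegral_mono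
    intro x
    by_cases hx : x ∈ Set.Icc a b
    · simp only [hx, Set.indicator_of_mem]
      rw [← Real.volume_Icc]
      apply measure_mono
      intro y hy
      exact ⟨hgK _ hy, hfK _ hy⟩
    · have : Prod.mk x ⁻¹' K = ∅ := by
        ext y
        simp only [Set.mem_preimage, Set.mem_empty_iff_false, iff_false]
        intro h
        exact hx (hp ▸ ⟨_, h, rfl⟩)
      simp [this]
  · rw [Filter.EventuallyLE, ae_restrict_iff' measurableSet_Icc]
    refine Filter.Eventually.of_forall fun x hx => ?_
    rw [← hp] at hx
    obtain ⟨p, hpK, rfl⟩ := hx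
    have := hfK p hpK
    have := hgK p hpK
    simp only [Pi.zero_apply]
    linarith

lemma proj_Icc (K : Set (ℝ × ℝ))
    (hK : IsCompact K) (hc : Convex ℝ K) (hint : (interior K).Nonempty) :
    ∃ a b : ℝ, a < b ∧ Prod.fst '' K = Set.Icc a b := by
  have hne : (Prod.fst '' K).Nonempty := (hint.mono interior_subset).image _
  have h := eq_Icc_of_connected_compact ⟨hne, (hc.isPreconnected.image _ continuous_fst.continuousOn)⟩
    (hK.image continuous_fst)
  refine ⟨_, _, ?_, h⟩
  obtain ⟨p, hpi⟩ := hint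
  obtain ⟨ε, hε, hb⟩ := Metric.mem_nhds_iff.1 (mem_interior_iff_mem_nhds.1 hpi)
  have h1 : p.1 ∈ Prod.fst '' K := ⟨p, interior_subset hpi, rfl⟩
  have h2 : p.1 + ε/2 ∈ Prod.fst '' K := by
    refine ⟨(p.1 + ε/2, p.2), hb ?_, rfl⟩
    rw [Metric.mem_ball, Prod.dist_eq]
    simp [abs_of_pos hε, hε]
  rw [h] at h1 h2
  linarith [h1.1, h2.2]

theorem blaschke_inscribed_triangle (K : Set (ℝ × ℝ))
    (hK : IsCompact K) (hc : Convex ℝ K) (hint : (interior K).Nonempty) :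
    ∃ a b c : ℝ × ℝ, convexHull ℝ {a, b, c} ⊆ K ∧
      ENNReal.ofReal (3 * Real.sqrt 3 / (4 * Real.pi)) * volume K ≤
        volume (convexHull ℝ ({a, b, c} : Set (ℝ × ℝ))) := by
  obtain ⟨a, b, hab, hp⟩ := proj_Icc K hK hc hint
  obtain ⟨f, hfm, hfK, hfu, M, hfM⟩ := upper_fn K hK a b hp
  obtain ⟨g, hgm, hgK, hgl, N, hgN⟩ := lower_fn K hK a b hp
  have hfi : IntegrableOn f (Set.Icc a b) :=
    Measure.integrableOn_of_bounded (M := M) (by simp) hfm.aestronglyMeasurable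
      (Filter.Eventually.of_forall hfM)
  have hgi : IntegrableOn g (Set.Icc a b) :=
    Measure.integrableOn_of_bounded (M := N) (by simp) hgm.aestronglyMeasurable
      (Filter.Eventually.of_forall hgN)
  have hvol := vol_le K hK a b hp f g hfi hgi hfu hgl
  set A := (∫ x in Set.Icc a b, f x) - ∫ x in Set.Icc a b, g x with hA
  set r := (b-a)/2 with hr
  set c := (a+b)/2 with hcc
  have hr0 : 0 < r := by rw [hr]; linarith
  let F : ℝ → ℝ := fun θ =>
    if 0 ≤ Real.sin θ then f (c + r * Real.cos θ) else g (c + r * Real.cos θ)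
  let H : ℝ → ℝ := fun θ => F θ * Real.sin θ
  have hFK : ∀ θ, (c + r * Real.cos θ, F θ) ∈ K := by
    intro θ
    have hx : c + r * Real.cos θ ∈ Set.Icc a b := by
      have h1 := Real.neg_one_le_cos θ
      have h2 := Real.cos_le_one θ
      constructor <;> nlinarith
    simp only [F]
    split_ifs
    · exact hfK _ hx
    · exact hgK _ hx
  have hFm : Measurable F := by
    refine Measurable.ite (measurableSet_le measurable_const Real.measurable_sin) ?_ ?_
    · exact hfm.comp (by fun_prop)
    · exact hgm.comp (by fun_prop)
  have hHm : Measurable H := hFm.mul Real.measurable_sin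
  have hHb : ∀ θ, ‖H θ‖ ≤ max M N := by
    intro θ
    have h1 : |F θ| ≤ max M N := by
      simp only [F]
      split_ifs
      · exact le_max_of_le_left (hfM _)
      · exact le_max_of_le_right (hgN _)
    have h2 := Real.abs_sin_le_one θ
    simp only [H, Real.norm_eq_abs, abs_mul]
    nlinarith [abs_nonneg (F θ), abs_nonneg (Real.sin θ)]
  have hHi : ∀ u v, IntervalIntegrable H volume u v := fun u v =>
    intervalIntegrable_iff.2 (Measure.integrableOn_of_bounded (M := max M N) (by simp)
      hHm.aestronglyMeasurable (Filter.Eventually.of_forall hHb))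
  have hHp : Function.Periodic H (2 * Real.pi) := by
    intro θ
    simp only [H, F, Real.sin_add_two_pi, Real.cos_add_two_pi]
  have hI : r * ∫ θ in (-Real.pi)..Real.pi, H θ = A := by
    rw [← intervalIntegral.integral_add_adjacent_intervals (hHi (-Real.pi) 0) (hHi 0 Real.pi), hA,
      cov a b hab f, cov a b hab g]
    have e1 : ∫ θ in (-Real.pi)..0, H θ = ∫ θ in (0:ℝ)..Real.pi, H (-θ) := by
      rw [intervalIntegral.integral_comp_neg]; simp
    rw [e1, mul_add, ← intervalIntegral.integral_const_mul, ← intervalIntegral.integral_const_mul]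
    have e2 : ∫ θ in (0:ℝ)..Real.pi, r * H θ =
        ∫ θ in (0:ℝ)..Real.pi, f (c + r * Real.cos θ) * (r * Real.sin θ) := by
      apply intervalIntegral.integral_congr
      intro θ hθ
      rw [Set.uIcc_of_le Real.pi_pos.le] at hθ
      have := Real.sin_nonneg_of_mem_Icc hθ
      simp only [H, F, this, if_true]; ring
    have e3 : ∫ θ in (0:ℝ)..Real.pi, r * H (-θ) =
        - ∫ θ in (0:ℝ)..Real.pi, g (c + r * Real.cos θ) * (r * Real.sin θ) := by
      rw [← intervalIntegral.integral_neg]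
      apply intervalIntegral.integral_congr
      intro θ hθ
      rw [Set.uIcc_of_le Real.pi_pos.le] at hθ
      have := Real.sin_nonneg_of_mem_Icc hθ
      rcases this.eq_or_lt with h0 | h0
      · simp [H, ← h0]
      · have : ¬ (0 ≤ - Real.sin θ) := by linarith
        simp only [H, F, Real.sin_neg, Real.cos_neg, this, if_false]; ring
    rw [e2, e3]; ring
  have hshift : ∀ s, ∫ θ in (-Real.pi)..Real.pi, H (θ + s) = ∫ θ in (-Real.pi)..Real.pi, H θ := by
    intro s
    rw [intervalIntegral.integral_comp_add_right]
    have := hHp.intervalIntegral_add_eq (-Real.pi + s) (-Real.pi)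
    convert this using 2 <;> ring
  let D : ℝ → ℝ := fun t =>
    r * Real.sqrt 3 * (H t + H (t + 2 * Real.pi / 3) + H (t + 4 * Real.pi / 3))
  have hHi' : ∀ s u v, IntervalIntegrable (fun θ => H (θ + s)) volume u v := fun s u v =>
    intervalIntegrable_iff.2 (Measure.integrableOn_of_bounded (M := max M N) (by simp)
      (hHm.comp (measurable_id.add_const s)).aestronglyMeasurable
      (Filter.Eventually.of_forall fun θ => hHb _))
  have hDi : IntervalIntegrable D volume (-Real.pi) Real.pi :=
    (((hHi _ _).add (hHi' _ _ _)).add (hHi' _ _ _)).const_mul _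
  have hDint : ∫ t in (-Real.pi)..Real.pi, D t = 3 * Real.sqrt 3 * A := by
    simp only [D]
    rw [intervalIntegral.integral_const_mul, intervalIntegral.integral_add
      ((hHi _ _).add (hHi' _ _ _)) (hHi' _ _ _), intervalIntegral.integral_add
      (hHi _ _) (hHi' _ _ _), hshift, hshift, ← hI]
    ring
  have hex : ∃ t, 3 * Real.sqrt 3 * A / (2 * Real.pi) ≤ D t := by
    by_contra! hcon
    have := intervalIntegral.intervalIntegral_pos_of_pos
      (f := fun t => 3 * Real.sqrt 3 * A / (2 * Real.pi) - D t)
      (a := -Real.pi) (b := Real.pi) (intervalIntegrable_const.sub hDi)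
      (fun t => sub_pos.2 (hcon t)) (by linarith [Real.pi_pos])
    rw [intervalIntegral.integral_sub intervalIntegrable_const hDi, hDint,
      intervalIntegral.integral_const, smul_eq_mul] at this
    have hpi := Real.pi_pos.ne'
    have e : (Real.pi - -Real.pi) * (3 * Real.sqrt 3 * A / (2 * Real.pi)) = 3 * Real.sqrt 3 * A := by
      field_simp; ring
    linarith
  obtain ⟨t, ht⟩ := hex
  refine ⟨(c + r * Real.cos t, F t),
    (c + r * Real.cos (t + 2 * Real.pi / 3), F (t + 2 * Real.pi / 3)),
    (c + r * Real.cos (t + 4 * Real.pi / 3), F (t + 4 * Real.pi / 3)), ?_, ?_⟩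
  · apply convexHull_min _ hc
    rintro p (rfl | rfl | rfl) <;> exact hFK _
  · refine le_trans ?_ (tri_area _ _ _)
    refine le_trans (mul_le_mul_right hvol _) ?_
    rw [← ENNReal.ofReal_mul (by positivity)]
    apply ENNReal.ofReal_le_ofReal
    have c1 : Real.cos (2 * Real.pi / 3) = -1/2 := by
      rw [show 2 * Real.pi / 3 = Real.pi - Real.pi / 3 by ring, Real.cos_pi_sub,
        Real.cos_pi_div_three]; ring
    have s1 : Real.sin (2 * Real.pi / 3) = Real.sqrt 3 / 2 := by
      rw [show 2 * Real.pi / 3 = Real.pi - Real.pi / 3 by ring, Real.sin_pi_sub,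
        Real.sin_pi_div_three]
    have c2 : Real.cos (4 * Real.pi / 3) = -1/2 := by
      rw [show 4 * Real.pi / 3 = Real.pi / 3 + Real.pi by ring, Real.cos_add_pi,
        Real.cos_pi_div_three]; ring
    have s2 : Real.sin (4 * Real.pi / 3) = - (Real.sqrt 3 / 2) := by
      rw [show 4 * Real.pi / 3 = Real.pi / 3 + Real.pi by ring, Real.sin_add_pi,
        Real.sin_pi_div_three]
    have h3 : Real.sqrt 3 * Real.sqrt 3 = 3 := Real.mul_self_sqrt (by norm_num)
    have hD : D t = (c + r * Real.cos (t + 2 * Real.pi / 3) - (c + r * Real.cos t)) *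
          (F (t + 4 * Real.pi / 3) - F t) -
        (c + r * Real.cos (t + 4 * Real.pi / 3) - (c + r * Real.cos t)) *
          (F (t + 2 * Real.pi / 3) - F t) := by
      simp only [D, H]
      generalize F (t + 4 * Real.pi / 3) = y2
      generalize F (t + 2 * Real.pi / 3) = y1
      simp only [Real.cos_add, Real.sin_add, c1, s1, c2, s2]
      linear_combination (r * Real.cos t * (y1 - y2) / 2) * h3
    rw [← hD]
    calc _ = (3 * Real.sqrt 3 * A / (2 * Real.pi)) / 2 := by
          have hpi := Real.pi_pos.ne'
          field_simp; ring
      _ ≤ |D t| / 2 := by linarith [le_abs_self (D t)]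
end

section
/- For d ≥ 2 and every ε ∈ (0,1] sufficiently small, there exists a set S ⊆ ℝᵈ of Lebesgue measure 1 with convexity ratio c(S) ≤ ε and d-index of convexity b_d(S) ≥ γ·ε/log₂(1/ε), where γ = 1/(8·C(d+2,d)·dᵈ). The set S can be taken as (0,1)ᵈ minus a (1/r)-net of size 2·C(d+2,d)·r·⌈log₂ r⌉ for the system of d-dimensional ellipsoids contained in (0,1)ᵈ, with r = dᵈ/ε. -/
open MeasureTheory
open scoped ENNReal Matrix

lemma lb_lintegral_section_le {α β : Type*} [MeasurableSpace α] [MeasurableSpace β]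
    (μ : Measure α) (ν : Measure β) [SFinite ν] (s : Set (α × β)) :
    ∫⁻ x, ν (Prod.mk x ⁻¹' s) ∂μ ≤ μ.prod ν s := by
  rw [← measure_toMeasurable s, Measure.prod_apply (measurableSet_toMeasurable _ _)]
  exact lintegral_mono fun x => measure_mono (Set.preimage_mono (subset_toMeasurable _ _))

lemma lb_ae_linInd (d k : ℕ) (hk : k ≤ d) (p : Fin d → ℝ) :
    ∀ᵐ B : Fin k → (Fin d → ℝ), LinearIndependent ℝ (fun i => B i - p) := by
  induction k with
  | zero => exact Filter.Eventually.of_forall fun B => linearIndependent_empty_type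
  | succ k ih =>
    have ih := ih (by omega)
    have hmp := volume_preserving_piFinSuccAbove (fun _ : Fin (k+1) => (Fin d → ℝ)) 0
    have hopen : ∀ k : ℕ, IsOpen {B : Fin k → (Fin d → ℝ) | LinearIndependent ℝ (fun i => B i - p)} := by
      intro k
      have : Continuous (fun B : Fin k → (Fin d → ℝ) => (fun i => B i - p)) := by fun_prop
      exact (isOpen_setOfPred_linearIndependent (𝕜 := ℝ) (E := Fin d → ℝ) (ι := Fin k)).preimage this
    have key : ∀ᵐ z : (Fin d → ℝ) × (Fin k → (Fin d → ℝ)),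
        LinearIndependent ℝ (fun i => (Fin.cons z.1 z.2 : Fin (k+1) → (Fin d → ℝ)) i - p) := by
      have hm : MeasurableSet {z : (Fin d → ℝ) × (Fin k → (Fin d → ℝ)) |
          LinearIndependent ℝ (fun i => (Fin.cons z.1 z.2 : Fin (k+1) → (Fin d → ℝ)) i - p)} := by
        have : Continuous (fun z : (Fin d → ℝ) × (Fin k → (Fin d → ℝ)) =>
          (Fin.cons z.1 z.2 : Fin (k+1) → (Fin d → ℝ))) := by fun_prop
        exact ((hopen (k+1)).preimage this).measurableSet
      rw [Measure.volume_eq_prod, ← (Measure.measurePreserving_swap).map_eq, ae_map_iff measurable_swap.aemeasurable hm]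
      refine (Measure.ae_prod_iff_ae_ae (measurable_swap hm)).2 ?_
      filter_upwards [ih] with B hB
      have hlt : Submodule.span ℝ (Set.range fun i => B i - p) ≠ ⊤ := by
        intro h
        have h1 := finrank_range_le_card (R := ℝ) (fun i => B i - p)
        rw [Set.finrank, h] at h1
        simp at h1
        omega
      have h0 := Measure.addHaar_submodule (volume : Measure (Fin d → ℝ)) _ hlt
      have h1 := measure_preimage_add_right (volume : Measure (Fin d → ℝ)) (-p)
        (Submodule.span ℝ (Set.range fun i => B i - p) : Set (Fin d → ℝ))
      rw [h0] at h1
      rw [ae_iff]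
      refine measure_mono_null ?_ h1
      intro x hx
      by_contra hx'
      apply hx
      have : (fun i => (Fin.cons x B : Fin (k+1) → (Fin d → ℝ)) i - p) =
          Fin.cons (x - p) (fun i => B i - p) := by
        funext i
        refine Fin.cases ?_ (fun i => ?_) i <;> simp
      simp only [Prod.swap_prod_mk]
      rw [this, linearIndependent_finCons]
      refine ⟨hB, ?_⟩
      simpa [sub_eq_add_neg] using hx'
    have := hmp.quasiMeasurePreserving.ae key
    filter_upwards [this] with B hB
    convert hB using 2 with i
    refine Fin.cases ?_ (fun i => ?_) i <;> simp [MeasurableEquiv.piFinSuccAbove, Fin.tail]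

lemma lb_hyperplane_null (d : ℕ) (φ : ((Fin d → ℝ) × ℝ) →ₗ[ℝ] ℝ) (h : φ ≠ 0) :
    volume {x : Fin d → ℝ | φ (x, 1) = 0} = 0 := by
  let a : (Fin d → ℝ) →ᵃ[ℝ] ℝ :=
    (φ.comp (LinearMap.inl ℝ (Fin d → ℝ) ℝ)).toAffineMap + AffineMap.const ℝ _ (φ (0, 1))
  have ha : ∀ x, a x = φ (x, 1) := by
    intro x
    simp [a, ← map_add]
  let s : AffineSubspace ℝ (Fin d → ℝ) := (affineSpan ℝ {(0:ℝ)}).comap a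
  have hs : (s : Set (Fin d → ℝ)) = {x : Fin d → ℝ | φ (x, 1) = 0} := by
    ext x
    simp [s, ha]
  rw [← hs]
  apply Measure.addHaar_affineSubspace
  intro htop
  apply h
  have h1 : ∀ x, φ (x, 1) = 0 := by
    intro x
    have : x ∈ (s : Set (Fin d → ℝ)) := by rw [htop]; trivial
    rw [hs] at this
    exact this
  apply LinearMap.ext
  rintro ⟨x, c⟩
  have : ((x, c) : (Fin d → ℝ) × ℝ) = (x, 1) + (c - 1) • (0, 1) := by simp
  rw [this, map_add, map_smul, h1, h1]; simp

lemma lb_exists_fg (d k : ℕ) (hk : k + 1 = d) (B : Fin k → (Fin d → ℝ)) (p : Fin d → ℝ) :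
    ∃ f g : ((Fin d → ℝ) × ℝ) →ₗ[ℝ] ℝ, g ≠ 0 ∧ g (p, 1) = 0 ∧ (∀ i, g (B i, 1) = 0) ∧
      (∀ i, f (B i, 1) = 0) ∧ ∀ t : ℝ, f - t • g ≠ 0 := by
  have hE : Module.finrank ℝ ((Fin d → ℝ) × ℝ) = d + 1 := by simp
  let W := Submodule.span ℝ (Set.range fun i => ((B i, 1) : (Fin d → ℝ) × ℝ))
  let W' := Submodule.span ℝ (Set.range (Fin.cons (p, 1) (fun i => (B i, 1)) : Fin (k+1) → ((Fin d → ℝ) × ℝ)))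
  have hW : Module.finrank ℝ W ≤ k := by
    simpa [Set.finrank] using finrank_range_le_card (R := ℝ) (fun i => ((B i, 1) : (Fin d → ℝ) × ℝ))
  have hW' : Module.finrank ℝ W' ≤ k + 1 := by
    simpa [Set.finrank] using finrank_range_le_card (R := ℝ) (Fin.cons (p, 1) (fun i => (B i, 1)) : Fin (k+1) → ((Fin d → ℝ) × ℝ))
  have hlt : W' < ⊤ := by
    rw [lt_top_iff_ne_top]
    intro h
    rw [h, finrank_top, hE] at hW'
    omega
  obtain ⟨g, hg0, hg⟩ := Submodule.exists_le_ker_of_lt_top W' hlt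
  have hgp : g (p, 1) = 0 := hg (Submodule.subset_span ⟨0, by simp⟩)
  have hgB : ∀ i, g (B i, 1) = 0 := fun i => hg (Submodule.subset_span ⟨i.succ, by simp⟩)
  have hker : Module.finrank ℝ (LinearMap.ker g) = d := by
    have := LinearMap.finrank_range_add_finrank_ker g
    have h2 : Module.finrank ℝ (LinearMap.range g) = 1 := by
      rw [LinearMap.range_eq_top.2 (LinearMap.surjective hg0)]; simp
    omega
  have : ∃ u ∈ LinearMap.ker g, u ∉ W := by
    by_contra! hcon
    have h3 : LinearMap.ker g ≤ W := hcon
    have := Submodule.finrank_mono h3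
    omega
  obtain ⟨u, hu, huW⟩ := this
  obtain ⟨f, hfu, hf⟩ := Submodule.exists_le_ker_of_notMem huW
  refine ⟨f, g, hg0, hgp, hgB, fun i => hf (Submodule.subset_span ⟨i, rfl⟩), fun t ht => hfu ?_⟩
  have := congrArg (fun φ => φ u) ht
  simpa [LinearMap.mem_ker.1 hu] using this

lemma lb_avoid_pos (d k : ℕ) (φ : ((Fin d → ℝ) × ℝ) →ₗ[ℝ] ℝ) (B : Fin k → (Fin d → ℝ))
    (x y p : Fin d → ℝ) (hB : ∀ i, φ (B i, 1) = 0) (hx : 0 < φ (x, 1)) (hy : 0 < φ (y, 1))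
    (hp : φ (p, 1) = 0)
    (h : p ∈ convexHull ℝ (Set.range (Fin.cons x (Fin.cons y B) : Fin (k+2) → (Fin d → ℝ)))) :
    p ∈ convexHull ℝ (Set.range B) := by
  have hcomb : ∀ (a b : ℝ) (z w : Fin d → ℝ), a + b = 1 →
      φ (a • z + b • w, 1) = a * φ (z, 1) + b * φ (w, 1) := by
    intro a b z w hab
    have : ((a • z + b • w, 1) : (Fin d → ℝ) × ℝ) = a • (z, 1) + b • (w, 1) := by
      simp [hab]
    rw [this, map_add, map_smul, map_smul]; simp
  have hz : ∀ z ∈ convexHull ℝ (Set.range B), φ (z, 1) = 0 := by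
    have : convexHull ℝ (Set.range B) ⊆ {z | φ (z, 1) = 0} := by
      apply convexHull_min
      · rintro _ ⟨i, rfl⟩; exact hB i
      · intro z hz w hw a b ha hb hab
        simp only [Set.mem_ofPred_eq] at *
        rw [hcomb a b z w hab, hz, hw]; simp
    exact this
  have hsub : convexHull ℝ (Set.range (Fin.cons x (Fin.cons y B) : Fin (k+2) → (Fin d → ℝ))) ⊆
      {z | 0 < φ (z, 1) ∨ z ∈ convexHull ℝ (Set.range B)} := by
    apply convexHull_min
    · rintro _ ⟨i, rfl⟩
      refine Fin.cases ?_ (fun i => ?_) i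
      · left; simpa using hx
      · refine Fin.cases ?_ (fun i => ?_) i
        · left; simpa using hy
        · right; simpa using subset_convexHull ℝ (Set.range B) ⟨i, rfl⟩
    · intro z hz' w hw' a b ha hb hab
      simp only [Set.mem_ofPred_eq] at *
      rw [hcomb a b z w hab]
      by_cases hc : z ∈ convexHull ℝ (Set.range B) ∧ w ∈ convexHull ℝ (Set.range B)
      · right; exact convex_convexHull ℝ _ hc.1 hc.2 ha hb hab
      rcases ha.eq_or_lt with ha0 | ha0
      · subst ha0
        obtain rfl : b = 1 := by linarith
        simpa using hw'
      rcases hb.eq_or_lt with hb0 | hb0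
      · subst hb0
        obtain rfl : a = 1 := by linarith
        simpa using hz'
      left
      rcases hz' with h1 | h1 <;> rcases hw' with h2 | h2
      · positivity
      · rw [hz w h2]; simp; positivity
      · rw [hz z h1]; simp; positivity
      · exact absurd ⟨h1, h2⟩ hc
  rcases hsub h with h1 | h1
  · simp only [hp] at h1; exact absurd h1 (lt_irrefl _)
  · exact h1

lemma lb_avoid (d k : ℕ) (φ : ((Fin d → ℝ) × ℝ) →ₗ[ℝ] ℝ) (B : Fin k → (Fin d → ℝ))
    (x y p : Fin d → ℝ) (hB : ∀ i, φ (B i, 1) = 0) (hxy : 0 < φ (x, 1) * φ (y, 1))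
    (hp : φ (p, 1) = 0)
    (h : p ∈ convexHull ℝ (Set.range (Fin.cons x (Fin.cons y B) : Fin (k+2) → (Fin d → ℝ)))) :
    p ∈ convexHull ℝ (Set.range B) := by
  rcases mul_pos_iff.1 hxy with ⟨h1, h2⟩ | ⟨h1, h2⟩
  · exact lb_avoid_pos d k φ B x y p hB h1 h2 hp h
  · exact lb_avoid_pos d k (-φ) B x y p (by simpa using hB) (by simpa using h1) (by simpa using h2)
      (by simpa using hp) h

/-- Pigeonhole / Cauchy–Schwarz for a measurable colouring with finitely many colours. -/
lemma lb_cells {α ι : Type*} [MeasurableSpace α] (μ : Measure α) [IsProbabilityMeasure μ]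
    (J : Finset ι) (C : ι → Set α) (hC : ∀ j ∈ J, MeasurableSet (C j))
    (hdis : (J : Set ι).PairwiseDisjoint C)
    (hcov : ∀ᵐ x ∂μ, ∃ j ∈ J, x ∈ C j) :
    ENNReal.ofReal (1 / (J.card : ℝ)) ≤ μ.prod μ (⋃ j ∈ J, C j ×ˢ C j) := by
  have h1 : ∑ j ∈ J, μ (C j) = 1 := by
    rw [← measure_biUnion_finset hdis hC, ← prob_compl_eq_zero_iff₀]
    · rw [ae_iff] at hcov
      convert hcov using 2
      ext x; simp
    · exact (Finset.measurableSet_biUnion J hC).nullMeasurableSet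
  rw [measure_biUnion_finset]
  · simp only [Measure.prod_prod]
    have h2 : ∑ j ∈ J, (μ (C j)).toReal = 1 := by
      rw [← ENNReal.toReal_sum (fun j _ => measure_ne_top _ _), h1]; simp
    have h3 := sq_sum_le_card_mul_sum_sq (s := J) (f := fun j => (μ (C j)).toReal)
    rw [h2] at h3
    rw [ENNReal.ofReal_le_iff_le_toReal, ENNReal.toReal_sum]
    · have h4 : ∑ j ∈ J, (μ (C j) * μ (C j)).toReal = ∑ j ∈ J, (μ (C j)).toReal ^ 2 :=
        Finset.sum_congr rfl fun j _ => by rw [ENNReal.toReal_mul, pow_two]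
      rw [h4]
      apply div_le_of_le_mul₀ (by positivity) (by positivity)
      linarith
    · intro j _; exact ENNReal.mul_ne_top (measure_ne_top _ _) (measure_ne_top _ _)
    · exact ENNReal.sum_ne_top.2 fun j _ => ENNReal.mul_ne_top (measure_ne_top _ _) (measure_ne_top _ _)
  · intro i hi j hj hij
    exact Set.Disjoint.set_prod_left (hdis hi hj hij) _ _
  · intro j hj
    exact (hC j hj).prod (hC j hj)

/-- the open unit cube -/
def lbCube (d : ℕ) : Set (Fin d → ℝ) := Set.pi Set.univ fun _ => Set.Ioo (0:ℝ) 1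

lemma lbCube_meas (d : ℕ) : MeasurableSet (lbCube d) :=
  MeasurableSet.univ_pi fun _ => measurableSet_Ioo

lemma lbCube_vol (d : ℕ) : volume (lbCube d) = 1 := by
  simp [lbCube, volume_pi_pi]

lemma lbCube_convex (d : ℕ) : Convex ℝ (lbCube d) :=
  convex_pi fun _ _ => convex_Ioo _ _

instance lbCube_prob (d : ℕ) : IsProbabilityMeasure (volume.restrict (lbCube d)) :=
  ⟨by simp [lbCube_vol]⟩

lemma lb_section (d k n : ℕ) (hk : k + 1 = d) (N : Finset (Fin d → ℝ)) (hN : N.Nonempty)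
    (hn : N.card ≤ n) (B : Fin k → (Fin d → ℝ)) (hB : ∀ p ∈ N, p ∉ convexHull ℝ (Set.range B)) :
    ENNReal.ofReal (1 / (2 * (n : ℝ))) ≤
      (volume : Measure ((Fin d → ℝ) × (Fin d → ℝ))) {z | z.1 ∈ lbCube d ∧ z.2 ∈ lbCube d ∧
        ∀ p ∈ N, p ∉ convexHull ℝ (Set.range (Fin.cons z.1 (Fin.cons z.2 B) :
          Fin (k+2) → (Fin d → ℝ)))} := by
  classical
  obtain ⟨p0, hp0⟩ := hN
  obtain ⟨f, g, hg0, hgp, hgB, hfB, hfg⟩ := lb_exists_fg d k hk B p0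
  let t : (Fin d → ℝ) → ℝ := fun x => f (x, 1) / g (x, 1)
  let N' := N.erase p0
  have hN' : N'.card < n := by
    exact (Finset.card_erase_lt_of_mem hp0).trans_le hn
  have hfm : Measurable (fun x : Fin d → ℝ => f (x, 1)) := by
    have := f.continuous_of_finiteDimensional
    exact (this.comp (by fun_prop : Continuous fun x : Fin d → ℝ => (x, (1:ℝ)))).measurable
  have hgm : Measurable (fun x : Fin d → ℝ => g (x, 1)) := by
    have := g.continuous_of_finiteDimensional
    exact (this.comp (by fun_prop : Continuous fun x : Fin d → ℝ => (x, (1:ℝ)))).measurable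
  have htm : Measurable t := hfm.div hgm
  let cnt : (Fin d → ℝ) → ℕ := fun x => (N'.filter fun p => t p < t x).card
  have hcm : Measurable cnt := by
    have : cnt = fun x => ∑ p ∈ N', if t p < t x then 1 else 0 := by
      funext x; exact Finset.card_filter _ _
    rw [this]
    refine Finset.measurable_sum _ fun p _ => ?_
    exact Measurable.ite (measurableSet_lt measurable_const htm) measurable_const measurable_const
  let good : Set (Fin d → ℝ) := {x | x ∈ lbCube d ∧ g (x, 1) ≠ 0 ∧ ∀ p ∈ N', t x ≠ t p}
  have hgoodm : MeasurableSet good := by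
    have : good = lbCube d ∩ ((fun x => g (x, 1)) ⁻¹' {0}ᶜ ∩ ⋂ p ∈ N', t ⁻¹' {t p}ᶜ) := by
      ext x; simp [good]; tauto
    rw [this]
    refine (lbCube_meas d).inter ((hgm (measurableSet_singleton _).compl).inter ?_)
    exact Finset.measurableSet_biInter _ fun p _ => htm (measurableSet_singleton _).compl
  let C : Bool × ℕ → Set (Fin d → ℝ) := fun j => {x | x ∈ good ∧ (0 < g (x, 1) ↔ j.1 = true) ∧ cnt x = j.2}
  let J : Finset (Bool × ℕ) := Finset.univ ×ˢ Finset.range n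
  have hCm : ∀ j ∈ J, MeasurableSet (C j) := by
    rintro ⟨b, m⟩ -
    have h1 : MeasurableSet {x : Fin d → ℝ | 0 < g (x, 1)} := measurableSet_lt measurable_const hgm
    have h2 : MeasurableSet {x : Fin d → ℝ | 0 < g (x, 1) ↔ b = true} := by
      cases b
      · simpa [Set.compl_ofPred] using h1.compl
      · simpa using h1
    exact hgoodm.inter (h2.inter (hcm (measurableSet_singleton m)))
  have hdis : (J : Set (Bool × ℕ)).PairwiseDisjoint C := by
    rintro ⟨b, m⟩ - ⟨b', m'⟩ - hne
    rw [Function.onFun, Set.disjoint_left]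
    rintro x ⟨_, h1, h2⟩ ⟨_, h3, h4⟩
    apply hne
    simp only at h1 h2 h3 h4
    rw [Prod.mk.injEq]
    refine ⟨?_, by omega⟩
    rw [h1] at h3
    cases b <;> cases b' <;> simp_all
  have hae : ∀ᵐ x ∂(volume.restrict (lbCube d)), ∃ j ∈ J, x ∈ C j := by
    rw [ae_restrict_iff' (lbCube_meas d)]
    have e1 : ∀ᵐ x : Fin d → ℝ, g (x, 1) ≠ 0 := by
      rw [ae_iff]; simpa using lb_hyperplane_null d g hg0
    have e2 : ∀ᵐ x : Fin d → ℝ, ∀ p ∈ N', f (x, 1) - t p * g (x, 1) ≠ 0 := by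
      rw [Filter.eventually_all_finset]
      intro p _
      rw [ae_iff]; simpa using lb_hyperplane_null d _ (hfg (t p))
    filter_upwards [e1, e2] with x h1 h2 hx
    refine ⟨(decide (0 < g (x, 1)), cnt x), ?_, ⟨hx, h1, ?_⟩, by simp, rfl⟩
    · simp only [J, Finset.mem_product, Finset.mem_univ, Finset.mem_range, true_and]
      exact (Finset.card_filter_le _ _).trans_lt hN'
    · intro p hp h
      apply h2 p hp
      rw [← h]; simp only [t]; field_simp; simp
  have hmain := lb_cells (volume.restrict (lbCube d)) J C hCm hdis hae
  have hJ : (J.card : ℝ) = 2 * n := by simp [J]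
  rw [hJ] at hmain
  refine hmain.trans ?_
  rw [Measure.prod_restrict, ← Measure.volume_eq_prod]
  refine (Measure.restrict_apply_le _ _).trans (measure_mono ?_)
  rintro ⟨x, y⟩ hxy
  simp only [Set.mem_iUnion, Set.mem_prod, exists_prop] at hxy
  obtain ⟨⟨b, m⟩, -, ⟨⟨hx1, hx2, hx3⟩, hx4, hx5⟩, ⟨⟨hy1, hy2, hy3⟩, hy4, hy5⟩⟩ := hxy
  refine ⟨hx1, hy1, fun p hp hmem => hB p hp ?_⟩
  simp only at hx4 hx5 hy4 hy5 hmem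
  have hgg : 0 < g (x, 1) * g (y, 1) := by
    rcases lt_or_gt_of_ne hx2 with h | h
    · have : ¬ 0 < g (y, 1) := by rw [hy4, ← hx4]; exact not_lt.2 h.le
      exact mul_pos_of_neg_of_neg h (lt_of_le_of_ne (not_lt.1 this) hy2)
    · exact mul_pos h (hy4.2 (hx4.1 h))
  by_cases hgp' : g (p, 1) = 0
  · exact lb_avoid d k g B x y p hgB hgg hgp' hmem
  have hpN' : p ∈ N' := Finset.mem_erase.2 ⟨fun h => hgp' (h ▸ hgp), hp⟩
  have hiff : t p < t x ↔ t p < t y := by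
    have aux : ∀ u v : Fin d → ℝ, t u ≤ t v → cnt u = cnt v → (t p < t u ↔ t p < t v) := by
      intro u v huv hc
      have hsub : (N'.filter fun p => t p < t u) ⊆ (N'.filter fun p => t p < t v) := by
        intro q hq
        rw [Finset.mem_filter] at hq ⊢
        exact ⟨hq.1, hq.2.trans_le huv⟩
      have heq := Finset.eq_of_subset_of_card_le hsub hc.ge
      have := Finset.ext_iff.1 heq p
      simpa [hpN'] using this
    rcases le_total (t x) (t y) with h | h
    · exact aux x y h (hx5.trans hy5.symm)
    · exact (aux y x h (hy5.trans hx5.symm)).symm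
  refine lb_avoid d k (f - t p • g) B x y p (fun i => by simp [hfB, hgB]) ?_ ?_ hmem
  · have ex : (f - t p • g) (x, 1) = (t x - t p) * g (x, 1) := by
      simp only [LinearMap.sub_apply, LinearMap.smul_apply, smul_eq_mul, t]; field_simp
    have ey : (f - t p • g) (y, 1) = (t y - t p) * g (y, 1) := by
      simp only [LinearMap.sub_apply, LinearMap.smul_apply, smul_eq_mul, t]; field_simp
    rw [ex, ey]
    have : 0 < (t x - t p) * (t y - t p) := by
      rcases lt_or_gt_of_ne (hx3 p hpN') with h | h
      · have h2 : t y < t p := lt_of_le_of_ne (not_lt.1 fun h' => (lt_asymm h (hiff.2 h'))) (hy3 p hpN')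
        exact mul_pos_of_neg_of_neg (by linarith) (by linarith)
      · exact mul_pos (sub_pos.2 h) (sub_pos.2 (hiff.1 h))
    calc 0 < ((t x - t p) * (t y - t p)) * (g (x, 1) * g (y, 1)) := mul_pos this hgg
      _ = _ := by ring
  · simp only [LinearMap.sub_apply, LinearMap.smul_apply, smul_eq_mul, t]; field_simp; simp

lemma lb_index (d n : ℕ) (hd : 1 ≤ d) (N : Finset (Fin d → ℝ)) (hN : N.Nonempty)
    (hn : N.card ≤ n) :
    ENNReal.ofReal (1 / (2 * (n : ℝ))) ≤
      volume {A : Fin (d + 1) → (Fin d → ℝ) |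
            (∀ i, A i ∈ lbCube d \ (N : Set (Fin d → ℝ))) ∧
              convexHull ℝ (Set.range A) ⊆ lbCube d \ (N : Set (Fin d → ℝ))} := by
  obtain ⟨k, hk⟩ : ∃ k, k + 1 = d := ⟨d - 1, by omega⟩
  have hgen : ∀ (m : ℕ), m = k + 2 → ENNReal.ofReal (1 / (2 * (n : ℝ))) ≤
      volume {A : Fin m → (Fin d → ℝ) |
            (∀ i, A i ∈ lbCube d \ (N : Set (Fin d → ℝ))) ∧
              convexHull ℝ (Set.range A) ⊆ lbCube d \ (N : Set (Fin d → ℝ))} := by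
    rintro _ rfl
    set T := {A : Fin (k+2) → (Fin d → ℝ) |
            (∀ i, A i ∈ lbCube d \ (N : Set (Fin d → ℝ))) ∧
              convexHull ℝ (Set.range A) ⊆ lbCube d \ (N : Set (Fin d → ℝ))} with hT
    let E := Fin d → ℝ
    -- measure preserving maps
    have m1 := (volume_preserving_piFinSuccAbove (fun _ : Fin (k+2) => E) 0).symm
    have m2 := (volume_preserving_piFinSuccAbove (fun _ : Fin (k+1) => E) 0).symm
    have m3 : MeasurePreserving (Prod.map (id : E → E) (MeasurableEquiv.piFinSuccAbove (fun _ : Fin (k+1) => E) 0).symm)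
        (volume : Measure (E × (E × (Fin k → E)))) volume :=
      (MeasurePreserving.id (volume : Measure E)).prod m2
    have m4 : MeasurePreserving (MeasurableEquiv.prodAssoc : (E × E) × (Fin k → E) ≃ᵐ E × E × (Fin k → E)) volume volume :=
      volume_preserving_prodAssoc
    have m5 : MeasurePreserving (Prod.swap : (Fin k → E) × (E × E) → (E × E) × (Fin k → E)) volume volume :=
      Measure.measurePreserving_swap
    have m := m1.comp (m3.comp (m4.comp m5))
    rw [← measure_toMeasurable T, ← m.measure_preimage (measurableSet_toMeasurable _ _).nullMeasurableSet]
    refine le_trans ?_ (measure_mono (Set.preimage_mono (subset_toMeasurable volume T)))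
    rw [Measure.volume_eq_prod]
    refine le_trans ?_ (lb_lintegral_section_le _ _ _)
    have hQ : (volume : Measure (Fin k → E)) (Set.pi Set.univ fun _ => lbCube d) = 1 := by
      rw [volume_pi_pi]
      exact Finset.prod_eq_one fun _ _ => lbCube_vol d
    have hQm : MeasurableSet (Set.pi Set.univ fun _ : Fin k => lbCube d) :=
      MeasurableSet.univ_pi fun _ => lbCube_meas d
    refine le_trans ?_ (setLIntegral_le_lintegral (Set.pi Set.univ fun _ : Fin k => lbCube d) _)
    calc ENNReal.ofReal (1 / (2 * (n : ℝ))) = ∫⁻ B in (Set.pi Set.univ fun _ : Fin k => lbCube d), ENNReal.ofReal (1 / (2 * (n : ℝ))) := by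
          rw [setLIntegral_const, hQ, mul_one]
      _ ≤ _ := by
          apply lintegral_mono_ae
          rw [ae_restrict_iff' hQm]
          have hli : ∀ᵐ B : Fin k → E, ∀ p ∈ N, LinearIndependent ℝ (fun i => B i - p) := by
            rw [Filter.eventually_all_finset]
            exact fun p _ => lb_ae_linInd d k (by omega) p
          filter_upwards [hli] with B hB hBQ
          have hBN : ∀ p ∈ N, p ∉ convexHull ℝ (Set.range B) := by
            intro p hp hmem
            have hli := hB p hp
            let b := Module.Basis.span hli
            obtain ⟨l, hl⟩ := LinearMap.exists_extend (b.constr ℝ (fun _ => (1:ℝ)))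
            have hl1 : ∀ i, l (B i - p) = 1 := by
              intro i
              have h1 := LinearMap.congr_fun hl (b i)
              rw [b.constr_basis] at h1
              rw [← h1]
              simp [b, Module.Basis.span_apply]
            have hsub : convexHull ℝ (Set.range B) ⊆ {z | l z = l p + 1} := by
              apply convexHull_min
              · rintro _ ⟨i, rfl⟩
                have := hl1 i
                rw [map_sub] at this
                simp only [Set.mem_ofPred_eq]; linarith
              · exact convex_hyperplane l.isLinear _
            have := hsub hmem
            simp at this
          refine (lb_section d k n hk N hN hn B hBN).trans (measure_mono ?_)
          rintro ⟨x, y⟩ ⟨hx, hy, hxy⟩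
          have hA : (Fin.cons x (Fin.cons y B) : Fin (k+2) → E) ∈ T := by
            have hcube : ∀ i, (Fin.cons x (Fin.cons y B) : Fin (k+2) → E) i ∈ lbCube d := by
              intro i
              refine Fin.cases hx (fun i => Fin.cases hy (fun i => ?_) i) i
              exact hBQ i trivial
            have hhull : convexHull ℝ (Set.range (Fin.cons x (Fin.cons y B) : Fin (k+2) → E)) ⊆ lbCube d \ (N : Set E) := by
              intro z hz
              refine ⟨convexHull_min ?_ (lbCube_convex d) hz, fun hzN => hxy z hzN hz⟩
              rintro _ ⟨i, rfl⟩; exact hcube i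
            exact ⟨fun i => hhull (subset_convexHull ℝ _ ⟨i, rfl⟩), hhull⟩
          simp only [Set.mem_preimage, Function.comp_apply, Prod.swap_prod_mk]
          convert hA using 1
          simp [MeasurableEquiv.prodAssoc, MeasurableEquiv.piFinSuccAbove]
          rfl
  exact hgen (d+1) (by omega)

/-- Greedy hitting set. -/
lemma lb_greedy {α ι : Type*} [MeasurableSpace α] (μ : Measure α) [IsProbabilityMeasure μ]
    (F : Finset ι) (C : ι → Set α) (hC : ∀ i ∈ F, MeasurableSet (C i)) (δ : ℝ)
    (hδ1 : δ ≤ 1) (hδ : ∀ i ∈ F, δ ≤ μ.real (C i)) (n : ℕ)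
    (hn : (F.card : ℝ) * (1 - δ) ^ n < 1) :
    ∃ N : Finset α, N.card ≤ n ∧ ∀ i ∈ F, ∃ p ∈ N, p ∈ C i := by
  classical
  have key : ∀ n : ℕ, ∃ N : Finset α, N.card ≤ n ∧
      ((F.filter fun i => ∀ p ∈ N, p ∉ C i).card : ℝ) ≤ F.card * (1 - δ) ^ n := by
    intro n
    induction n with
    | zero => exact ⟨∅, by simp, by simp⟩
    | succ n ih =>
      obtain ⟨N, hN, hle⟩ := ih
      set R := F.filter fun i => ∀ p ∈ N, p ∉ C i with hR
      have hRF : ∀ i ∈ R, i ∈ F := fun i hi => (Finset.mem_filter.1 hi).1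
      have hintg : ∀ i ∈ R, Integrable ((C i).indicator (fun _ => (1:ℝ))) μ := fun i hi =>
        (integrable_const _).indicator (hC i (hRF i hi))
      obtain ⟨x, hx⟩ := exists_integral_le (integrable_finsetSum R hintg)
      rw [integral_finsetSum R hintg] at hx
      have h1 : δ * R.card ≤ ∑ i ∈ R, ∫ a, (C i).indicator (fun _ => (1:ℝ)) a ∂μ := by
        rw [mul_comm, ← nsmul_eq_mul]
        apply Finset.card_nsmul_le_sum
        intro i hi
        rw [integral_indicator (hC i (hRF i hi))]
        simpa using hδ i (hRF i hi)
      have h2 : ∑ i ∈ R, (C i).indicator (fun _ => (1:ℝ)) x = ((R.filter fun i => x ∈ C i).card : ℝ) := by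
        rw [Finset.card_filter]; push_cast
        exact Finset.sum_congr rfl fun i _ => by simp [Set.indicator_apply]
      have h3 : ((R.filter fun i => x ∈ C i).card : ℝ) + ((R.filter fun i => x ∉ C i).card : ℝ) = R.card := by
        exact_mod_cast Finset.card_filter_add_card_filter_not (s := R) (fun i => x ∈ C i)
      refine ⟨insert x N, (Finset.card_insert_le _ _).trans (by omega), ?_⟩
      have h4 : (F.filter fun i => ∀ p ∈ insert x N, p ∉ C i) = R.filter fun i => x ∉ C i := by
        ext i; simp only [hR, Finset.mem_filter, Finset.forall_mem_insert]; tauto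
      rw [h4]
      have h5 : (∑ i ∈ R, (C i).indicator (fun _ => (1:ℝ)) x) ≥ δ * R.card := by
        refine h1.trans (hx.trans ?_)
        simp
      rw [h2] at h5
      calc ((R.filter fun i => x ∉ C i).card : ℝ) ≤ (1 - δ) * R.card := by linarith
        _ ≤ (1 - δ) * (F.card * (1 - δ) ^ n) := mul_le_mul_of_nonneg_left hle (by linarith)
        _ = _ := by ring
  obtain ⟨N, hN, hle⟩ := key n
  refine ⟨N, hN, ?_⟩
  have h0 : (F.filter fun i => ∀ p ∈ N, p ∉ C i).card = 0 := by
    have : ((F.filter fun i => ∀ p ∈ N, p ∉ C i).card : ℝ) < 1 := hle.trans_lt hn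
    have : (F.filter fun i => ∀ p ∈ N, p ∉ C i).card < 1 := by exact_mod_cast this
    omega
  intro i hi
  by_contra! hcon
  have : i ∈ F.filter fun i => ∀ p ∈ N, p ∉ C i := Finset.mem_filter.2 ⟨hi, hcon⟩
  rw [Finset.card_eq_zero.1 h0] at this
  simp at this

/-- edge matrix of a simplex -/
def lbM {d : ℕ} (v : Fin (d+1) → (Fin d → ℝ)) : Matrix (Fin d) (Fin d) ℝ :=
  Matrix.of fun r c => v c.succ r - v 0 r

def lbDelta (d : ℕ) : Set (Fin d → ℝ) := {y | (∀ i, 0 ≤ y i) ∧ ∑ i, y i ≤ 1}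

lemma lb_mulVec_eq {d : ℕ} (v : Fin (d+1) → (Fin d → ℝ)) (y : Fin d → ℝ) :
    v 0 + lbM v *ᵥ y = (1 - ∑ i, y i) • v 0 + ∑ i, y i • v i.succ := by
  funext r
  simp only [Pi.add_apply, Matrix.mulVec, dotProduct, lbM, Matrix.of_apply, Pi.smul_apply,
    smul_eq_mul, Finset.sum_apply, sub_mul, Finset.sum_sub_distrib, one_mul, ← Finset.mul_sum]
  rw [Finset.sum_congr rfl fun i _ => mul_comm (v i.succ r) (y i)]
  ring

lemma lb_mem_hull {d : ℕ} (v : Fin (d+1) → (Fin d → ℝ)) (y : Fin d → ℝ) (hy : y ∈ lbDelta d) :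
    v 0 + lbM v *ᵥ y ∈ convexHull ℝ (Set.range v) := by
  rw [lb_mulVec_eq]
  have := (convex_convexHull ℝ (Set.range v)).sum_mem (t := Finset.univ)
    (w := Fin.cons (1 - ∑ i, y i) y) (z := v) ?_ ?_ ?_
  · simpa [Fin.sum_univ_succ] using this
  · intro i _
    refine Fin.cases ?_ (fun i => ?_) i
    · simpa using hy.2
    · simpa using hy.1 i
  · simp [Fin.sum_univ_succ]
  · intro i _; exact subset_convexHull ℝ _ ⟨i, rfl⟩

lemma lb_vol_image {d : ℕ} (a : Fin d → ℝ) (A : Matrix (Fin d) (Fin d) ℝ) (Q : Set (Fin d → ℝ)) :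
    volume ((fun y => a + A *ᵥ y) '' Q) = ENNReal.ofReal |A.det| * volume Q := by
  have : (fun y => a + A *ᵥ y) '' Q = (fun x => a + x) '' (Matrix.toLin' A '' Q) := by
    rw [Set.image_image]; simp
  rw [this, Set.image_add_left, measure_preimage_add, Measure.addHaar_image_linearMap,
    LinearMap.det_toLin']

lemma lb_volQ (d : ℕ) (hd : 1 ≤ d) :
    volume {y : Fin d → ℝ | (∀ i, y i ≤ 1) ∧ 0 ≤ ∑ i, y i} ≤
      ENNReal.ofReal ((d:ℝ)^d) * volume (lbDelta d) := by
  have hd0 : (0:ℝ) < d := by exact_mod_cast hd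
  have h := lb_vol_image (d := d) (fun _ => 1) (Matrix.diagonal fun _ => -(d:ℝ)) (lbDelta d)
  rw [Matrix.det_diagonal] at h
  simp only [Finset.prod_const, Finset.card_univ, Fintype.card_fin, abs_pow, abs_neg,
    Nat.abs_cast] at h
  rw [← h]
  apply measure_mono
  rintro y ⟨h1, h2⟩
  refine ⟨fun i => (1 - y i) / d, ⟨fun i => div_nonneg (by linarith [h1 i]) hd0.le, ?_⟩, ?_⟩
  · rw [← Finset.sum_div, Finset.sum_sub_distrib, div_le_one hd0]
    simp; exact h2
  · funext i
    simp
    field_simp; ring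

lemma lb_detM_zero {d : ℕ} (v : Fin (d+1) → (Fin d → ℝ)) (y : Fin d → ℝ) :
    (lbM (Function.update v 0 (v 0 + lbM v *ᵥ y))).det = (lbM v).det * (1 - ∑ i, y i) := by
  have h1 : lbM (Function.update v 0 (v 0 + lbM v *ᵥ y)) =
      lbM v * (1 + Matrix.replicateCol Unit (-y) * Matrix.replicateRow Unit (fun _ : Fin d => (1:ℝ))) := by
    rw [mul_add, mul_one, ← Matrix.mul_assoc]
    ext r c
    simp [lbM, Matrix.mul_apply, Matrix.mulVec, dotProduct]
    ring
  rw [h1, Matrix.det_mul, Matrix.det_one_add_replicateCol_mul_replicateRow]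
  simp [dotProduct, sub_eq_add_neg]

lemma lb_detM_succ {d : ℕ} (v : Fin (d+1) → (Fin d → ℝ)) (y : Fin d → ℝ) (j : Fin d) :
    (lbM (Function.update v j.succ (v 0 + lbM v *ᵥ y))).det = (lbM v).det * y j := by
  have h1 : lbM (Function.update v j.succ (v 0 + lbM v *ᵥ y)) =
      (lbM v).updateCol j (lbM v *ᵥ y) := by
    ext r c
    by_cases hc : c = j
    · subst hc; simp [lbM, Function.update_of_ne (Fin.succ_ne_zero c).symm]
    · simp [lbM, hc, Function.update_of_ne (Fin.succ_ne_zero j).symm]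
  rw [h1, ← Matrix.cramer_apply, Matrix.cramer_eq_adjugate_mulVec, Matrix.mulVec_mulVec,
    Matrix.adjugate_mul]
  simp [Matrix.smul_mulVec]

lemma lb_max_simplex (d : ℕ) (hd : 1 ≤ d) (C : Set (Fin d → ℝ)) (hC : IsCompact C)
    (w : Fin (d+1) → (Fin d → ℝ)) (hw : ∀ i, w i ∈ C) (hdet : (lbM w).det ≠ 0) :
    ∃ v : Fin (d+1) → (Fin d → ℝ), (∀ i, v i ∈ C) ∧ (lbM v).det ≠ 0 ∧
      volume C ≤ ENNReal.ofReal (|(lbM v).det| * (d:ℝ)^d) * volume (lbDelta d) := by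
  have hcomp : IsCompact (Set.pi Set.univ fun _ : Fin (d+1) => C) := isCompact_univ_pi fun _ => hC
  have hcont : Continuous fun v : Fin (d+1) → (Fin d → ℝ) => |(lbM v).det| := by
    apply Continuous.abs
    apply Continuous.matrix_det
    unfold lbM
    fun_prop
  obtain ⟨v, hv, hmax⟩ := hcomp.exists_isMaxOn ⟨w, fun i _ => hw i⟩ hcont.continuousOn
  have hv' : ∀ i, v i ∈ C := fun i => hv i trivial
  have hmax' : ∀ u : Fin (d+1) → (Fin d → ℝ), (∀ i, u i ∈ C) → |(lbM u).det| ≤ |(lbM v).det| :=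
    fun u hu => hmax (fun i _ => hu i)
  have hpos : 0 < |(lbM v).det| := (abs_pos.2 hdet).trans_le (hmax' w hw)
  have hne : (lbM v).det ≠ 0 := abs_pos.1 hpos
  refine ⟨v, hv', hne, ?_⟩
  have hupd : ∀ x ∈ C, ∀ j, ∀ i, Function.update v j x i ∈ C := by
    intro x hx j i
    by_cases h : i = j
    · subst h; simpa using hx
    · simpa [h] using hv' i
  have hsub : C ⊆ (fun y => v 0 + lbM v *ᵥ y) '' {y : Fin d → ℝ | (∀ i, y i ≤ 1) ∧ 0 ≤ ∑ i, y i} := by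
    intro x hx
    have hunit : IsUnit (lbM v).det := isUnit_iff_ne_zero.2 hne
    have hy : v 0 + lbM v *ᵥ ((lbM v)⁻¹ *ᵥ (x - v 0)) = x := by
      rw [Matrix.mulVec_mulVec, Matrix.mul_nonsing_inv _ hunit]; simp
    set y := (lbM v)⁻¹ *ᵥ (x - v 0)
    refine ⟨y, ⟨fun j => ?_, ?_⟩, hy⟩
    · have h1 := hmax' _ (hupd x hx j.succ)
      rw [← hy, lb_detM_succ, abs_mul] at h1
      have : |y j| ≤ 1 := by
        by_contra! h; nlinarith
      exact (le_abs_self _).trans this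
    · have h1 := hmax' _ (hupd x hx 0)
      rw [← hy, lb_detM_zero, abs_mul] at h1
      have : |1 - ∑ i, y i| ≤ 1 := by
        by_contra! h; nlinarith
      linarith [le_abs_self (1 - ∑ i, y i)]
  refine (measure_mono hsub).trans ?_
  rw [lb_vol_image, ENNReal.ofReal_mul (abs_nonneg _), mul_assoc]
  gcongr
  exact lb_volQ d hd

lemma lb_det_cont (d : ℕ) : ∃ η : ℝ, 0 < η ∧ ∀ Z : Matrix (Fin d) (Fin d) ℝ,
    (∀ i j, |Z i j - (1 : Matrix (Fin d) (Fin d) ℝ) i j| ≤ η) → 1 / 2 ≤ Z.det := by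
  have hcont : Continuous fun Z : Fin d → Fin d → ℝ => (Matrix.of Z).det :=
    Continuous.matrix_det (by fun_prop)
  have h := Metric.continuousAt_iff.1 (hcont.continuousAt (x := fun i j => (1 : Matrix (Fin d) (Fin d) ℝ) i j)) (1/2) (by norm_num)
  obtain ⟨η, hη, h⟩ := h
  refine ⟨η / 2, by positivity, fun Z hZ => ?_⟩
  have h1 : dist (fun i j => Z i j) (fun i j => (1 : Matrix (Fin d) (Fin d) ℝ) i j) < η := by
    refine lt_of_le_of_lt ?_ (half_lt_self hη)
    refine (dist_pi_le_iff (by positivity)).2 fun i => (dist_pi_le_iff (by positivity)).2 fun j => ?_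
    rw [Real.dist_eq]; exact hZ i j
  have h2 := h h1
  rw [Real.dist_eq] at h2
  have h3 : (Matrix.of fun i j => (1 : Matrix (Fin d) (Fin d) ℝ) i j).det = 1 := Matrix.det_one
  have h4 : (Matrix.of fun i j => Z i j).det = Z.det := rfl
  rw [h3, h4] at h2
  linarith [(abs_lt.1 h2).1]

lemma lb_cramer_bound (d : ℕ) (A : Matrix (Fin d) (Fin d) ℝ) (hA : ∀ i j, |A i j| ≤ 1)
    (hdet : A.det ≠ 0) (u : Fin d → ℝ) (h : ℝ) (hh : 0 < h) (hu : ∀ i, |u i| ≤ h) (j : Fin d) :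
    |(A⁻¹ *ᵥ u) j| ≤ d.factorial * h / |A.det| := by
  have h1 : A⁻¹ *ᵥ u = (A.det⁻¹ * h) • Matrix.cramer A (h⁻¹ • u) := by
    rw [Matrix.inv_def, Ring.inverse_eq_inv', Matrix.smul_mulVec, ← Matrix.cramer_eq_adjugate_mulVec,
      map_smul, smul_smul, mul_assoc, mul_inv_cancel₀ hh.ne', mul_one]
  have h2 : |(A.updateCol j (h⁻¹ • u)).det| ≤ d.factorial := by
    have := Matrix.det_le (A := A.updateCol j (h⁻¹ • u)) (abv := AbsoluteValue.abs) (x := (1:ℝ)) ?_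
    · simpa using this
    · intro r c
      by_cases hc : c = j
      · subst hc
        simp only [Matrix.updateCol_self, AbsoluteValue.abs_apply, Pi.smul_apply, smul_eq_mul, abs_mul, abs_inv, abs_of_pos hh]
        rw [inv_mul_le_iff₀ hh, mul_one]; exact hu r
      · simpa [Matrix.updateCol_ne hc] using hA r c
  rw [h1, Pi.smul_apply, Matrix.cramer_apply, smul_eq_mul, abs_mul, abs_mul, abs_inv, abs_of_pos hh]
  rw [div_eq_inv_mul, mul_assoc, mul_comm (d.factorial : ℝ)]
  gcongr

lemma lb_snap (d : ℕ) (hd : 1 ≤ d) : ∃ ρ : ℝ, 0 < ρ ∧ ∀ (v : Fin (d+1) → (Fin d → ℝ)) (M : ℕ),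
    (∀ i r, 0 ≤ v i r ∧ v i r ≤ 1) → (lbM v).det ≠ 0 → 0 < M →
    (d.factorial : ℝ) / (ρ * |(lbM v).det|) ≤ M →
    ∃ q : Fin (d+1) → Fin d → Fin (M+1),
      (∀ i, (fun r => ((q i r : ℕ) : ℝ) / M) ∈ convexHull ℝ (Set.range v)) ∧
      |(lbM v).det| / 2 ≤ |(lbM fun i r => ((q i r : ℕ) : ℝ) / M).det| := by
  obtain ⟨η, hη, hdetc⟩ := lb_det_cont d
  have hd0 : (1:ℝ) ≤ d := by exact_mod_cast hd
  obtain ⟨ρ, hρ, hρ1, hρ2⟩ : ∃ ρ : ℝ, 0 < ρ ∧ 2 * d * ρ ≤ 1 ∧ (2 * d + 2) * ρ ≤ η := by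
    refine ⟨min (1 / (2 * (d:ℝ))) (η / (2 * d + 2)), by positivity, ?_, ?_⟩
    · calc 2 * (d:ℝ) * min (1 / (2 * (d:ℝ))) (η / (2 * d + 2)) ≤ 2 * d * (1 / (2 * d)) := by
            gcongr; exact min_le_left _ _
        _ = 1 := by field_simp
    · calc (2 * (d:ℝ) + 2) * min (1 / (2 * (d:ℝ))) (η / (2 * d + 2)) ≤ (2 * d + 2) * (η / (2 * d + 2)) := by
            gcongr; exact min_le_right _ _
        _ = η := by field_simp
  refine ⟨ρ, hρ, fun v M hv hne hM hMle => ?_⟩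
  set A := lbM v with hAdef
  have hpos : 0 < |A.det| := abs_pos.2 hne
  have hM0 : (0:ℝ) < M := by exact_mod_cast hM
  have hA : ∀ i j, |A i j| ≤ 1 := by
    intro i j
    simp only [hAdef, lbM, Matrix.of_apply]
    rw [abs_le]
    constructor <;> linarith [(hv j.succ i).1, (hv j.succ i).2, (hv 0 i).1, (hv 0 i).2]
  -- ideal barycentric coordinates
  let y : Fin (d+1) → Fin d → ℝ := Fin.cons (fun _ => ρ) (fun c r => ρ + (1 - 2 * d * ρ) * (1 : Matrix (Fin d) (Fin d) ℝ) r c)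
  have hy : ∀ i, (∀ r, ρ ≤ y i r) ∧ ∑ r, y i r ≤ 1 - d * ρ := by
    intro i
    refine Fin.cases ?_ (fun c => ?_) i
    · simp only [y, Fin.cons_zero]
      refine ⟨fun _ => le_rfl, ?_⟩
      simp; linarith
    · simp only [y, Fin.cons_succ]
      refine ⟨fun r => ?_, ?_⟩
      · have : 0 ≤ (1 : Matrix (Fin d) (Fin d) ℝ) r c := by
          rw [Matrix.one_apply]; split_ifs <;> norm_num
        nlinarith
      · rw [Finset.sum_add_distrib, ← Finset.mul_sum]
        simp [Matrix.one_apply]; linarith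
  have hyD : ∀ i, y i ∈ lbDelta d := fun i =>
    ⟨fun r => hρ.le.trans ((hy i).1 r), (hy i).2.trans (by nlinarith)⟩
  let w : Fin (d+1) → Fin d → ℝ := fun i => v 0 + A *ᵥ y i
  have hw : ∀ i r, 0 ≤ w i r ∧ w i r ≤ 1 := by
    intro i
    have h1 : w i ∈ convexHull ℝ (Set.range v) := lb_mem_hull v _ (hyD i)
    have h2 : convexHull ℝ (Set.range v) ⊆ Set.Icc (0 : Fin d → ℝ) 1 := by
      apply convexHull_min _ (convex_Icc _ _)
      rintro _ ⟨i, rfl⟩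
      exact ⟨fun r => (hv i r).1, fun r => (hv i r).2⟩
    exact fun r => ⟨(h2 h1).1 r, (h2 h1).2 r⟩
  have hfl : ∀ i r, ⌊(M:ℝ) * w i r⌋₊ < M + 1 := by
    intro i r
    have : ⌊(M:ℝ) * w i r⌋₊ ≤ M := by
      apply Nat.floor_le_of_le
      nlinarith [(hw i r).2]
    omega
  let q : Fin (d+1) → Fin d → Fin (M+1) := fun i r => ⟨⌊(M:ℝ) * w i r⌋₊, hfl i r⟩
  let g : Fin (d+1) → Fin d → ℝ := fun i r => ((q i r : ℕ) : ℝ) / M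
  have hg : ∀ i r, |(g i - w i) r| ≤ 1 / M := by
    intro i r
    simp only [g, q, Pi.sub_apply]
    have h1 := Nat.floor_le (mul_nonneg hM0.le (hw i r).1)
    have h2 := Nat.lt_floor_add_one ((M:ℝ) * w i r)
    have h3 : (⌊(M:ℝ) * w i r⌋₊ : ℝ) / M - w i r = (⌊(M:ℝ) * w i r⌋₊ - M * w i r) / M := by
      field_simp
    rw [h3, abs_div, abs_of_pos hM0]
    gcongr
    rw [abs_le]; constructor <;> linarith
  let z : Fin (d+1) → Fin d → ℝ := fun i => y i + A⁻¹ *ᵥ (g i - w i)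
  have hunit : IsUnit A.det := isUnit_iff_ne_zero.2 hne
  have hgz : ∀ i, g i = v 0 + A *ᵥ z i := by
    intro i
    simp only [z, Matrix.mulVec_add, Matrix.mulVec_mulVec, Matrix.mul_nonsing_inv _ hunit, Matrix.one_mulVec]
    simp only [w]; abel
  have hzy : ∀ i r, |z i r - y i r| ≤ ρ := by
    intro i r
    have h1 := lb_cramer_bound d A hA hne (g i - w i) (1/M) (by positivity) (hg i) r
    have h2 : z i r - y i r = (A⁻¹ *ᵥ (g i - w i)) r := by simp [z]
    rw [h2]
    refine h1.trans ?_
    rw [div_le_iff₀ (by positivity)] at hMle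
    rw [div_le_iff₀ hpos, mul_one_div, div_le_iff₀ hM0]
    linarith
  have hzD : ∀ i, z i ∈ lbDelta d := by
    intro i
    refine ⟨fun r => ?_, ?_⟩
    · linarith [(abs_le.1 (hzy i r)).1, (hy i).1 r]
    · have : ∑ r, z i r ≤ ∑ r, (y i r + ρ) :=
        Finset.sum_le_sum fun r _ => by linarith [(abs_le.1 (hzy i r)).2]
      rw [Finset.sum_add_distrib] at this
      simp at this
      linarith [(hy i).2]
  refine ⟨q, fun i => ?_, ?_⟩
  · have := lb_mem_hull v _ (hzD i)
    rw [← hAdef, ← hgz] at this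
    exact this
  · let Z : Matrix (Fin d) (Fin d) ℝ := Matrix.of fun r c => z c.succ r - z 0 r
    have hMg : lbM g = A * Z := by
      ext r c
      have e : lbM g r c = g c.succ r - g 0 r := rfl
      rw [e, hgz, hgz]
      simp [Matrix.mul_apply, Matrix.mulVec, dotProduct, Z, mul_sub]
    have hZ : 1 / 2 ≤ Z.det := by
      apply hdetc
      intro r c
      have h1 := abs_le.1 (hzy c.succ r)
      have h2 := abs_le.1 (hzy 0 r)
      have e1 : y c.succ r = ρ + (1 - 2 * d * ρ) * (1 : Matrix (Fin d) (Fin d) ℝ) r c := by simp [y]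
      have e2 : y 0 r = ρ := by simp [y]
      have e3 : Z r c = z c.succ r - z 0 r := rfl
      have h3 : 0 ≤ (1 : Matrix (Fin d) (Fin d) ℝ) r c ∧ (1 : Matrix (Fin d) (Fin d) ℝ) r c ≤ 1 := by
        rw [Matrix.one_apply]; split_ifs <;> norm_num
      rw [e1] at h1
      rw [e2] at h2
      rw [e3, abs_le]
      generalize (1 : Matrix (Fin d) (Fin d) ℝ) r c = o at *
      have h4 : 0 ≤ 2 * d * ρ * o := mul_nonneg (by positivity) h3.1
      have h5 : 2 * d * ρ * o ≤ 2 * d * ρ := mul_le_of_le_one_right (by positivity) h3.2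
      constructor <;> linarith [h1.1, h1.2, h2.1, h2.2]
    change _ ≤ |(lbM g).det|
    rw [hMg, Matrix.det_mul, abs_mul, abs_of_nonneg (show 0 ≤ Z.det by linarith)]
    nlinarith

lemma lb_delta_le (d : ℕ) : volume (lbDelta d) ≤ 1 := by
  have : lbDelta d ⊆ Set.pi Set.univ fun _ => Set.Icc (0:ℝ) 1 := by
    intro y hy i _
    refine ⟨hy.1 i, le_trans ?_ hy.2⟩
    exact Finset.single_le_sum (f := y) (fun i _ => hy.1 i) (Finset.mem_univ i)
  refine (measure_mono this).trans ?_
  rw [volume_pi_pi]; simp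

lemma lb_net (d : ℕ) (hd : 1 ≤ d) : ∃ c : ℝ, 1 < c ∧ ∀ ε : ℝ, 0 < ε → ε ≤ 1 → ∀ n : ℕ,
    (c / ε) ^ (d * (d+1)) * (1 - ε / (2 * (d:ℝ)^d)) ^ n < 1 →
    ∃ N : Finset (Fin d → ℝ), N.card ≤ n ∧
      ∀ K ⊆ lbCube d \ (N : Set (Fin d → ℝ)), Convex ℝ K → volume K ≤ ENNReal.ofReal ε := by
  classical
  obtain ⟨ρ, hρ, hsnap⟩ := lb_snap d hd
  have hd0 : (1:ℝ) ≤ d := by exact_mod_cast hd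
  have hdd : (1:ℝ) ≤ (d:ℝ)^d := one_le_pow₀ hd0
  have hc0 : (0:ℝ) < d.factorial * (d:ℝ)^d / ρ := by positivity
  refine ⟨d.factorial * (d:ℝ)^d / ρ + 2, by linarith, fun ε hε hε1 n hn => ?_⟩
  set M := ⌈(d.factorial : ℝ) * (d:ℝ)^d / (ρ * ε)⌉₊ with hMdef
  have hM : 0 < M := Nat.ceil_pos.2 (by positivity)
  have hMge : (d.factorial : ℝ) * (d:ℝ)^d / (ρ * ε) ≤ M := Nat.le_ceil _
  have hMle : (M:ℝ) + 1 ≤ (d.factorial * (d:ℝ)^d / ρ + 2) / ε := by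
    have h1 : (M:ℝ) < (d.factorial : ℝ) * (d:ℝ)^d / (ρ * ε) + 1 := Nat.ceil_lt_add_one (by positivity)
    have h2 : (d.factorial : ℝ) * (d:ℝ)^d / (ρ * ε) = (d.factorial * (d:ℝ)^d / ρ) / ε := by
      field_simp
    rw [add_div]
    have h3 : 2 ≤ 2 / ε := by rw [le_div_iff₀ hε]; linarith
    linarith
  set δ := ε / (2 * (d:ℝ)^d) with hδ
  have hδ1 : δ ≤ 1 := by
    rw [hδ, div_le_one (by positivity)]; linarith
  have hδ0 : 0 < δ := by positivity
  let G : (Fin (d+1) → Fin d → Fin (M+1)) → Fin (d+1) → Fin d → ℝ := fun q i r => ((q i r : ℕ) : ℝ) / M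
  let C : (Fin (d+1) → Fin d → Fin (M+1)) → Set (Fin d → ℝ) := fun q => convexHull ℝ (Set.range (G q))
  have hCm : ∀ q, MeasurableSet (C q) := fun q =>
    ((Set.finite_range (G q)).isCompact_convexHull ℝ).measurableSet
  let μ : Measure (Fin d → ℝ) := volume.restrict (lbCube d)
  have hμp : IsProbabilityMeasure μ := lbCube_prob d
  let F := (Finset.univ : Finset (Fin (d+1) → Fin d → Fin (M+1))).filter fun q => δ ≤ μ.real (C q)
  have hF : (F.card : ℝ) ≤ ((d.factorial * (d:ℝ)^d / ρ + 2) / ε) ^ (d * (d+1)) := by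
    have h1 : F.card ≤ (M+1) ^ (d * (d+1)) := by
      refine (Finset.card_filter_le _ _).trans ?_
      simp [pow_mul]
    calc (F.card : ℝ) ≤ ((M:ℝ)+1) ^ (d * (d+1)) := by exact_mod_cast h1
      _ ≤ _ := by gcongr
  obtain ⟨N, hNc, hN⟩ := lb_greedy μ F C (fun q _ => hCm q) δ hδ1
    (fun q hq => (Finset.mem_filter.1 hq).2) n
    (lt_of_le_of_lt (mul_le_mul_of_nonneg_right hF (pow_nonneg (by linarith) _)) hn)
  refine ⟨N, hNc, fun K hKs hK => ?_⟩
  by_contra! hvol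
  have hintg : volume (interior K) = volume K := by
    apply le_antisymm (measure_mono interior_subset)
    calc volume K ≤ volume (interior K ∪ frontier K) := by
          apply measure_mono
          rw [← closure_eq_interior_union_frontier]
          exact subset_closure
      _ ≤ volume (interior K) + volume (frontier K) := measure_union_le _ _
      _ = volume (interior K) := by rw [hK.addHaar_frontier volume, add_zero]
  rw [← hintg] at hvol
  obtain ⟨C0, hC0s, hC0, hC0v⟩ := isOpen_interior.exists_lt_isCompact hvol
  have hne : (interior K).Nonempty := by
    rw [Set.nonempty_iff_ne_empty]
    intro h; rw [h] at hvol; simp at hvol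
  obtain ⟨x, hx⟩ := hne
  obtain ⟨r, hr, hball⟩ := Metric.nhds_basis_closedBall.mem_iff.1 (mem_interior_iff_mem_nhds.1 hx)
  let w : Fin (d+1) → Fin d → ℝ := Fin.cons x (fun i => x + r • Pi.single i 1)
  have hw : ∀ i, w i ∈ C0 ∪ Metric.closedBall x r := by
    intro i
    right
    refine Fin.cases ?_ (fun i => ?_) i
    · simp [w, hr.le]
    · simp only [w, Fin.cons_succ, Metric.mem_closedBall, dist_self_add_left, norm_smul]
      rw [Real.norm_of_nonneg hr.le]
      have : ‖(Pi.single i 1 : Fin d → ℝ)‖ ≤ 1 := by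
        rw [pi_norm_le_iff_of_nonneg zero_le_one]
        intro j
        rw [Pi.single_apply]
        split_ifs <;> simp
      nlinarith
  have hwdet : (lbM w).det ≠ 0 := by
    have : lbM w = r • (1 : Matrix (Fin d) (Fin d) ℝ) := by
      ext a b
      simp [lbM, w, Matrix.one_apply, Pi.single_apply]
    rw [this, Matrix.det_smul]
    simp [hr.ne']
  obtain ⟨v, hvC, hvdet, hvvol⟩ := lb_max_simplex d hd _ (hC0.union (isCompact_closedBall x r)) w hw hwdet
  have hCK : C0 ∪ Metric.closedBall x r ⊆ K := Set.union_subset (hC0s.trans interior_subset) hball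
  have hvK : ∀ i, v i ∈ K := fun i => hCK (hvC i)
  have hvcube : ∀ i s, 0 ≤ v i s ∧ v i s ≤ 1 := by
    intro i s
    have := (hKs (hvK i)).1 s trivial
    exact ⟨this.1.le, this.2.le⟩
  set D := |(lbM v).det| with hD
  have hDpos : 0 < D := abs_pos.2 hvdet
  have hsfin : volume (lbDelta d) ≠ ⊤ := ne_top_of_le_ne_top ENNReal.one_ne_top (lb_delta_le d)
  obtain ⟨s, hs0, hs⟩ : ∃ s : ℝ, 0 ≤ s ∧ volume (lbDelta d) = ENNReal.ofReal s :=
    ⟨_, ENNReal.toReal_nonneg, (ENNReal.ofReal_toReal hsfin).symm⟩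
  have hs1 : s ≤ 1 := by
    have := lb_delta_le d
    rw [hs] at this
    simpa using this
  have hεD : ε < D * (d:ℝ)^d * s := by
    have h1 := (hC0v.trans_le (measure_mono Set.subset_union_left)).trans_le hvvol
    rw [hs, ← ENNReal.ofReal_mul (by positivity)] at h1
    exact (ENNReal.ofReal_lt_ofReal_iff_of_nonneg hε.le).1 h1
  have hεD' : ε < D * (d:ℝ)^d := hεD.trans_le (mul_le_of_le_one_right (by positivity) hs1)
  obtain ⟨q, hq1, hq2⟩ := hsnap v M hvcube hvdet hM (by
    refine le_trans ?_ hMge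
    rw [div_le_div_iff₀ (by positivity) (by positivity)]
    have : (d.factorial : ℝ) * ρ * ε ≤ d.factorial * ρ * (D * (d:ℝ)^d) := by gcongr
    linarith)
  have hCqK : C q ⊆ K := by
    apply convexHull_min _ hK
    rintro _ ⟨i, rfl⟩
    refine convexHull_min ?_ hK (hq1 i)
    rintro _ ⟨j, rfl⟩; exact hvK j
  have hvolq : ENNReal.ofReal δ ≤ volume (C q) := by
    have h1 : (fun y => G q 0 + lbM (G q) *ᵥ y) '' lbDelta d ⊆ C q := by
      rintro _ ⟨y, hy, rfl⟩; exact lb_mem_hull (G q) y hy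
    refine le_trans ?_ (measure_mono h1)
    rw [lb_vol_image, hs, ← ENNReal.ofReal_mul (abs_nonneg _)]
    apply ENNReal.ofReal_le_ofReal
    have h2 : D / 2 * s ≤ |(lbM (G q)).det| * s := by gcongr
    refine le_trans ?_ h2
    rw [hδ, div_le_iff₀ (by positivity)]
    linarith
  have hqF : q ∈ F := by
    refine Finset.mem_filter.2 ⟨Finset.mem_univ _, ?_⟩
    have h1 : μ (C q) = volume (C q) := by
      rw [Measure.restrict_apply (hCm q), Set.inter_eq_left.2]
      exact fun z hz => (hKs (hCqK hz)).1
    rw [← h1] at hvolq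
    exact (ENNReal.ofReal_le_iff_le_toReal (measure_ne_top _ _)).1 hvolq
  obtain ⟨p, hpN, hpC⟩ := hN q hqF
  exact (hKs (hCqK hpC)).2 hpN

/-- For `d ≥ 2` and every sufficiently small `ε ∈ (0,1]`, there is a set
`S ⊆ ℝᵈ` of measure `1` with convexity ratio at most `ε` and `d`-index of convexity at
least `γ·ε/log₂(1/ε)`, where `γ = 1/(8·C(d+2,d)·dᵈ)`. -/
theorem lower_bound_construction (d : ℕ) (hd : 2 ≤ d) :
    ∃ ε₀ : ℝ, 0 < ε₀ ∧ ε₀ ≤ 1 ∧ ∀ ε : ℝ, 0 < ε → ε ≤ ε₀ →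
      ∃ S : Set (Fin d → ℝ), volume S = 1 ∧
        (∀ K ⊆ S, Convex ℝ K → volume K ≤ ENNReal.ofReal ε) ∧
        ENNReal.ofReal ((1 / (8 * ((d + 2).choose d : ℝ) * (d : ℝ) ^ d)) * ε /
            Real.logb 2 (1 / ε)) ≤
          volume {A : Fin (d + 1) → (Fin d → ℝ) |
            (∀ i, A i ∈ S) ∧ convexHull ℝ (Set.range A) ⊆ S} := by
  classical
  obtain ⟨c, hc, hnet⟩ := lb_net d (by omega)
  have hd0 : (2:ℝ) ≤ d := by exact_mod_cast hd
  have hdd : (1:ℝ) ≤ (d:ℝ)^d := one_le_pow₀ (by linarith)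
  have hlc : 0 < Real.log c := Real.log_pos hc
  set X : ℝ := (d:ℝ) * (d + 1) * Real.log c + 2 with hX
  have hX2 : 2 ≤ X := by rw [hX]; have : 0 ≤ (d:ℝ) * (d + 1) * Real.log c := by positivity
                         linarith
  refine ⟨Real.exp (-X), Real.exp_pos _, by rw [Real.exp_le_one_iff]; linarith, fun ε hε hεle => ?_⟩
  set L := Real.log (1 / ε) with hL
  have hLX : X ≤ L := by
    have := Real.log_le_log hε hεle
    rw [Real.log_exp] at this
    rw [hL, one_div, Real.log_inv]; linarith
  have hε1 : ε ≤ 1 := hεle.trans (by rw [Real.exp_le_one_iff]; linarith)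
  set Y : ℝ := (d:ℝ) * (d + 1) * (L + Real.log c) + 1 with hY
  have hY0 : 0 < Y := by
    have : 0 < L + Real.log c := by linarith
    positivity
  set δ : ℝ := ε / (2 * (d:ℝ)^d) with hδ
  have hδ0 : 0 < δ := by positivity
  have hδ1 : δ ≤ 1 := by rw [hδ, div_le_one (by positivity)]; linarith
  set n := ⌈Y / δ⌉₊ with hn
  have hn1 : Y / δ ≤ n := Nat.le_ceil _
  have hn2 : (n:ℝ) < Y / δ + 1 := Nat.ceil_lt_add_one (by positivity)
  obtain ⟨N, hNc, hNK⟩ := hnet ε hε hε1 n (by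
    have h1 : (1 - δ) ^ n ≤ Real.exp (-Y) := by
      calc (1 - δ) ^ n ≤ (Real.exp (-δ)) ^ n :=
            pow_le_pow_left₀ (by linarith) (Real.one_sub_le_exp_neg δ) n
        _ = Real.exp (-(n * δ)) := by rw [← Real.exp_nat_mul]; congr 1; ring
        _ ≤ Real.exp (-Y) := by
            apply Real.exp_le_exp.2
            rw [div_le_iff₀ hδ0] at hn1
            linarith
    have h2 : (c / ε) ^ (d * (d+1)) = Real.exp ((d:ℝ) * (d + 1) * (L + Real.log c)) := by
      have h3 : c / ε = Real.exp (L + Real.log c) := by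
        rw [Real.exp_add, hL, Real.exp_log (by positivity), Real.exp_log (by linarith)]; ring
      rw [h3, ← Real.exp_nat_mul]; push_cast; rfl
    calc (c / ε) ^ (d * (d+1)) * (1 - δ) ^ n
        ≤ Real.exp ((d:ℝ) * (d + 1) * (L + Real.log c)) * Real.exp (-Y) := by
          rw [h2]; gcongr
      _ = Real.exp (-1) := by rw [← Real.exp_add]; congr 1; rw [hY]; ring
      _ < 1 := by rw [Real.exp_lt_one_iff]; norm_num)
  refine ⟨lbCube d \ ((insert 0 N : Finset (Fin d → ℝ)) : Set (Fin d → ℝ)), ?_, ?_, ?_⟩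
  · have : Nonempty (Fin d) := ⟨⟨0, by omega⟩⟩
    rw [measure_sdiff_null, lbCube_vol]
    exact (Finset.finite_toSet _).measure_zero _
  · intro K hK
    apply hNK K
    intro z hz
    refine ⟨(hK hz).1, fun h => (hK hz).2 ?_⟩
    simp only [Finset.coe_insert]
    exact Set.mem_insert_of_mem _ h
  · refine le_trans ?_ (lb_index d (n+1) (by omega) (insert 0 N) (Finset.insert_nonempty _ _)
      ((Finset.card_insert_le _ _).trans (by omega)))
    apply ENNReal.ofReal_le_ofReal
    have hch : ((d + 2).choose d : ℝ) = (d + 1) * (d + 2) / 2 := by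
      rw [Nat.choose_symm_add, Nat.cast_choose_two]; push_cast; ring
    have hLpos : 0 < L := by linarith
    have hlogb : L ≤ Real.logb 2 (1 / ε) := by
      rw [Real.logb, ← hL, le_div_iff₀ (Real.log_pos (by norm_num))]
      nlinarith [Real.log_two_lt_d9]
    have hkey : ((n + 1 : ℕ) : ℝ) ≤ 2 * (d + 1) * (d + 2) * (d:ℝ)^d * L / ε := by
      push_cast
      have h1 : Y / δ = (2 * (d:ℝ)^d / ε) * Y := by rw [hδ]; field_simp
      have h2 : 2 ≤ 2 * (d:ℝ)^d / ε := by rw [le_div_iff₀ hε]; nlinarith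
      have h3 : Y + 1 ≤ (d + 1) * (d + 2) * L := by
        have : (d + 1 : ℝ) * (d + 2) * L = d * (d + 1) * L + 2 * (d + 1) * L := by ring
        have h5 : L ≤ 2 * (d + 1) * L := le_mul_of_one_le_left hLpos.le (by linarith)
        rw [this, hY]
        linarith
      calc (n:ℝ) + 1 ≤ (2 * (d:ℝ)^d / ε) * (Y + 1) := by linarith
        _ ≤ (2 * (d:ℝ)^d / ε) * ((d + 1) * (d + 2) * L) := by gcongr
        _ = _ := by ring
    rw [hch]
    have hlb0 : 0 < Real.logb 2 (1 / ε) := hLpos.trans_le hlogb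
    calc 1 / (8 * ((d + 1) * (d + 2) / 2) * (d:ℝ)^d) * ε / Real.logb 2 (1 / ε)
        ≤ 1 / (8 * ((d + 1) * (d + 2) / 2) * (d:ℝ)^d) * ε / L := by gcongr
      _ = 1 / (2 * (2 * (d + 1) * (d + 2) * (d:ℝ)^d * L / ε)) := by field_simp; norm_num
      _ ≤ 1 / (2 * ((n + 1 : ℕ) : ℝ)) := by
          apply one_div_le_one_div_of_le (by positivity)
          linarith
end
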